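/- arXiv:1404.6794 — 5 statements merged into one kernel-verified Lean document; each statement's English description precedes it below -/
import Mathlib

section
/- Fix a nonzero scalar q ∈ F that is not a root of unity, and scalars α, α*, a, a′, b, b′, ξ ∈ F. Define θ_i = α + a·q^{2i−d} + a′·q^{d−2i} and θ*_i = α* + b·q^{2i−d} + b′·q^{d−2i} for 0 ≤ i ≤ d, and for 1 ≤ i ≤ d define φ_i = (q^i − q^{−i})(q^{i−d−1} − q^{d−i+1})(ξ + ab·q^{2i−d−1} + a′b′·q^{d−2i+1}) and φ̂_i = (q^i − q^{−i})(q^{i−d−1} − q^{d−i+1})(ξ + a′b·q^{2i−d−1} + ab′·q^{d−2i+1}). Let (A, A*) be a Leonard pair in Mat_{d+1}(F) such that: (a) there exists an invertible U ∈ Mat_{d+1}(F) with U⁻¹AU lower bidiagonal having diagonal entries θ_0,…,θ_d and all subdiagonal entries 1, and U⁻¹A*U upper bidiagonal having diagonal entries θ*_0,…,θ*_d and superdiagonal entries φ_1,…,φ_d; and (b) there exists an invertible W ∈ Mat_{d+1}(F) with W⁻¹AW lower bidiagonal having diagonal entries θ_d,…,θ_0 and all subdiagonal entries 1, and W⁻¹A*W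 upper bidiagonal having diagonal entries θ*_0,…,θ*_d and superdiagonal entries φ̂_1,…,φ̂_d. Then the following are equivalent: (i) there exists an invertible S ∈ Mat_{d+1}(F) such that S⁻¹AS is lower bidiagonal with all subdiagonal entries 1 and S⁻¹A*S is irreducible tridiagonal; (ii) at least two of the three scalars a·a′, b·b′, ξ are nonzero. -/
def IsTridiagonal {F : Type*} [Field F] {n : ℕ} (M : Matrix (Fin n) (Fin n) F) : Prop :=
  ∀ i j : Fin n,
    ¬((i : ℕ) = (j : ℕ) ∨ (i : ℕ) = (j : ℕ) + 1 ∨ (j : ℕ) = (i : ℕ) + 1) → M i j = 0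

def IsIrredTridiagonal {F : Type*} [Field F] {n : ℕ} (M : Matrix (Fin n) (Fin n) F) : Prop :=
  IsTridiagonal M ∧
    ∀ i j : Fin n, ((i : ℕ) = (j : ℕ) + 1 ∨ (j : ℕ) = (i : ℕ) + 1) → M i j ≠ 0

def IsLowerBidiagonal {F : Type*} [Field F] {n : ℕ} (M : Matrix (Fin n) (Fin n) F) : Prop :=
  ∀ i j : Fin n, ¬((i : ℕ) = (j : ℕ) ∨ (i : ℕ) = (j : ℕ) + 1) → M i j = 0

/-- A Leonard pair in `Mat_{n}(F)`: each matrix is irreducible tridiagonal in some basis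
diagonalizing the other one. -/
def IsLeonardPair {F : Type*} [Field F] {n : ℕ} (A As : Matrix (Fin n) (Fin n) F) : Prop :=
  (∃ P : Matrix (Fin n) (Fin n) F, IsUnit P ∧
    IsIrredTridiagonal (P⁻¹ * A * P) ∧ (P⁻¹ * As * P).IsDiag) ∧
  (∃ Q : Matrix (Fin n) (Fin n) F, IsUnit Q ∧
    IsIrredTridiagonal (Q⁻¹ * As * Q) ∧ (Q⁻¹ * A * Q).IsDiag)

section LeonardHelpers

open Matrix hiding zpow_neg

variable {F : Type*} [Field F] {d : ℕ}

/-- The standard basis of column vectors, indexed by `ℤ` and extended by zero. -/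
def stdVec (F : Type*) [Field F] (d : ℕ) (n : ℤ) : Fin (d + 1) → F :=
  fun k => if (k : ℤ) = n then 1 else 0

/-- `M` is tridiagonal with superdiagonal `u`, diagonal `y` and subdiagonal `l`. -/
def IsBand (M : Matrix (Fin (d + 1)) (Fin (d + 1)) F) (u y l : ℤ → F) : Prop :=
  ∀ i j : Fin (d + 1), M i j = if (i : ℤ) = j then y j else if (i : ℤ) = j + 1 then l i
    else if (j : ℤ) = i + 1 then u j else 0

lemma stdVec_apply_of_ne {n : ℤ} {k : Fin (d + 1)} (h : (k : ℤ) ≠ n) : stdVec F d n k = 0 := by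
  simp [stdVec, h]

lemma stdVec_coe (j : Fin (d + 1)) : stdVec F d j = Pi.single j 1 := by
  ext k
  simp [stdVec, Pi.single_apply, Fin.ext_iff]

lemma stdVec_eq_zero {n : ℤ} (h : n < 0 ∨ (d : ℤ) < n) : stdVec F d n = 0 := by
  ext k
  have := k.2
  exact stdVec_apply_of_ne (by omega)

lemma IsBand.mulVec_stdVec {M : Matrix (Fin (d + 1)) (Fin (d + 1)) F} {u y l : ℤ → F}
    (h : IsBand M u y l) (hl : l 0 = 0) (hu : u (d + 1) = 0) (n : ℤ) :
    M *ᵥ stdVec F d n = u n • stdVec F d (n - 1) + y n • stdVec F d n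
      + l (n + 1) • stdVec F d (n + 1) := by
  by_cases hn : n < 0 ∨ (d : ℤ) < n
  · rw [stdVec_eq_zero hn, mulVec_zero]
    rcases hn with hn | hn
    · rw [stdVec_eq_zero (n := n - 1) (by omega)]
      by_cases h0 : n = -1
      · subst h0; simp [hl]
      · rw [stdVec_eq_zero (n := n + 1) (by omega)]; simp
    · rw [stdVec_eq_zero (n := n + 1) (by omega)]
      by_cases h0 : n = d + 1
      · subst h0; simp [hu]
      · rw [stdVec_eq_zero (n := n - 1) (by omega)]; simp
  · push Not at hn
    obtain ⟨m, rfl⟩ : ∃ m : ℕ, n = m := ⟨n.toNat, by omega⟩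
    have hm : m < d + 1 := by omega
    have := stdVec_coe (F := F) (⟨m, hm⟩ : Fin (d + 1))
    simp only at this
    rw [this, mulVec_single_one, ← this]
    ext i
    have hi := h i ⟨m, hm⟩
    simp only at hi
    simp only [col_apply, hi, Pi.add_apply, Pi.smul_apply, smul_eq_mul, stdVec]
    by_cases h1 : (i : ℤ) = m
    · have h4 : (m : ℤ) ≠ m - 1 := by omega
      simp [h1, h4]
    · by_cases h2 : (i : ℤ) = m + 1
      · have h4 : (m : ℤ) + 1 ≠ m - 1 := by omega
        simp [h2, h4]
      · by_cases h3 : (m : ℤ) = i + 1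
        · have h4 : (i : ℤ) = m - 1 := by omega
          have h5 : (m : ℤ) - 1 ≠ m + 1 := by omega
          simp [h4, h5]
        · have h4 : (i : ℤ) ≠ m - 1 := by omega
          simp [h1, h2, h3, h4]

lemma ext_stdVec {M N : Matrix (Fin (d + 1)) (Fin (d + 1)) F}
    (h : ∀ n : ℤ, 0 ≤ n → n ≤ d → M *ᵥ stdVec F d n = N *ᵥ stdVec F d n) : M = N := by
  refine Matrix.ext_of_mulVec_single fun j => ?_
  rw [← stdVec_coe]
  have := j.2
  exact h j (by omega) (by omega)

/-- The cubic expression `A²B - β ABA + BA²` on a basis in which `A` is lower bidiagonal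
and `B` is tridiagonal. -/
lemma cubic_left_mulVec {A B : Matrix (Fin (d + 1)) (Fin (d + 1)) F} {x ε z y w : ℤ → F} {e : ℤ → Fin (d + 1) → F}
    (hA : ∀ n, A *ᵥ e n = x n • e n + ε (n + 1) • e (n + 1))
    (hB : ∀ n, B *ᵥ e n = z n • e (n - 1) + y n • e n + w (n + 1) • e (n + 1))
    (β : F) (n : ℤ) :
    (A * A * B - β • (A * B * A) + B * A * A) *ᵥ e n =
      (z n * (x (n - 1) ^ 2 - β * (x n * x (n - 1)) + x n ^ 2)) • e (n - 1)
      + (ε n * z n * (x (n - 1) + x n - β * x n) + ε (n + 1) * z (n + 1) * (x n + x (n + 1) - β * x n)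
          + y n * (2 - β) * x n ^ 2) • e n
      + (ε n * ε (n + 1) * z n - β * (ε (n + 1) * ε (n + 1) * z (n + 1)) + ε (n + 1) * ε (n + 2) * z (n + 2)
          + ε (n + 1) * ((x n + x (n + 1)) * (y n + y (n + 1)) - β * (x n * y n + x (n + 1) * y (n + 1)))
          + w (n + 1) * (x n ^ 2 - β * (x n * x (n + 1)) + x (n + 1) ^ 2)) • e (n + 1)
      + (ε (n + 1) * ε (n + 2) * (y n - β * y (n + 1) + y (n + 2))
          + ε (n + 2) * w (n + 1) * (x (n + 1) + x (n + 2) - β * x n)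
          + ε (n + 1) * w (n + 2) * (x n + x (n + 1) - β * x (n + 2))) • e (n + 2)
      + (ε (n + 2) * ε (n + 3) * w (n + 1) - β * (ε (n + 1) * ε (n + 3) * w (n + 2))
          + ε (n + 1) * ε (n + 2) * w (n + 3)) • e (n + 3) := by
  simp only [add_mulVec, sub_mulVec, smul_mulVec, ← mulVec_mulVec, hA, hB, mulVec_add, mulVec_smul]
  have e1 : n - 1 + 1 = n := by ring
  have e2 : n + 1 - 1 = n := by ring
  have e3 : n + 1 + 1 = n + 2 := by ring
  have e4 : n + 2 - 1 = n + 1 := by ring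
  have e5 : n + 2 + 1 = n + 3 := by ring
  simp only [e1, e2, e3, e4, e5]
  module

/-- The cubic expression `B²A - β BAB + AB²` on a basis in which `A` is lower bidiagonal
and `B` is tridiagonal. -/
lemma cubic_right_mulVec {A B : Matrix (Fin (d + 1)) (Fin (d + 1)) F} {x ε z y w : ℤ → F} {e : ℤ → Fin (d + 1) → F}
    (hA : ∀ n, A *ᵥ e n = x n • e n + ε (n + 1) • e (n + 1))
    (hB : ∀ n, B *ᵥ e n = z n • e (n - 1) + y n • e n + w (n + 1) • e (n + 1))
    (β : F) (n : ℤ) :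
    (B * B * A - β • (B * A * B) + A * B * B) *ᵥ e n =
      (z n * z (n - 1) * (x n - β * x (n - 1) + x (n - 2))) • e (n - 2)
      + (x n * (z n * (y (n - 1) + y n)) + ε (n + 1) * z n * z (n + 1)
          + ε (n - 1) * z n * z (n - 1) + x (n - 1) * (z n * (y (n - 1) + y n))
          - β * (z n * x (n - 1) * y (n - 1) + (ε n * z n + y n * x n) * z n)) • e (n - 1)
      + (x n * (y n ^ 2 + z n * w n + z (n + 1) * w (n + 1)) + ε (n + 1) * z (n + 1) * (y n + y (n + 1))
          + x n * (y n ^ 2 + z n * w n + z (n + 1) * w (n + 1)) + ε n * z n * (y n + y (n - 1))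
          - β * (z n * x (n - 1) * w n + (ε n * z n + y n * x n) * y n
            + (ε (n + 1) * y n + w (n + 1) * x (n + 1)) * z (n + 1))) • e n
      + (w (n + 1) * (x n + x (n + 1)) * (y n + y (n + 1))
          + ε (n + 1) * (y n ^ 2 + y (n + 1) ^ 2)
          + ε (n + 1) * (2 * z (n + 1) * w (n + 1) + z (n + 2) * w (n + 2) + z n * w n)
          - β * ((ε n * z n + y n * x n) * w (n + 1) + (ε (n + 1) * y n + w (n + 1) * x (n + 1)) * y (n + 1)
            + ε (n + 2) * w (n + 1) * z (n + 2))) • e (n + 1)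
      + (w (n + 1) * w (n + 2) * (x n - β * x (n + 1) + x (n + 2))
          + ε (n + 1) * w (n + 2) * (y (n + 1) + y (n + 2)) + ε (n + 2) * w (n + 1) * (y n + y (n + 1))
          - β * (ε (n + 1) * y n * w (n + 2) + ε (n + 2) * w (n + 1) * y (n + 2))) • e (n + 2)
      + (ε (n + 1) * w (n + 2) * w (n + 3) - β * (ε (n + 2) * w (n + 1) * w (n + 3))
          + ε (n + 3) * w (n + 1) * w (n + 2)) • e (n + 3) := by
  simp only [add_mulVec, sub_mulVec, smul_mulVec, ← mulVec_mulVec, hA, hB, mulVec_add, mulVec_smul]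
  have e1 : n - 1 + 1 = n := by ring
  have e2 : n + 1 - 1 = n := by ring
  have e3 : n + 1 + 1 = n + 2 := by ring
  have e4 : n + 2 - 1 = n + 1 := by ring
  have e5 : n + 2 + 1 = n + 3 := by ring
  have e6 : n - 1 - 1 = n - 2 := by ring
  have e7 : n - 2 + 1 = n - 1 := by ring
  simp only [e1, e2, e3, e4, e5, e6, e7]
  module

/-- The scalars `a q^(2n-d) + a' q^(d-2n)`. -/
def qEig (q : F) (d : ℕ) (a a' : F) (n : ℤ) : F :=
  a * q ^ (2 * n - (d : ℤ)) + a' * q ^ ((d : ℤ) - 2 * n)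

/-- The split sequence attached to the eigenvalue parameters and `ξ`. -/
def qSplit (q : F) (d : ℕ) (a a' b b' ξ : F) (n : ℤ) : F :=
  (q ^ n - q ^ (-n)) * (q ^ (n - (d : ℤ) - 1) - q ^ ((d : ℤ) - n + 1)) *
    (ξ + a * b * q ^ (2 * n - (d : ℤ) - 1) + a' * b' * q ^ ((d : ℤ) - 2 * n + 1))

lemma qEig_add {q : F} (hq : q ≠ 0) (a a' : F) (n k : ℤ) :
    qEig q d a a' (n + k) =
      a * (q ^ (2 * k) * q ^ (2 * n - (d : ℤ))) + a' * (q ^ (2 * k) * q ^ (2 * n - (d : ℤ)))⁻¹ := by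
  rw [qEig, ← zpow_add₀ hq, ← zpow_neg]
  congr 3 <;> ring_nf

lemma qSplit_add {q : F} (hq : q ≠ 0) (a a' b b' ξ : F) (n k : ℤ) {K P : F}
    (hK : K = q ^ (2 * n - (d : ℤ))) (hP : P = q ^ ((d : ℤ) + 1)) :
    qSplit q d a a' b b' ξ (n + k) =
      (q ^ (2 * k - 1) * K + (q ^ (2 * k - 1) * K)⁻¹ - P - P⁻¹) *
        (ξ + a * b * (q ^ (2 * k - 1) * K) + a' * b' * (q ^ (2 * k - 1) * K)⁻¹) := by
  subst hK hP
  rw [qSplit, ← zpow_add₀ hq, ← zpow_neg, ← zpow_neg]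
  congr 1
  · rw [mul_sub, sub_mul, sub_mul, ← zpow_add₀ hq, ← zpow_add₀ hq, ← zpow_add₀ hq, ← zpow_add₀ hq]
    have e1 : n + k + (n + k - d - 1) = 2 * k - 1 + (2 * n - d) := by ring
    have e2 : -(n + k) + (n + k - d - 1) = -((d : ℤ) + 1) := by ring
    have e3 : n + k + (d - (n + k) + 1) = (d : ℤ) + 1 := by ring
    have e4 : -(n + k) + (d - (n + k) + 1) = -(2 * k - 1 + (2 * n - d)) := by ring
    rw [e1, e2, e3, e4]
    ring
  · congr 3 <;> ring_nf

lemma qSplit_zero (q : F) (d : ℕ) (a a' b b' ξ : F) : qSplit q d a a' b b' ξ 0 = 0 := by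
  simp [qSplit]

/-- The first Askey-Wilson relation. -/
def AskeyWilsonLeft (q : F) (d : ℕ) (a a' b b' ξ : F) (A B : Matrix (Fin (d + 1)) (Fin (d + 1)) F) :
    Prop :=
  A * A * B - (q ^ 2 + (q⁻¹) ^ 2) • (A * B * A) + B * A * A =
    (-(a * a') * (q ^ 2 - (q⁻¹) ^ 2) ^ 2) • B
    + (-(q - q⁻¹) ^ 2 * ((a + a') * (b + b') - ξ * (q ^ ((d : ℤ) + 1) + (q ^ ((d : ℤ) + 1))⁻¹))) • A
    + (-(q - q⁻¹) ^ 2 * (q + q⁻¹) * ((a + a') * ξ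
      - a * a' * (b + b') * (q ^ ((d : ℤ) + 1) + (q ^ ((d : ℤ) + 1))⁻¹))) • (1 : Matrix _ _ F)

/-- The second Askey-Wilson relation. -/
def AskeyWilsonRight (q : F) (d : ℕ) (a a' b b' ξ : F) (A B : Matrix (Fin (d + 1)) (Fin (d + 1)) F) :
    Prop :=
  B * B * A - (q ^ 2 + (q⁻¹) ^ 2) • (B * A * B) + A * B * B =
    (-(b * b') * (q ^ 2 - (q⁻¹) ^ 2) ^ 2) • A
    + (-(q - q⁻¹) ^ 2 * ((a + a') * (b + b') - ξ * (q ^ ((d : ℤ) + 1) + (q ^ ((d : ℤ) + 1))⁻¹))) • B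
    + (-(q - q⁻¹) ^ 2 * (q + q⁻¹) * ((b + b') * ξ
      - b * b' * (a + a') * (q ^ ((d : ℤ) + 1) + (q ^ ((d : ℤ) + 1))⁻¹))) • (1 : Matrix _ _ F)

section Split

variable {q a a' b b' ξ : F} {A B : Matrix (Fin (d + 1)) (Fin (d + 1)) F} {ε : ℤ → F}

lemma askeyWilsonLeft_of_split (hq : q ≠ 0) (hε : ∀ n, 1 ≤ n → ε n = 1)
    (hA : ∀ n, A *ᵥ stdVec F d n = qEig q d a a' n • stdVec F d n + ε (n + 1) • stdVec F d (n + 1))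
    (hB : ∀ n, B *ᵥ stdVec F d n = qSplit q d a a' b b' ξ n • stdVec F d (n - 1)
      + qEig q d b b' n • stdVec F d n) : AskeyWilsonLeft q d a a' b b' ξ A B := by
  refine ext_stdVec fun n hn _ => ?_
  have hB' : ∀ n, B *ᵥ stdVec F d n = qSplit q d a a' b b' ξ n • stdVec F d (n - 1)
      + qEig q d b b' n • stdVec F d n + (0 : ℤ → F) (n + 1) • stdVec F d (n + 1) := by
    simpa using hB
  have h0 : ε n * qSplit q d a a' b b' ξ n = qSplit q d a a' b b' ξ n := by
    rcases hn.eq_or_lt with rfl | h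
    · simp [qSplit_zero]
    · rw [hε n (by omega), one_mul]
  rw [cubic_left_mulVec hA hB']
  simp only [add_mulVec, smul_mulVec, hA, hB, one_mulVec, hε (n + 1) (by omega), hε (n + 2) (by omega),
    hε (n + 3) (by omega), h0, Pi.zero_apply, zero_mul, mul_zero, add_zero, mul_one, one_mul, sub_zero, zero_smul]
  have hK0 : q ^ (2 * n - (d : ℤ)) ≠ 0 := zpow_ne_zero _ hq
  have hP0 : q ^ ((d : ℤ) + 1) ≠ 0 := zpow_ne_zero _ hq
  have hx := qEig_add (d := d) hq a a' n
  have hy := qEig_add (d := d) hq b b' n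
  have hz := fun k => qSplit_add hq a a' b b' ξ n k (d := d) rfl rfl
  have x0 := hx 0
  have x1 := hx 1
  have x3 := hx (-1)
  have y0 := hy 0
  have y1 := hy 1
  have y2 := hy 2
  have z0 := hz 0
  have z1 := hz 1
  have z2 := hz 2
  generalize q ^ (2 * n - (d : ℤ)) = K at *
  generalize q ^ ((d : ℤ) + 1) = P at *
  rw [← sub_eq_add_neg] at x3
  rw [add_zero] at x0 y0 z0
  norm_num at x0 x1 x3 y0 y1 y2 z0 z1 z2
  match_scalars <;> simp only [x0, x1, x3, y0, y1, y2, z0, z1, z2] <;> field_simp <;> ring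

lemma askeyWilsonRight_of_split (hq : q ≠ 0) (hε : ∀ n, 1 ≤ n → ε n = 1)
    (hA : ∀ n, A *ᵥ stdVec F d n = qEig q d a a' n • stdVec F d n + ε (n + 1) • stdVec F d (n + 1))
    (hB : ∀ n, B *ᵥ stdVec F d n = qSplit q d a a' b b' ξ n • stdVec F d (n - 1)
      + qEig q d b b' n • stdVec F d n) : AskeyWilsonRight q d a a' b b' ξ A B := by
  refine ext_stdVec fun n hn _ => ?_
  have hB' : ∀ n, B *ᵥ stdVec F d n = qSplit q d a a' b b' ξ n • stdVec F d (n - 1)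
      + qEig q d b b' n • stdVec F d n + (0 : ℤ → F) (n + 1) • stdVec F d (n + 1) := by
    simpa using hB
  have h0 : ε n * qSplit q d a a' b b' ξ n = qSplit q d a a' b b' ξ n := by
    rcases hn.eq_or_lt with rfl | h
    · simp [qSplit_zero]
    · rw [hε n (by omega), one_mul]
  have h1 : ε (n - 1) * qSplit q d a a' b b' ξ n * qSplit q d a a' b b' ξ (n - 1) =
      qSplit q d a a' b b' ξ n * qSplit q d a a' b b' ξ (n - 1) := by
    by_cases hn0 : n = 0
    · simp [hn0, qSplit_zero]
    by_cases hn1 : n = 1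
    · simp [hn1, qSplit_zero]
    · rw [hε (n - 1) (by omega), one_mul]
  rw [cubic_right_mulVec hA hB']
  simp only [add_mulVec, smul_mulVec, hA, hB, one_mulVec, hε (n + 1) (by omega), hε (n + 2) (by omega),
    hε (n + 3) (by omega), h0, h1, Pi.zero_apply, zero_mul, mul_zero, add_zero, one_mul, sub_zero,
    zero_smul]
  have hK0 : q ^ (2 * n - (d : ℤ)) ≠ 0 := zpow_ne_zero _ hq
  have hP0 : q ^ ((d : ℤ) + 1) ≠ 0 := zpow_ne_zero _ hq
  have hx := qEig_add (d := d) hq a a' n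
  have hy := qEig_add (d := d) hq b b' n
  have hz := fun k => qSplit_add hq a a' b b' ξ n k (d := d) rfl rfl
  have x0 := hx 0
  have x1 := hx (-1)
  have x2 := hx (-2)
  have y0 := hy 0
  have y1 := hy 1
  have y2 := hy (-1)
  have z0 := hz 0
  have z1 := hz 1
  have z2 := hz (-1)
  generalize q ^ (2 * n - (d : ℤ)) = K at *
  generalize q ^ ((d : ℤ) + 1) = P at *
  rw [← sub_eq_add_neg] at x1 x2 y2 z2
  rw [add_zero] at x0 y0 z0
  norm_num at x0 x1 x2 y0 y1 y2 z0 z1 z2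
  match_scalars <;> simp only [x0, x1, x2, y0, y1, y2, z0, z1, z2] <;> field_simp <;> ring

end Split

section Similarity

lemma vecMul_lowerBidiagonal {L : Matrix (Fin (d + 1)) (Fin (d + 1)) F} (hL : IsLowerBidiagonal L)
    (h1 : ∀ i j : Fin (d + 1), (i : ℕ) = (j : ℕ) + 1 → L i j = 1) (g : Fin (d + 1) → F) (k : ℕ)
    (hk : k + 1 < d + 1) :
    (g ᵥ* L) ⟨k, by omega⟩ = g ⟨k, by omega⟩ * L ⟨k, by omega⟩ ⟨k, by omega⟩ + g ⟨k + 1, hk⟩ := by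
  have h2 := h1 ⟨k + 1, hk⟩ ⟨k, by omega⟩ rfl
  simp only [vecMul, dotProduct]
  rw [Fintype.sum_eq_add ⟨k, by omega⟩ ⟨k + 1, hk⟩ (by simp [Fin.ext_iff]), h2, mul_one]
  rintro i ⟨hi, hi'⟩
  rw [hL, mul_zero]
  simp only [ne_eq, Fin.ext_iff] at hi hi' ⊢
  omega

/-- A diagonal matrix similar to a lower bidiagonal matrix with subdiagonal entries `1` has
mutually distinct diagonal entries. -/
lemma injective_of_diagonal_similar {δ : Fin (d + 1) → F} {G L : Matrix (Fin (d + 1)) (Fin (d + 1)) F}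
    (hG : IsUnit G) (hDG : diagonal δ * G = G * L) (hL : IsLowerBidiagonal L)
    (h1 : ∀ i j : Fin (d + 1), (i : ℕ) = (j : ℕ) + 1 → L i j = 1) : Function.Injective δ := by
  have hinj := vecMul_injective_of_isUnit hG
  have hrec : ∀ i : Fin (d + 1), ∀ k : ℕ, ∀ hk : k + 1 < d + 1,
      G i ⟨k + 1, hk⟩ = (δ i - L ⟨k, by omega⟩ ⟨k, by omega⟩) * G i ⟨k, by omega⟩ := by
    intro i k hk
    have e := vecMul_lowerBidiagonal hL h1 (G i) k hk
    have e' : (G i ᵥ* L) ⟨k, by omega⟩ = δ i * G i ⟨k, by omega⟩ := by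
      have := congrFun (congrFun hDG i) ⟨k, by omega⟩
      rw [diagonal_mul, mul_apply_eq_vecMul] at this
      exact this.symm
    linear_combination e' - e
  have hne : ∀ i : Fin (d + 1), G i 0 ≠ 0 := by
    intro i h0
    have hz : ∀ k : ℕ, ∀ hk : k < d + 1, G i ⟨k, hk⟩ = 0 := by
      intro k
      induction k with
      | zero => intro _; exact h0
      | succ k ih => intro hk; rw [hrec i k hk, ih, mul_zero]
    have : (Pi.single i 1 : Fin (d + 1) → F) = 0 := by
      apply hinj
      ext k
      simpa using hz k k.2
    simpa using congrFun this i
  intro i j hij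
  by_contra hne'
  have hz : ∀ k : ℕ, ∀ hk : k < d + 1, G i 0 * G j ⟨k, hk⟩ = G j 0 * G i ⟨k, hk⟩ := by
    intro k
    induction k with
    | zero => intro _; exact mul_comm _ _
    | succ k ih =>
      intro hk
      rw [hrec i k hk, hrec j k hk, hij]
      linear_combination (δ j - L ⟨k, by omega⟩ ⟨k, by omega⟩) * ih (by omega)
  have : (G i 0 • Pi.single j 1 - G j 0 • Pi.single i 1 : Fin (d + 1) → F) = 0 := by
    apply hinj
    ext k
    have := hz k k.2
    simp only [sub_vecMul, smul_vecMul, single_one_vecMul, zero_vecMul, Pi.sub_apply, Pi.smul_apply,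
      smul_eq_mul, Pi.zero_apply, row_apply]
    linear_combination this
  have := congrFun this j
  simp [Ne.symm hne'] at this
  exact hne i this

lemma diag_injective_of_similar {δ : Fin (d + 1) → F} {G L : Matrix (Fin (d + 1)) (Fin (d + 1)) F}
    (hG : IsUnit G) (hDG : diagonal δ * G = G * L) (hL : IsLowerBidiagonal L)
    (h1 : ∀ i j : Fin (d + 1), (i : ℕ) = (j : ℕ) + 1 → L i j = 1) :
    Function.Injective fun i => L i i := by
  have hδ := injective_of_diagonal_similar hG hDG hL h1
  obtain ⟨u, rfl⟩ := hG
  have hc : (diagonal δ).charpoly = L.charpoly := by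
    have : L = (↑u⁻¹ : Matrix _ _ F) * diagonal δ * u.val := by
      rw [mul_assoc, hDG, ← mul_assoc]; simp
    rw [this, coe_units_inv, charpoly_units_conj']
  have hL' : Lᵀ.IsUpperTriangular := by
    intro i j hij
    refine hL j i ?_
    simp only [id, Fin.lt_def] at hij
    omega
  rw [charpoly_diagonal, ← charpoly_transpose, charpoly_of_isUpperTriangular _ hL'] at hc
  have hr := congrArg Polynomial.roots hc
  have hroots : ∀ f : Fin (d + 1) → F,
      (∏ i, (Polynomial.X - Polynomial.C (f i))).roots = Finset.univ.val.map f := by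
    intro f
    rw [← Polynomial.roots_multiset_prod_X_sub_C (Finset.univ.val.map f), Multiset.map_map]
    rfl
  rw [hroots, hroots] at hr
  have hnd := Finset.univ.nodup.map hδ
  rw [hr] at hnd
  intro i j hij
  exact Multiset.inj_on_of_nodup_map hnd i (Finset.mem_univ i) j (Finset.mem_univ j) hij

lemma single_mem_of_mem {N : Submodule F (Fin (d + 1) → F)} {δ : Fin (d + 1) → F}
    (hδ : Function.Injective δ) (hN : ∀ v ∈ N, v ᵥ* diagonal δ ∈ N) {v : Fin (d + 1) → F} (hv : v ∈ N)
    {j : Fin (d + 1)} (hj : v j ≠ 0) : Pi.single j 1 ∈ N := by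
  have key : ∀ s : Finset (Fin (d + 1)), (fun k => v k * ∏ i ∈ s, (δ k - δ i)) ∈ N := by
    intro s
    induction s using Finset.induction_on with
    | empty => simpa using hv
    | insert i s hi ih =>
      convert N.sub_mem (hN _ ih) (N.smul_mem (δ i) ih) using 1
      ext k
      simp only [Finset.prod_insert hi, vecMul_diagonal, Pi.sub_apply, Pi.smul_apply, smul_eq_mul]
      ring
  have hp : ∏ i ∈ Finset.univ.erase j, (δ j - δ i) ≠ 0 := by
    refine Finset.prod_ne_zero_iff.2 fun i hi => sub_ne_zero.2 fun h => ?_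
    exact Finset.ne_of_mem_erase hi (hδ h).symm
  convert N.smul_mem (v j * ∏ i ∈ Finset.univ.erase j, (δ j - δ i))⁻¹ (key (Finset.univ.erase j)) using 1
  ext k
  by_cases hk : k = j
  · subst hk
    rw [Pi.single_eq_same, Pi.smul_apply, smul_eq_mul, inv_mul_cancel₀ (mul_ne_zero hj hp)]
  · have h0 : ∏ i ∈ Finset.univ.erase j, (δ k - δ i) = 0 :=
      Finset.prod_eq_zero (Finset.mem_erase.2 ⟨hk, Finset.mem_univ k⟩) (sub_self _)
    rw [Pi.single_eq_of_ne hk, Pi.smul_apply, h0, mul_zero, smul_zero]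

/-- A Leonard pair acts irreducibly: `A` lower bidiagonal forces the other matrix to have no
vanishing upper right block. -/
lemma exists_ne_zero_of_irred {δ : Fin (d + 1) → F} {G L T M : Matrix (Fin (d + 1)) (Fin (d + 1)) F}
    (hG : IsUnit G) (hDG : diagonal δ * G = G * L) (hTG : T * G = G * M) (hL : IsLowerBidiagonal L)
    (h1 : ∀ i j : Fin (d + 1), (i : ℕ) = (j : ℕ) + 1 → L i j = 1) (hT : IsIrredTridiagonal T)
    {m : ℕ} (hm : 1 ≤ m) (hmd : m ≤ d) :
    ∃ i j : Fin (d + 1), (i : ℕ) < m ∧ m ≤ (j : ℕ) ∧ M i j ≠ 0 := by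
  by_contra! hM
  have hδ := injective_of_diagonal_similar hG hDG hL h1
  let N : Submodule F (Fin (d + 1) → F) :=
    { carrier := {r | ∀ k : Fin (d + 1), m ≤ (k : ℕ) → (r ᵥ* G) k = 0}
      add_mem' := by
        intro r s hr hs k hk
        rw [add_vecMul, Pi.add_apply, hr k hk, hs k hk, add_zero]
      zero_mem' := by
        intro k _
        rw [zero_vecMul, Pi.zero_apply]
      smul_mem' := by
        intro c r hr k hk
        rw [smul_vecMul, Pi.smul_apply, hr k hk, smul_zero] }
  have hstable : ∀ X Y : Matrix (Fin (d + 1)) (Fin (d + 1)) F, X * G = G * Y →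
      (∀ i j : Fin (d + 1), (i : ℕ) < m → m ≤ (j : ℕ) → Y i j = 0) → ∀ v ∈ N, v ᵥ* X ∈ N := by
    intro X Y hXY hY v hv k hk
    rw [vecMul_vecMul, hXY, ← vecMul_vecMul]
    change ∑ i, (v ᵥ* G) i * Y i k = 0
    refine Finset.sum_eq_zero fun i _ => ?_
    by_cases hi : (i : ℕ) < m
    · rw [hY i k hi hk, mul_zero]
    · rw [hv i (by omega), zero_mul]
  have hND := hstable _ _ hDG fun i j hi hj => hL i j (by omega)
  have hNT := hstable _ _ hTG hM
  have hinv : G⁻¹ * G = 1 := nonsing_inv_mul _ ((isUnit_iff_isUnit_det _).1 hG)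
  have hrow : ∀ i k : Fin (d + 1), (G⁻¹ i ᵥ* G) k = (1 : Matrix (Fin (d + 1)) (Fin (d + 1)) F) i k := by
    intro i k
    rw [← hinv, mul_apply_eq_vecMul]
  have h0 : G⁻¹ 0 ∈ N := by
    intro k hk
    rw [hrow, one_apply_ne]
    intro h
    rw [← h] at hk
    simp at hk
    omega
  obtain ⟨j, hj⟩ : ∃ j, G⁻¹ 0 j ≠ 0 := by
    by_contra! h
    have h' : G⁻¹ 0 = 0 := funext h
    have := hrow 0 0
    rw [h', zero_vecMul] at this
    simp at this
  have hj := single_mem_of_mem hδ hND h0 hj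
  have hstep : ∀ i k : Fin (d + 1), ((i : ℕ) = k + 1 ∨ (k : ℕ) = i + 1) →
      Pi.single i 1 ∈ N → Pi.single k 1 ∈ N := by
    intro i k hik hi
    have := hNT _ hi
    rw [single_one_vecMul] at this
    exact single_mem_of_mem hδ hND this (hT.2 i k hik)
  have hdown : ∀ k : ℕ, ∀ hk : k < d + 1, Pi.single ⟨k, hk⟩ 1 ∈ N → Pi.single (0 : Fin (d + 1)) 1 ∈ N := by
    intro k
    induction k with
    | zero => intro _ h; exact h
    | succ k ih => intro hk h; exact ih (by omega) (hstep _ _ (Or.inl rfl) h)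
  have hup : ∀ k : ℕ, ∀ hk : k < d + 1, Pi.single ⟨k, hk⟩ 1 ∈ N := by
    intro k
    induction k with
    | zero => intro _; exact hdown j j.2 hj
    | succ k ih => intro hk; exact hstep _ _ (Or.inr rfl) (ih (by omega))
  have htop : G⁻¹ (Fin.last d) ∈ N := by
    rw [pi_eq_sum_univ' (G⁻¹ (Fin.last d))]
    refine N.sum_mem fun i _ => N.smul_mem _ ?_
    exact hup i i.2
  have := htop (Fin.last d) (by simpa using hmd)
  rw [hrow] at this
  simp at this

end Similarity

section Recurrence

lemma exists_eq_of_homogeneous_rec {q : F} (hq : q ≠ 0) (hq4 : q ^ 4 ≠ 1) {f : ℤ → F} {lo hi : ℤ}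
    (hf : ∀ n, lo ≤ n → n + 2 ≤ hi → f n - (q ^ 2 + q⁻¹ ^ 2) * f (n + 1) + f (n + 2) = 0) (c : ℤ) :
    ∃ g g' : F, ∀ n, lo ≤ n → n ≤ hi → f n = g * q ^ (2 * n - c) + g' * (q ^ (2 * n - c))⁻¹ := by
  have hstep : ∀ n : ℤ, q ^ (2 * (n + 1) - c) = q ^ 2 * q ^ (2 * n - c) := by
    intro n
    rw [← zpow_natCast, ← zpow_add₀ hq]
    congr 1
    push_cast
    ring
  have hK : q ^ (2 * lo - c) ≠ 0 := zpow_ne_zero _ hq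
  have hD : q ^ 4 - 1 ≠ 0 := sub_ne_zero.2 hq4
  refine ⟨(q ^ 2 * f (lo + 1) - f lo) / ((q ^ 4 - 1) * q ^ (2 * lo - c)),
    (q ^ 4 * f lo - q ^ 2 * f (lo + 1)) * q ^ (2 * lo - c) / (q ^ 4 - 1), ?_⟩
  set g := (q ^ 2 * f (lo + 1) - f lo) / ((q ^ 4 - 1) * q ^ (2 * lo - c)) with hg
  set g' := (q ^ 4 * f lo - q ^ 2 * f (lo + 1)) * q ^ (2 * lo - c) / (q ^ 4 - 1) with hg'
  have key : ∀ k : ℕ, (lo + k ≤ hi → f (lo + k) = g * q ^ (2 * (lo + k) - c) + g' * (q ^ (2 * (lo + k) - c))⁻¹) ∧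
      (lo + k + 1 ≤ hi → f (lo + k + 1) = g * q ^ (2 * (lo + k + 1) - c)
        + g' * (q ^ (2 * (lo + k + 1) - c))⁻¹) := by
    intro k
    induction k with
    | zero =>
      refine ⟨fun _ => ?_, fun _ => ?_⟩
      · rw [hg, hg']
        push_cast
        rw [add_zero]
        field_simp
        ring
      · rw [hg, hg', hstep]
        push_cast
        rw [add_zero]
        field_simp
        ring
    | succ k ih =>
      refine ⟨fun h => ?_, fun h => ?_⟩
      · push_cast at h ⊢
        rw [← add_assoc]
        exact ih.2 (by omega)
      · push_cast at h ⊢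
        have h1 := ih.1 (by omega)
        have h2 := ih.2 (by omega)
        have h3 := hf (lo + k) (by omega) (by omega)
        have e : lo + ((k : ℤ) + 1) + 1 = lo + k + 2 := by ring
        have e' : lo + (k : ℤ) + 2 = lo + k + 1 + 1 := by ring
        rw [e]
        have hK' : q ^ (2 * (lo + k) - c) ≠ 0 := zpow_ne_zero _ hq
        have : f (lo + k + 2) = (q ^ 2 + q⁻¹ ^ 2) * f (lo + k + 1) - f (lo + k) := by
          linear_combination h3
        rw [this, h1, h2, e', hstep (lo + k + 1), hstep (lo + k)]
        field_simp
        ring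
  intro n hn hn'
  have := (key (n - lo).toNat).1 (by omega)
  rwa [show lo + ((n - lo).toNat : ℤ) = n by omega] at this

lemma sum_zpow_mul_sub_inv {q : F} (hq : q ≠ 0) (d : ℕ) :
    (∑ n ∈ Finset.range (d + 1), q ^ (2 * (n : ℤ) - (d : ℤ))) * (q - q⁻¹) =
      q ^ ((d : ℤ) + 1) - (q ^ ((d : ℤ) + 1))⁻¹ := by
  have key : ∀ N : ℕ, (∑ n ∈ Finset.range N, q ^ (2 * (n : ℤ) - (d : ℤ))) * (q - q⁻¹) =
      q ^ (2 * (N : ℤ) - d - 1) - q ^ (-(d : ℤ) - 1) := by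
    intro N
    induction N with
    | zero => simp
    | succ N ih =>
      rw [Finset.sum_range_succ, add_mul, ih, mul_sub, ← zpow_add_one₀ hq, ← zpow_sub_one₀ hq]
      push_cast
      ring_nf
  rw [key, ← _root_.zpow_neg]
  push_cast
  ring_nf

lemma lowerBidiagonal_tridiagonal_relation {q : F} (hq : q ≠ 0) (hqr : ∀ n : ℕ, 1 ≤ n → q ^ n ≠ 1)
    (hd : 2 ≤ d) {a a' c σ π ξ β ω ρ P : F} {x y z w : ℤ → F}
    (hβ : β = q ^ 2 + q⁻¹ ^ 2) (hP : P = q ^ ((d : ℤ) + 1))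
    (hω : ω = -(q - q⁻¹) ^ 2 * ((a + a') * σ - ξ * (P + P⁻¹)))
    (hρ : ρ = -π * (q ^ 2 - q⁻¹ ^ 2) ^ 2)
    (hx : ∀ n, 0 ≤ n → n ≤ (d : ℤ) → x n = a * q ^ (2 * n - (d : ℤ)) + a' * (q ^ (2 * n - (d : ℤ)))⁻¹)
    (hw : ∀ n, 1 ≤ n → n ≤ (d : ℤ) → w n = c * q ^ (2 * n - (d : ℤ)))
    (hc : c ≠ 0)
    (hy : ∀ n, 0 ≤ n → n + 2 ≤ (d : ℤ) → y n - β * y (n + 1) + y (n + 2)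
      + w (n + 1) * (x (n + 1) + x (n + 2) - β * x n) + w (n + 2) * (x n + x (n + 1) - β * x (n + 2)) = 0)
    (hz : ∀ n, 0 ≤ n → n + 1 ≤ (d : ℤ) → z n - β * z (n + 1) + z (n + 2)
      + ((x n + x (n + 1)) * (y n + y (n + 1)) - β * (x n * y n + x (n + 1) * y (n + 1))) = ω)
    (hyw : w 2 * (y 1 + y 2) + w 1 * (y 0 + y 1) - β * (y 0 * w 2 + w 1 * y 2) = 0)
    (hyz : w 1 * (x 0 + x 1) * (y 0 + y 1) + (y 0 ^ 2 + y 1 ^ 2) + (2 * z 1 * w 1 + z 2 * w 2)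
      - β * (y 0 * x 0 * w 1 + (y 0 + w 1 * x 1) * y 1 + w 1 * z 2) = ρ + ω * w 1)
    (hz0 : z 0 = 0) (hzd : z (d + 1) = 0)
    (htr : (∑ n ∈ Finset.range (d + 1), y n) * (q - q⁻¹) = σ * (P - P⁻¹)) :
    ξ * (c * q) = a * a' * (c * q) ^ 2 + π := by
  have hstep : ∀ n k : ℤ, q ^ (2 * (n + k) - (d : ℤ)) = q ^ (2 * k) * q ^ (2 * n - (d : ℤ)) := by
    intro n k
    rw [← zpow_add₀ hq]
    congr 1
    ring
  have hs1 : ∀ n : ℤ, q ^ (2 * (n + 1) - (d : ℤ)) = q ^ 2 * q ^ (2 * n - (d : ℤ)) := fun n => by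
    simpa only [mul_one, zpow_ofNat] using hstep n 1
  have hs2 : ∀ n : ℤ, q ^ (2 * (n + 2) - (d : ℤ)) = q ^ 4 * q ^ (2 * n - (d : ℤ)) := fun n => by
    exact_mod_cast hstep n 2
  have hq2 : q ^ 2 - 1 ≠ 0 := sub_ne_zero.2 (hqr 2 (by norm_num))
  have hq4 : q ^ 4 - 1 ≠ 0 := sub_ne_zero.2 (hqr 4 (by norm_num))
  have hq6 : q ^ 6 - 1 ≠ 0 := sub_ne_zero.2 (hqr 6 (by norm_num))
  have hqq : q ^ 2 + 1 ≠ 0 := fun h => hq4 (by linear_combination (q ^ 2 - 1) * h)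
  have hP0 : P ≠ 0 := hP ▸ zpow_ne_zero _ hq
  have hPn : ∀ k : ℕ, 1 ≤ k → P ^ k ≠ 1 := by
    intro k hk
    rw [hP]
    have := hqr ((d + 1) * k) (Nat.mul_pos (by omega) hk)
    rw [pow_mul] at this
    exact_mod_cast this
  have hP2 : P ^ 2 - 1 ≠ 0 := sub_ne_zero.2 (hPn 2 (by norm_num))
  have hP4 : P ^ 2 + 1 ≠ 0 := fun h => hPn 4 (by norm_num) (by linear_combination (P ^ 2 - 1) * h)
  have hQ0 : q ^ (2 * 0 - (d : ℤ)) = q * P⁻¹ := by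
    rw [hP, ← _root_.zpow_neg, ← zpow_one_add₀ hq]
    congr 1
    ring
  have hQd : q ^ (2 * ((d : ℤ) + 1) - (d : ℤ)) = q * P := by
    rw [hP, ← zpow_one_add₀ hq]
    congr 1
    ring
  obtain ⟨g, g', hg⟩ := exists_eq_of_homogeneous_rec hq (hqr 4 (by norm_num))
    (f := fun n => y n - c * a * (q ^ 2 + 1) * (q ^ (2 * n - (d : ℤ))) ^ 2) (lo := 0) (hi := d) (fun n h0 h1 => by
      have h := hy n h0 h1
      have hK : q ^ (2 * n - (d : ℤ)) ≠ 0 := zpow_ne_zero _ hq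
      simp only [hx n (by omega) (by omega), hx (n + 1) (by omega) (by omega),
        hx (n + 2) (by omega) (by omega), hw (n + 1) (by omega) (by omega), hw (n + 2) (by omega) (by omega),
        hs1, hs2, hβ] at h ⊢
      generalize q ^ (2 * n - (d : ℤ)) = K at *
      refine Eq.trans ?_ h
      field_simp
      ring) d
  have hyf : ∀ n : ℤ, 0 ≤ n → n ≤ d → y n = g * q ^ (2 * n - (d : ℤ)) + g' * (q ^ (2 * n - (d : ℤ)))⁻¹
      + c * a * (q ^ 2 + 1) * (q ^ (2 * n - (d : ℤ))) ^ 2 := by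
    intro n h0 h1
    linear_combination hg n h0 h1
  have hs01 := hs1 0
  have hs02 := hs2 0
  rw [zero_add] at hs01 hs02
  have x0 := hx 0 (by omega) (by omega)
  have x1 := hx 1 (by omega) (by omega)
  have x2 := hx 2 (by omega) (by omega)
  have y0 := hyf 0 (by omega) (by omega)
  have y1 := hyf 1 (by omega) (by omega)
  have y2 := hyf 2 (by omega) (by omega)
  have w1 := hw 1 (by omega) (by omega)
  have w2 := hw 2 (by omega) (by omega)
  rw [hs01] at x1 y1 w1
  rw [hs02] at x2 y2 w2
  rw [hQ0] at x0 x1 x2 y0 y1 y2 w1 w2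
  have hg0 : g' = 0 := by
    have : g' * (c * (q ^ 6 - 1) * (q ^ 4 - 1)) = 0 := by
      rw [← mul_zero (-q ^ 4), ← hyw, y0, y1, y2, w1, w2, hβ]
      field_simp
      ring
    simpa [hc, hq4, hq6] using this
  subst hg0
  have hgσ : g = σ - c * a * q * (P + P⁻¹) := by
    have hsum : ∑ n ∈ Finset.range (d + 1), y n = g * ∑ n ∈ Finset.range (d + 1), q ^ (2 * (n : ℤ) - (d : ℤ))
        + c * a * (q ^ 2 + 1) * ∑ n ∈ Finset.range (d + 1), (q ^ 2) ^ (2 * (n : ℤ) - (d : ℤ)) := by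
      rw [Finset.mul_sum, Finset.mul_sum, ← Finset.sum_add_distrib]
      refine Finset.sum_congr rfl fun n hn => ?_
      have := Finset.mem_range.1 hn
      rw [hyf n (by omega) (by omega), ← zpow_natCast q 2, ← _root_.zpow_mul, mul_comm ((2 : ℕ) : ℤ), _root_.zpow_mul]
      simp
    have h1 := sum_zpow_mul_sub_inv hq d
    have h2 := sum_zpow_mul_sub_inv (pow_ne_zero 2 hq) d
    have h3 : (q ^ 2) ^ ((d : ℤ) + 1) = P ^ 2 := by
      rw [hP, ← zpow_natCast q 2, ← _root_.zpow_mul, mul_comm ((2 : ℕ) : ℤ), _root_.zpow_mul]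
      simp
    rw [h3] at h2
    rw [← hP] at h1
    rw [hsum] at htr
    have h4 : (P - P⁻¹) ≠ 0 := by
      intro h
      apply hP2
      field_simp at h
      linear_combination h
    have h5 : q ^ 2 - (q ^ 2)⁻¹ = (q - q⁻¹) * (q ^ 2 + 1) * q⁻¹ := by
      field_simp
      ring
    rw [h5] at h2
    apply mul_right_cancel₀ h4
    have h6 : q⁻¹ * q = 1 := inv_mul_cancel₀ hq
    have h7 : P ^ 2 - (P ^ 2)⁻¹ = (P - P⁻¹) * (P + P⁻¹) := by
      ring
    rw [h7] at h2
    linear_combination htr - g * h1 - c * a * q * h2 + c * a * (q ^ 2 + 1) * (∑ n ∈ Finset.range (d + 1), (q ^ 2) ^ (2 * (n : ℤ) - (d : ℤ))) * (q - q⁻¹) * h6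
  obtain ⟨r, s, hrs⟩ := exists_eq_of_homogeneous_rec hq (hqr 4 (by norm_num))
    (f := fun n => z n - (c * a ^ 2 * q⁻¹ ^ 2 * (q ^ (2 * n - (d : ℤ))) ^ 3
      + a * g * q⁻¹ ^ 2 * (q ^ (2 * n - (d : ℤ))) ^ 2 + ((a + a') * σ - ξ * (P + P⁻¹) - a' * g)))
    (lo := 0) (hi := d + 1) (fun n h0 h1 => by
      have h := hz n h0 (by omega)
      have hK : q ^ (2 * n - (d : ℤ)) ≠ 0 := zpow_ne_zero _ hq
      simp only [hx n (by omega) (by omega), hx (n + 1) (by omega) (by omega),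
        hyf n (by omega) (by omega), hyf (n + 1) (by omega) (by omega), hω,
        hs1, hs2, hβ] at h ⊢
      generalize q ^ (2 * n - (d : ℤ)) = K at *
      rw [← sub_eq_zero] at h
      refine Eq.trans ?_ h
      field_simp
      ring) d
  have hz1 := hrs 1 (by omega) (by omega)
  have hz2 := hrs 2 (by omega) (by omega)
  have hzz0 := hrs 0 (by omega) (by omega)
  have hzzd := hrs (d + 1) (by omega) (by omega)
  simp only [hs01, hs02, hQ0, hQd, hz0, hzd] at hz1 hz2 hzz0 hzzd
  have hπ : π = c * s := by
    have hD : q ^ 2 - q⁻¹ ^ 2 ≠ 0 := by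
      intro h
      apply hq4
      field_simp at h
      linear_combination h
    have hz1' := sub_eq_iff_eq_add.1 hz1
    have hz2' := sub_eq_iff_eq_add.1 hz2
    rw [hρ, hω, ← sub_eq_zero, hz1', hz2', x0, x1, y0, y1, w1, w2, hβ] at hyz
    rw [← sub_eq_zero] at hzz0
    have key : (π - c * s) * (q ^ 2 - q⁻¹ ^ 2) ^ 2 = 0 := by
      refine Eq.trans ?_ (congrArg₂ (· + ·) hyz
        (congrArg (fun t => ((q ^ 2 + q⁻¹ ^ 2) * c * (q ^ 2 * (q * P⁻¹)) - c * (q * P⁻¹)) * t) hzz0) |>.trans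
        (by ring))
      field_simp
      ring
    exact sub_eq_zero.1 ((mul_eq_zero.1 key).resolve_right (pow_ne_zero 2 hD))
  have hs : s = q * (ξ - c * q * a * a') := by
    rw [← sub_eq_zero, hgσ] at hzz0 hzzd
    have key : (s - q * (ξ - c * q * a * a')) * ((P ^ 2 - 1) * (P ^ 2 + 1) * P⁻¹ * q⁻¹) = 0 := by
      refine Eq.trans ?_ (congrArg₂ (· - ·) hzzd (congrArg (P ^ 2 * ·) hzz0) |>.trans (by ring))
      field_simp
      ring
    exact sub_eq_zero.1 ((mul_eq_zero.1 key).resolve_right (by simp [hP2, hP4, hP0, hq]))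
  rw [hπ, hs]
  ring

end Recurrence

section Entry

/-- The matrix entries, indexed by `ℤ` and extended by zero. -/
def extEntry (M : Matrix (Fin (d + 1)) (Fin (d + 1)) F) (i j : ℤ) : F :=
  stdVec F d i ⬝ᵥ (M *ᵥ stdVec F d j)

lemma extEntry_coe (M : Matrix (Fin (d + 1)) (Fin (d + 1)) F) (i j : Fin (d + 1)) :
    extEntry M i j = M i j := by
  rw [extEntry, stdVec_coe, stdVec_coe, mulVec_single_one, single_one_dotProduct, col_apply]

lemma extEntry_eq_zero (M : Matrix (Fin (d + 1)) (Fin (d + 1)) F) {i j : ℤ}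
    (h : i < 0 ∨ (d : ℤ) < i ∨ j < 0 ∨ (d : ℤ) < j) : extEntry M i j = 0 := by
  rw [← or_assoc] at h
  rcases h with h | h
  · rw [extEntry, stdVec_eq_zero h, zero_dotProduct]
  · rw [extEntry, stdVec_eq_zero h, mulVec_zero, dotProduct_zero]

lemma trace_eq_sum_extEntry (M : Matrix (Fin (d + 1)) (Fin (d + 1)) F) :
    M.trace = ∑ n ∈ Finset.range (d + 1), extEntry M n n := by
  rw [Finset.sum_range]
  exact Finset.sum_congr rfl fun i _ => (extEntry_coe M i i).symm

lemma isBand_of_isTridiagonal {M : Matrix (Fin (d + 1)) (Fin (d + 1)) F} (hM : IsTridiagonal M) :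
    IsBand M (fun n => extEntry M (n - 1) n) (fun n => extEntry M n n)
      (fun n => extEntry M n (n - 1)) := by
  intro i j
  have h := extEntry_coe M i j
  split_ifs with h1 h2 h3
  · rw [← h, h1]
  · simp only [← h, h2, add_sub_cancel_right]
  · simp only [← h, h3, add_sub_cancel_right]
  · exact hM i j (by omega)

lemma isBand_of_isLowerBidiagonal {M : Matrix (Fin (d + 1)) (Fin (d + 1)) F}
    (hM : IsLowerBidiagonal M) (h1 : ∀ i j : Fin (d + 1), (i : ℕ) = (j : ℕ) + 1 → M i j = 1) :
    IsBand M 0 (fun n => extEntry M n n) (fun n => if n = 0 then 0 else 1) := by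
  intro i j
  split_ifs with h2 h3
  · rw [← extEntry_coe M i j, h2]
  · simp only [show (i : ℤ) ≠ 0 by omega, if_false]
    exact h1 i j (by omega)
  all_goals exact hM i j (by omega)

lemma stdVec_toNat {m : ℤ} (k : ℤ) (h : m.toNat < d + 1) (h0 : 0 ≤ m) :
    stdVec F d k ⟨m.toNat, h⟩ = if m = k then 1 else 0 := by
  simp [stdVec, Int.toNat_of_nonneg h0]

end Entry

section Conjugation

variable {q a a' b b' ξ : F} {A B G : Matrix (Fin (d + 1)) (Fin (d + 1)) F}

lemma inv_mul_mul_mul_inv_mul_mul (hG : IsUnit G) (A B : Matrix (Fin (d + 1)) (Fin (d + 1)) F) :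
    G⁻¹ * A * G * (G⁻¹ * B * G) = G⁻¹ * (A * B) * G := by
  have h : G * G⁻¹ = 1 := mul_nonsing_inv _ ((isUnit_iff_isUnit_det _).1 hG)
  calc G⁻¹ * A * G * (G⁻¹ * B * G) = G⁻¹ * A * (G * G⁻¹) * B * G := by simp only [mul_assoc]
    _ = _ := by rw [h]; simp only [mul_assoc, one_mul]

lemma AskeyWilsonLeft.conj (h : AskeyWilsonLeft q d a a' b b' ξ A B) (hG : IsUnit G) :
    AskeyWilsonLeft q d a a' b b' ξ (G⁻¹ * A * G) (G⁻¹ * B * G) := by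
  have h1 : G⁻¹ * G = 1 := nonsing_inv_mul _ ((isUnit_iff_isUnit_det _).1 hG)
  simp only [AskeyWilsonLeft, inv_mul_mul_mul_inv_mul_mul hG] at h ⊢
  generalize -(q - q⁻¹) ^ 2 * (_ - _) = ω at h ⊢
  generalize -(q - q⁻¹) ^ 2 * (q + q⁻¹) * _ = η at h ⊢
  have := congrArg (fun X => G⁻¹ * X * G) h
  simpa only [Matrix.mul_add, Matrix.mul_sub, Matrix.add_mul, Matrix.sub_mul, mul_smul_comm,
    smul_mul_assoc, mul_one, h1] using this

lemma AskeyWilsonRight.conj (h : AskeyWilsonRight q d a a' b b' ξ A B) (hG : IsUnit G) :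
    AskeyWilsonRight q d a a' b b' ξ (G⁻¹ * A * G) (G⁻¹ * B * G) := by
  have h1 : G⁻¹ * G = 1 := nonsing_inv_mul _ ((isUnit_iff_isUnit_det _).1 hG)
  simp only [AskeyWilsonRight, inv_mul_mul_mul_inv_mul_mul hG] at h ⊢
  generalize -(q - q⁻¹) ^ 2 * (_ - _) = ω at h ⊢
  generalize -(q - q⁻¹) ^ 2 * (q + q⁻¹) * _ = η at h ⊢
  have := congrArg (fun X => G⁻¹ * X * G) h
  simpa only [Matrix.mul_add, Matrix.mul_sub, Matrix.add_mul, Matrix.sub_mul, mul_smul_comm,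
    smul_mul_assoc, mul_one, h1] using this

end Conjugation

section Necessity

variable {q a a' b b' ξ : F} {A B : Matrix (Fin (d + 1)) (Fin (d + 1)) F} {ε x y z w : ℤ → F}

lemma AskeyWilsonLeft.coeff_eq (h : AskeyWilsonLeft q d a a' b b' ξ A B)
    (hε : ∀ n, 1 ≤ n → ε n = 1) (hz0 : z 0 = 0)
    (hA : ∀ n, A *ᵥ stdVec F d n = x n • stdVec F d n + ε (n + 1) • stdVec F d (n + 1))
    (hB : ∀ n, B *ᵥ stdVec F d n = z n • stdVec F d (n - 1) + y n • stdVec F d n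
      + w (n + 1) • stdVec F d (n + 1)) {n : ℤ} (hn : 0 ≤ n) :
    (1 ≤ n → n ≤ d + 1 → z n * (x (n - 1) ^ 2 - (q ^ 2 + q⁻¹ ^ 2) * (x n * x (n - 1)) + x n ^ 2
      + a * a' * (q ^ 2 - q⁻¹ ^ 2) ^ 2) = 0) ∧
    (n + 1 ≤ d → z n - (q ^ 2 + q⁻¹ ^ 2) * z (n + 1) + z (n + 2)
      + ((x n + x (n + 1)) * (y n + y (n + 1)) - (q ^ 2 + q⁻¹ ^ 2) * (x n * y n + x (n + 1) * y (n + 1)))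
      + w (n + 1) * (x n ^ 2 - (q ^ 2 + q⁻¹ ^ 2) * (x n * x (n + 1)) + x (n + 1) ^ 2
      + a * a' * (q ^ 2 - q⁻¹ ^ 2) ^ 2)
      - -(q - q⁻¹) ^ 2 * ((a + a') * (b + b') - ξ * (q ^ ((d : ℤ) + 1) + (q ^ ((d : ℤ) + 1))⁻¹)) = 0) ∧
    (n + 2 ≤ d → y n - (q ^ 2 + q⁻¹ ^ 2) * y (n + 1) + y (n + 2)
      + w (n + 1) * (x (n + 1) + x (n + 2) - (q ^ 2 + q⁻¹ ^ 2) * x n)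
      + w (n + 2) * (x n + x (n + 1) - (q ^ 2 + q⁻¹ ^ 2) * x (n + 2)) = 0) ∧
    (n + 3 ≤ d → w (n + 1) - (q ^ 2 + q⁻¹ ^ 2) * w (n + 2) + w (n + 3) = 0) := by
  have e := congrArg (· *ᵥ stdVec F d n) h
  have h0 : ε n * z n = z n := by
    rcases hn.eq_or_lt with rfl | h
    · simp [hz0]
    · rw [hε n (by omega), one_mul]
  simp only [cubic_left_mulVec hA hB] at e
  simp only [add_mulVec, smul_mulVec, hA, hB, one_mulVec, hε (n + 1) (by omega), hε (n + 2) (by omega),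
    hε (n + 3) (by omega), h0, mul_one, one_mul] at e
  refine ⟨fun h1 h2 => ?_, fun h1 => ?_, fun h1 => ?_, fun h1 => ?_⟩
  · have := congrFun e ⟨(n - 1).toNat, by omega⟩
    simp only [Pi.add_apply, Pi.smul_apply, smul_eq_mul, stdVec_toNat _ _ (show 0 ≤ n - 1 by omega),
      if_true, show n - 1 ≠ n by omega, show n - 1 ≠ n + 1 by omega, show n - 1 ≠ n + 2 by omega, show n - 1 ≠ n + 3 by omega, if_false, mul_zero, mul_one, add_zero] at this
    linear_combination this
  · have := congrFun e ⟨(n + 1).toNat, by omega⟩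
    simp only [Pi.add_apply, Pi.smul_apply, smul_eq_mul, stdVec_toNat _ _ (show 0 ≤ n + 1 by omega),
      if_true, show n + 1 ≠ n - 1 by omega, show n + 1 ≠ n by omega, show n + 1 ≠ n + 2 by omega, show n + 1 ≠ n + 3 by omega, if_false, mul_zero, mul_one, add_zero, zero_add] at this
    linear_combination this
  · have := congrFun e ⟨(n + 2).toNat, by omega⟩
    simp only [Pi.add_apply, Pi.smul_apply, smul_eq_mul, stdVec_toNat _ _ (show 0 ≤ n + 2 by omega),
      if_true, show n + 2 ≠ n - 1 by omega, show n + 2 ≠ n by omega, show n + 2 ≠ n + 1 by omega, show n + 2 ≠ n + 3 by omega, if_false, mul_zero, mul_one, add_zero, zero_add] at this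
    linear_combination this
  · have := congrFun e ⟨(n + 3).toNat, by omega⟩
    simp only [Pi.add_apply, Pi.smul_apply, smul_eq_mul, stdVec_toNat _ _ (show 0 ≤ n + 3 by omega),
      if_true, show n + 3 ≠ n - 1 by omega, show n + 3 ≠ n by omega, show n + 3 ≠ n + 1 by omega, show n + 3 ≠ n + 2 by omega, if_false, mul_zero, mul_one, add_zero, zero_add] at this
    linear_combination this

lemma AskeyWilsonRight.coeff_eq (h : AskeyWilsonRight q d a a' b b' ξ A B) (hd : 3 ≤ d)
    (hε : ∀ n, 1 ≤ n → ε n = 1) (hz0 : z 0 = 0)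
    (hA : ∀ n, A *ᵥ stdVec F d n = x n • stdVec F d n + ε (n + 1) • stdVec F d (n + 1))
    (hB : ∀ n, B *ᵥ stdVec F d n = z n • stdVec F d (n - 1) + y n • stdVec F d n
      + w (n + 1) • stdVec F d (n + 1)) :
    (w 1 * (x 0 + x 1) * (y 0 + y 1) + (y 0 ^ 2 + y 1 ^ 2) + (2 * z 1 * w 1 + z 2 * w 2)
      - (q ^ 2 + q⁻¹ ^ 2) * (y 0 * x 0 * w 1 + (y 0 + w 1 * x 1) * y 1 + w 1 * z 2)
      - (-(b * b') * (q ^ 2 - q⁻¹ ^ 2) ^ 2 + -(q - q⁻¹) ^ 2 * ((a + a') * (b + b')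
        - ξ * (q ^ ((d : ℤ) + 1) + (q ^ ((d : ℤ) + 1))⁻¹)) * w 1) = 0) ∧
    (w 1 * w 2 * (x 0 - (q ^ 2 + q⁻¹ ^ 2) * x 1 + x 2) + w 2 * (y 1 + y 2) + w 1 * (y 0 + y 1)
      - (q ^ 2 + q⁻¹ ^ 2) * (y 0 * w 2 + w 1 * y 2) = 0) ∧
    (w 2 * w 3 - (q ^ 2 + q⁻¹ ^ 2) * (w 1 * w 3) + w 1 * w 2 = 0) := by
  have e := congrArg (· *ᵥ stdVec F d 0) h
  simp only [cubic_right_mulVec hA hB] at e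
  simp only [add_mulVec, smul_mulVec, hA, hB, one_mulVec, hε 1 (by omega), hε 2 (by omega),
    hε 3 (by omega), hz0, one_mul, mul_zero, zero_mul, zero_add, zero_smul, add_zero] at e
  refine ⟨?_, ?_, ?_⟩
  · have := congrFun e ⟨1, by omega⟩
    simp [stdVec] at this
    linear_combination this
  · have := congrFun e ⟨2, by omega⟩
    simp [stdVec] at this
    linear_combination this
  · have := congrFun e ⟨3, by omega⟩
    simp [stdVec] at this
    linear_combination this

lemma exists_ne_zero_of_sq_eq_mul (hq : q ≠ 0) (hq4 : q ^ 4 ≠ 1) {hi : ℤ} (h3 : 3 ≤ hi)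
    (hw : ∀ n, 1 ≤ n → n ≤ hi → w n ≠ 0)
    (hrec : ∀ n, 1 ≤ n → n + 2 ≤ hi → w n - (q ^ 2 + q⁻¹ ^ 2) * w (n + 1) + w (n + 2) = 0)
    (hsq : w 2 ^ 2 = w 1 * w 3) (c : ℤ) :
    ∃ e : F, e ≠ 0 ∧ ((∀ n, 1 ≤ n → n ≤ hi → w n = e * q ^ (2 * n - c)) ∨
      ∀ n, 1 ≤ n → n ≤ hi → w n = e * (q ^ (2 * n - c))⁻¹) := by
  obtain ⟨e, f, hef⟩ := exists_eq_of_homogeneous_rec hq hq4 hrec c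
  have h1 := hef 1 (by omega) (by omega)
  have h2 := hef 2 (by omega) (by omega)
  have h3 := hef 3 (by omega) (by omega)
  have hstep : ∀ n : ℤ, q ^ (2 * (n + 1) - c) = q ^ 2 * q ^ (2 * n - c) := by
    intro n
    rw [← zpow_natCast, ← zpow_add₀ hq]
    congr 1
    push_cast
    ring
  have s2 := hstep 1
  have s3 := hstep 2
  norm_num at s2 s3
  have hK : q ^ (2 - c) ≠ 0 := zpow_ne_zero _ hq
  have hD : q ^ 4 - 1 ≠ 0 := sub_ne_zero.2 hq4
  have h0 : e * f = 0 := by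
    have : e * f * (q ^ 4 - 1) ^ 2 = 0 := by
      rw [← mul_zero (-q ^ 4), ← sub_eq_zero.2 hsq, h1, h2, h3]
      norm_num
      rw [s3, s2]
      field_simp
      ring
    simpa [hD] using this
  rcases mul_eq_zero.1 h0 with rfl | rfl
  · refine ⟨f, fun h => hw 1 le_rfl (by omega) ?_, Or.inr fun n hn hn' => ?_⟩
    · rw [h1, h]; ring
    · rw [hef n hn hn']; ring
  · refine ⟨e, fun h => hw 1 le_rfl (by omega) ?_, Or.inl fun n hn hn' => ?_⟩
    · rw [h1, h]; ring
    · rw [hef n hn hn']; ring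

lemma sum_qEig_mul_sub_inv (hq : q ≠ 0) (d : ℕ) (a a' : F) :
    (∑ n ∈ Finset.range (d + 1), (a * q ^ (2 * (n : ℤ) - (d : ℤ)) + a' * (q ^ (2 * (n : ℤ) - (d : ℤ)))⁻¹))
      * (q - q⁻¹) = (a + a') * (q ^ ((d : ℤ) + 1) - (q ^ ((d : ℤ) + 1))⁻¹) := by
  have h1 := sum_zpow_mul_sub_inv hq d
  have h2 := sum_zpow_mul_sub_inv (inv_ne_zero hq) d
  simp only [_root_.inv_zpow, inv_inv] at h2
  rw [Finset.sum_add_distrib, ← Finset.mul_sum, ← Finset.mul_sum]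
  linear_combination a * h1 - a' * h2

/-- If `A`, `B` satisfy the Askey-Wilson relations, `A` is lower bidiagonal and `B` is irreducible
tridiagonal, then `a a' X² - ξ X + b b'` has a nonzero root. -/
lemma exists_root_of_askeyWilson (hq : q ≠ 0) (hqr : ∀ n : ℕ, 1 ≤ n → q ^ n ≠ 1) (hd : 3 ≤ d)
    (hL : AskeyWilsonLeft q d a a' b b' ξ A B) (hR : AskeyWilsonRight q d a a' b b' ξ A B)
    (hε : ∀ n, 1 ≤ n → ε n = 1)
    (hA : ∀ n, A *ᵥ stdVec F d n = x n • stdVec F d n + ε (n + 1) • stdVec F d (n + 1))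
    (hB : ∀ n, B *ᵥ stdVec F d n = z n • stdVec F d (n - 1) + y n • stdVec F d n
      + w (n + 1) • stdVec F d (n + 1))
    (hz0 : z 0 = 0) (hzd : z (d + 1) = 0)
    (hzne : ∀ n : ℤ, 1 ≤ n → n ≤ d → z n ≠ 0) (hwne : ∀ n : ℤ, 1 ≤ n → n ≤ d → w n ≠ 0)
    (hxne : ∀ n : ℤ, 0 ≤ n → n + 2 ≤ d → x n ≠ x (n + 2))
    (htA : (∑ n ∈ Finset.range (d + 1), x n) * (q - q⁻¹) =
      (a + a') * (q ^ ((d : ℤ) + 1) - (q ^ ((d : ℤ) + 1))⁻¹))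
    (htB : (∑ n ∈ Finset.range (d + 1), y n) * (q - q⁻¹) =
      (b + b') * (q ^ ((d : ℤ) + 1) - (q ^ ((d : ℤ) + 1))⁻¹)) :
    ∃ C : F, C ≠ 0 ∧ a * a' * C ^ 2 - ξ * C + b * b' = 0 := by
  have hl := fun n (hn : 0 ≤ n) => hL.coeff_eq hε hz0 hA hB hn
  obtain ⟨hr1, hr2, hr3⟩ := hR.coeff_eq hd hε hz0 hA hB
  have hq4 := hqr 4 (by norm_num)
  have hxrel : ∀ n, 0 ≤ n → n + 1 ≤ (d : ℤ) → x n ^ 2 - (q ^ 2 + q⁻¹ ^ 2) * (x n * x (n + 1)) + x (n + 1) ^ 2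
      + a * a' * (q ^ 2 - q⁻¹ ^ 2) ^ 2 = 0 := by
    intro n h0 h1
    have := (mul_eq_zero.1 ((hl (n + 1) (by omega)).1 (by omega) (by omega))).resolve_left
      (hzne _ (by omega) (by omega))
    rw [add_sub_cancel_right] at this
    linear_combination this
  have hxrec : ∀ n, 0 ≤ n → n + 2 ≤ (d : ℤ) → x n - (q ^ 2 + q⁻¹ ^ 2) * x (n + 1) + x (n + 2) = 0 := by
    intro n h0 h1
    have e1 := hxrel n h0 (by omega)
    have e2 := hxrel (n + 1) (by omega) (by omega)
    rw [show n + 1 + 1 = n + 2 by ring] at e2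
    refine (mul_eq_zero.1 (?_ : (x n - x (n + 2)) * _ = 0)).resolve_left (sub_ne_zero.2 (hxne n h0 h1))
    linear_combination e1 - e2
  have hwrec : ∀ n, 1 ≤ n → n + 2 ≤ (d : ℤ) → w n - (q ^ 2 + q⁻¹ ^ 2) * w (n + 1) + w (n + 2) = 0 := by
    intro n h0 h1
    have := (hl (n - 1) (by omega)).2.2.2 (by omega)
    rwa [show n - 1 + 1 = n by ring, show n - 1 + 2 = n + 1 by ring, show n - 1 + 3 = n + 2 by ring] at this
  have hwsq : w 2 ^ 2 = w 1 * w 3 := by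
    have e := hwrec 1 le_rfl (by omega)
    norm_num at e
    have hβ : q ^ 2 + q⁻¹ ^ 2 ≠ 0 := by
      intro h
      apply hqr 8 (by norm_num)
      field_simp at h
      linear_combination (q ^ 4 - 1) * h
    refine mul_left_cancel₀ (mul_ne_zero hβ (hwne 2 (by omega) (by omega))) ?_
    linear_combination w 2 * hr3 - w 2 ^ 2 * e
  have hxr := hxrec 0 le_rfl (by omega)
  have hl3 := fun n hn => (hl n hn).2.2.1
  have hl2 := fun n (hn : 0 ≤ n) (hn' : n + 1 ≤ (d : ℤ)) => (hl n hn).2.1 hn'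
  obtain ⟨a₁, a₂, hxf⟩ := exists_eq_of_homogeneous_rec hq hq4 hxrec d
  have hP1 : q ^ ((d : ℤ) + 1) - (q ^ ((d : ℤ) + 1))⁻¹ ≠ 0 := by
    intro h
    have hP0 : q ^ ((d : ℤ) + 1) ≠ 0 := zpow_ne_zero _ hq
    apply hqr ((d + 1) * 2) (by omega)
    rw [pow_mul]
    have : q ^ (d + 1) = q ^ ((d : ℤ) + 1) := by exact_mod_cast rfl
    rw [this]
    field_simp at h
    linear_combination h
  have hD : q ^ 2 - q⁻¹ ^ 2 ≠ 0 := by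
    intro h
    apply hq4
    field_simp at h
    linear_combination h
  have hsum : a₁ + a₂ = a + a' := by
    refine mul_right_cancel₀ hP1 ?_
    rw [← htA, ← sum_qEig_mul_sub_inv hq]
    congr 1
    refine Finset.sum_congr rfl fun n hn => ?_
    have := Finset.mem_range.1 hn
    rw [hxf n (by omega) (by omega)]
  have hprod : a₁ * a₂ = a * a' := by
    refine mul_right_cancel₀ (pow_ne_zero 2 hD) ?_
    have h := hxrel 0 le_rfl (by omega)
    rw [hxf (0 + 1) (by omega) (by omega), hxf 0 (by omega) (by omega),
      show 2 * (0 + 1) - (d : ℤ) = 2 * 0 - d + 1 + 1 by ring, zpow_add_one₀ hq, zpow_add_one₀ hq] at h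
    have hK : q ^ (2 * 0 - (d : ℤ)) ≠ 0 := zpow_ne_zero _ hq
    generalize q ^ (2 * 0 - (d : ℤ)) = K at h hK
    rw [← sub_eq_zero, ← neg_eq_zero, ← h]
    field_simp
    ring
  have hz' : ∀ n, 0 ≤ n → n + 1 ≤ (d : ℤ) → z n - (q ^ 2 + q⁻¹ ^ 2) * z (n + 1) + z (n + 2)
      + ((x n + x (n + 1)) * (y n + y (n + 1)) - (q ^ 2 + q⁻¹ ^ 2) * (x n * y n + x (n + 1) * y (n + 1))) =
      -(q - q⁻¹) ^ 2 * ((a₁ + a₂) * (b + b') - ξ * (q ^ ((d : ℤ) + 1) + (q ^ ((d : ℤ) + 1))⁻¹)) := by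
    intro n h0 h1
    rw [hsum]
    linear_combination hl2 n h0 h1 - w (n + 1) * hxrel n h0 h1
  have hyw : w 2 * (y 1 + y 2) + w 1 * (y 0 + y 1) - (q ^ 2 + q⁻¹ ^ 2) * (y 0 * w 2 + w 1 * y 2) = 0 := by
    norm_num at hxr
    linear_combination hr2 - w 1 * w 2 * hxr
  rw [← hsum] at hr1
  obtain ⟨e, he, hwf⟩ := exists_ne_zero_of_sq_eq_mul hq hq4 (by omega : (3 : ℤ) ≤ d) hwne hwrec hwsq d
  rcases hwf with hwf | hwf
  · refine ⟨e * q, mul_ne_zero he hq, ?_⟩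
    have := lowerBidiagonal_tridiagonal_relation hq hqr (by omega : 2 ≤ d) (σ := b + b') (π := b * b') (ξ := ξ)
      rfl rfl rfl rfl hxf hwf he hl3 hz' hyw (sub_eq_zero.1 hr1) hz0 hzd htB
    rw [hprod] at this
    linear_combination -this
  · refine ⟨e * q⁻¹, mul_ne_zero he (inv_ne_zero hq), ?_⟩
    have := lowerBidiagonal_tridiagonal_relation (inv_ne_zero hq)
      (fun n hn h => hqr n hn (by rwa [inv_pow, inv_eq_one] at h)) (by omega : 2 ≤ d)
      (σ := b + b') (π := b * b') (ξ := ξ) (a := a₂) (a' := a₁) (c := e) (x := x) (y := y) (z := z) (w := w)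
      (β := q ^ 2 + q⁻¹ ^ 2) (by rw [inv_inv, add_comm]) rfl rfl rfl
      (fun n h0 h1 => by rw [hxf n h0 h1, _root_.inv_zpow, inv_inv, add_comm])
      (fun n h0 h1 => by rw [hwf n h0 h1, _root_.inv_zpow]) he hl3
      (fun n h0 h1 => by rw [hz' n h0 h1]; simp only [_root_.inv_zpow, inv_inv]; ring) hyw
      (by rw [sub_eq_zero.1 hr1]; simp only [_root_.inv_zpow, inv_inv]; ring) hz0 hzd
      (by simp only [_root_.inv_zpow, inv_inv]; linear_combination -htB)
    rw [mul_comm a₂, hprod] at this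
    linear_combination -this

lemma exists_root_of_isIrredTridiagonal (hq : q ≠ 0) (hqr : ∀ n : ℕ, 1 ≤ n → q ^ n ≠ 1) (hd : 3 ≤ d)
    (hL : AskeyWilsonLeft q d a a' b b' ξ A B) (hR : AskeyWilsonRight q d a a' b b' ξ A B)
    (hA : IsLowerBidiagonal A) (hA1 : ∀ i j : Fin (d + 1), (i : ℕ) = (j : ℕ) + 1 → A i j = 1)
    (hB : IsIrredTridiagonal B) (hinj : Function.Injective fun i => A i i)
    (htA : A.trace * (q - q⁻¹) = (a + a') * (q ^ ((d : ℤ) + 1) - (q ^ ((d : ℤ) + 1))⁻¹))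
    (htB : B.trace * (q - q⁻¹) = (b + b') * (q ^ ((d : ℤ) + 1) - (q ^ ((d : ℤ) + 1))⁻¹)) :
    ∃ C : F, C ≠ 0 ∧ a * a' * C ^ 2 - ξ * C + b * b' = 0 := by
  have hbA := (isBand_of_isLowerBidiagonal hA hA1).mulVec_stdVec (by simp) (by simp)
  have hbB := (isBand_of_isTridiagonal hB.1).mulVec_stdVec (extEntry_eq_zero _ (by omega))
    (extEntry_eq_zero _ (by omega))
  simp only [Pi.zero_apply, zero_smul, zero_add] at hbA
  have hzne : ∀ n : ℤ, 1 ≤ n → n ≤ d → extEntry B (n - 1) n ≠ 0 := by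
    intro n h1 h2
    have := extEntry_coe B ⟨(n - 1).toNat, by omega⟩ ⟨n.toNat, by omega⟩
    simp only [Int.toNat_of_nonneg (show 0 ≤ n by omega), Int.toNat_of_nonneg (show 0 ≤ n - 1 by omega)] at this
    rw [this]
    exact hB.2 _ _ (Or.inr (by simp only; omega))
  have hwne : ∀ n : ℤ, 1 ≤ n → n ≤ d → extEntry B n (n - 1) ≠ 0 := by
    intro n h1 h2
    have := extEntry_coe B ⟨n.toNat, by omega⟩ ⟨(n - 1).toNat, by omega⟩
    simp only [Int.toNat_of_nonneg (show 0 ≤ n by omega), Int.toNat_of_nonneg (show 0 ≤ n - 1 by omega)] at this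
    rw [this]
    exact hB.2 _ _ (Or.inl (by simp only; omega))
  have hxne : ∀ n : ℤ, 0 ≤ n → n + 2 ≤ d → extEntry A n n ≠ extEntry A (n + 2) (n + 2) := by
    intro n h1 h2 h
    have e1 := extEntry_coe A ⟨n.toNat, by omega⟩ ⟨n.toNat, by omega⟩
    have e2 := extEntry_coe A ⟨(n + 2).toNat, by omega⟩ ⟨(n + 2).toNat, by omega⟩
    simp only [Int.toNat_of_nonneg (show 0 ≤ n by omega), Int.toNat_of_nonneg (show 0 ≤ n + 2 by omega)] at e1 e2
    rw [e1, e2] at h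
    have := hinj h
    simp only [Fin.mk.injEq] at this
    omega
  have hz0 : extEntry B (0 - 1) 0 = 0 := extEntry_eq_zero _ (by omega)
  have hzd : extEntry B (((d : ℤ) + 1) - 1) (d + 1) = 0 := extEntry_eq_zero _ (by omega)
  rw [trace_eq_sum_extEntry] at htA htB
  have hε : ∀ n : ℤ, 1 ≤ n → (fun n : ℤ => if n = 0 then (0 : F) else 1) n = 1 := by
    intro n hn
    simp only [show n ≠ 0 by omega, if_false]
  exact exists_root_of_askeyWilson hq hqr hd hL hR (x := fun n => extEntry A n n)
    (y := fun n => extEntry B n n) (z := fun n => extEntry B (n - 1) n)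
    (w := fun n => extEntry B n (n - 1)) hε hbA hbB hz0 hzd hzne hwne hxne htA htB

end Necessity

section Form

variable {q a a' b b' ξ α αs : F} {A As U S : Matrix (Fin (d + 1)) (Fin (d + 1)) F}

lemma split_ne_zero {t ts f : ℕ → F} (hLP : IsLeonardPair A As) (hU : IsUnit U)
    (hUA : ∀ i j : Fin (d + 1), (U⁻¹ * A * U) i j =
        if (i : ℕ) = (j : ℕ) then t (i : ℕ) else if (i : ℕ) = (j : ℕ) + 1 then 1 else 0)
    (hUAs : ∀ i j : Fin (d + 1), (U⁻¹ * As * U) i j =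
        if (i : ℕ) = (j : ℕ) then ts (i : ℕ) else if (j : ℕ) = (i : ℕ) + 1 then f (j : ℕ) else 0)
    {m : ℕ} (hm : 1 ≤ m) (hmd : m ≤ d) : f m ≠ 0 := by
  obtain ⟨Q, hQ, hT, hD⟩ := hLP.2
  have hcomm : ∀ X, Q⁻¹ * X * Q * (Q⁻¹ * U) = Q⁻¹ * U * (U⁻¹ * X * U) := by
    intro X
    calc Q⁻¹ * X * Q * (Q⁻¹ * U) = Q⁻¹ * X * (Q * Q⁻¹) * U := by simp only [mul_assoc]
      _ = Q⁻¹ * (U * U⁻¹) * X * U := by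
        rw [mul_nonsing_inv _ ((isUnit_iff_isUnit_det _).1 hQ),
          mul_nonsing_inv _ ((isUnit_iff_isUnit_det _).1 hU), mul_one, mul_one]
      _ = _ := by simp only [mul_assoc]
  have hA := hcomm A
  rw [← hD.diagonal_diag] at hA
  obtain ⟨i, j, hi, hj, hij⟩ := exists_ne_zero_of_irred ((isUnit_nonsing_inv_iff.2 hQ).mul hU) hA
    (hcomm As) (fun i j h => by rw [hUA, if_neg (by tauto), if_neg (by tauto)])
    (fun i j h => by rw [hUA, if_neg (by omega), if_pos h]) hT hm hmd
  rw [hUAs, if_neg (by omega)] at hij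
  split_ifs at hij with h
  · rwa [show (j : ℕ) = m by omega] at hij
  · exact absurd rfl hij

lemma trace_inv_mul_mul (hU : IsUnit U) (X : Matrix (Fin (d + 1)) (Fin (d + 1)) F) :
    (U⁻¹ * X * U).trace = X.trace := by
  rw [trace_mul_comm, ← mul_assoc, mul_nonsing_inv _ ((isUnit_iff_isUnit_det _).1 hU), one_mul]

lemma trace_mul_sub_inv_of_diag {X : Matrix (Fin (d + 1)) (Fin (d + 1)) F} (hq : q ≠ 0)
    (hX : ∀ i : Fin (d + 1), X i i = qEig q d a a' i) :
    X.trace * (q - q⁻¹) = (a + a') * (q ^ ((d : ℤ) + 1) - (q ^ ((d : ℤ) + 1))⁻¹) := by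
  rw [← sum_qEig_mul_sub_inv hq, Finset.sum_range]
  congr 1
  refine Finset.sum_congr rfl fun i _ => ?_
  rw [diag_apply, hX, qEig, ← zpow_neg, neg_sub]

lemma diag_injective_of_isLeonardPair (hLP : IsLeonardPair A As) (hS : IsUnit S)
    (hL : IsLowerBidiagonal (S⁻¹ * A * S))
    (h1 : ∀ i j : Fin (d + 1), (i : ℕ) = (j : ℕ) + 1 → (S⁻¹ * A * S) i j = 1) :
    Function.Injective fun i => (S⁻¹ * A * S) i i := by
  obtain ⟨Q, hQ, -, hD⟩ := hLP.2
  refine diag_injective_of_similar (δ := (Q⁻¹ * A * Q).diag) (G := Q⁻¹ * S)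
    ((isUnit_nonsing_inv_iff.2 hQ).mul hS) ?_ hL h1
  rw [hD.diagonal_diag]
  calc Q⁻¹ * A * Q * (Q⁻¹ * S) = Q⁻¹ * A * (Q * Q⁻¹) * S := by simp only [mul_assoc]
    _ = Q⁻¹ * (S * S⁻¹) * A * S := by
      rw [mul_nonsing_inv _ ((isUnit_iff_isUnit_det _).1 hQ),
        mul_nonsing_inv _ ((isUnit_iff_isUnit_det _).1 hS), mul_one, mul_one]
    _ = _ := by simp only [mul_assoc]

lemma IsBand.sub_smul_one {X : Matrix (Fin (d + 1)) (Fin (d + 1)) F} {c : F} {u y l : ℤ → F}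
    (h : IsBand X u (fun n => c + y n) l) : IsBand (X - c • 1) u y l := by
  intro i j
  rw [Matrix.sub_apply, Matrix.smul_apply, h i j, one_apply, smul_eq_mul]
  by_cases hij : i = j
  · simp [hij]
  · have h' : (i : ℤ) ≠ j := by omega
    simp only [if_neg h', if_neg hij, mul_zero, sub_zero]

lemma sub_smul_one_apply_of_ne (X : Matrix (Fin (d + 1)) (Fin (d + 1)) F) (c : F) {i j : Fin (d + 1)}
    (h : (i : ℕ) ≠ j) : (X - c • (1 : Matrix (Fin (d + 1)) (Fin (d + 1)) F)) i j = X i j := by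
  rw [Matrix.sub_apply, Matrix.smul_apply, one_apply_ne (by omega), smul_zero, sub_zero]

lemma add_smul_one_apply_of_ne (X : Matrix (Fin (d + 1)) (Fin (d + 1)) F) (c : F) {i j : Fin (d + 1)}
    (h : (i : ℕ) ≠ j) : (X + c • (1 : Matrix (Fin (d + 1)) (Fin (d + 1)) F)) i j = X i j := by
  rw [Matrix.add_apply, Matrix.smul_apply, one_apply_ne (by omega), smul_zero, add_zero]

lemma exists_root_of_split (hq : q ≠ 0) (hqr : ∀ n : ℕ, 1 ≤ n → q ^ n ≠ 1) (hd : 3 ≤ d)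
    (hLP : IsLeonardPair A As) (hU : IsUnit U)
    (hUA : IsBand (U⁻¹ * A * U) 0 (fun n => α + qEig q d a a' n) (fun n => if n = 0 then 0 else 1))
    (hUAs : IsBand (U⁻¹ * As * U) (qSplit q d a a' b b' ξ) (fun n => αs + qEig q d b b' n) 0)
    (hS : IsUnit S) (hL : IsLowerBidiagonal (S⁻¹ * A * S))
    (h1 : ∀ i j : Fin (d + 1), (i : ℕ) = (j : ℕ) + 1 → (S⁻¹ * A * S) i j = 1)
    (hT : IsIrredTridiagonal (S⁻¹ * As * S)) :
    ∃ C : F, C ≠ 0 ∧ a * a' * C ^ 2 - ξ * C + b * b' = 0 := by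
  have hV : IsUnit (U⁻¹ * S) := (isUnit_nonsing_inv_iff.2 hU).mul hS
  have hUU : U * U⁻¹ = 1 := mul_nonsing_inv _ ((isUnit_iff_isUnit_det _).1 hU)
  have hVV : (U⁻¹ * S)⁻¹ * (U⁻¹ * S) = 1 := nonsing_inv_mul _ ((isUnit_iff_isUnit_det _).1 hV)
  have hconj : ∀ (X : Matrix (Fin (d + 1)) (Fin (d + 1)) F) (c : F),
      (U⁻¹ * S)⁻¹ * (U⁻¹ * X * U - c • 1) * (U⁻¹ * S) = S⁻¹ * X * S - c • 1 := by
    intro X c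
    rw [mul_sub, sub_mul, mul_smul_comm, mul_one, smul_mul_assoc, hVV, Matrix.mul_inv_rev,
      nonsing_inv_nonsing_inv _ ((isUnit_iff_isUnit_det _).1 hU)]
    congr 1
    calc S⁻¹ * U * (U⁻¹ * X * U) * (U⁻¹ * S) = S⁻¹ * (U * U⁻¹) * X * (U * U⁻¹) * S := by
          simp only [mul_assoc]
      _ = _ := by rw [hUU, mul_one, mul_one]
  have hA := hUA.sub_smul_one
  have hB := hUAs.sub_smul_one
  have hA' := hA.mulVec_stdVec (by simp) (by simp)
  have hB' := hB.mulVec_stdVec (by simp) (by simp [qSplit])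
  simp only [Pi.zero_apply, zero_smul, zero_add] at hA'
  simp only [Pi.zero_apply, zero_smul, add_zero] at hB'
  have hε : ∀ n : ℤ, 1 ≤ n → (fun n : ℤ => if n = 0 then (0 : F) else 1) n = 1 := by
    intro n hn
    simp only [show n ≠ 0 by omega, if_false]
  have hAWL := (askeyWilsonLeft_of_split hq hε hA' hB').conj hV
  have hAWR := (askeyWilsonRight_of_split hq hε hA' hB').conj hV
  have htA := trace_mul_sub_inv_of_diag hq fun i => (hA i i).trans (if_pos rfl)
  have htB := trace_mul_sub_inv_of_diag hq fun i => (hB i i).trans (if_pos rfl)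
  rw [← trace_inv_mul_mul hV] at htA htB
  rw [hconj, hconj] at hAWL hAWR
  rw [hconj] at htA htB
  refine exists_root_of_isIrredTridiagonal hq hqr hd hAWL hAWR ?_ ?_ ⟨?_, ?_⟩ ?_ htA htB
  · intro i j h
    rw [sub_smul_one_apply_of_ne _ _ (by tauto), hL i j h]
  · intro i j h
    rw [sub_smul_one_apply_of_ne _ _ (by omega), h1 i j h]
  · intro i j h
    rw [sub_smul_one_apply_of_ne _ _ (by tauto), hT.1 i j h]
  · intro i j h
    rw [sub_smul_one_apply_of_ne _ _ (by omega)]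
    exact hT.2 i j h
  · intro i j h
    refine diag_injective_of_isLeonardPair hLP hS hL h1 ?_
    simpa using h

end Form

section Sufficiency

lemma IsBand.transpose {M : Matrix (Fin (d + 1)) (Fin (d + 1)) F} {u y l : ℤ → F}
    (h : IsBand M u y l) : IsBand Mᵀ l y u := by
  intro i j
  rw [transpose_apply, h j i]
  split_ifs with h1 h2 h3 h4 <;> first | rfl | omega | rw [h1]

/-- The matrix with entries `v i j`. -/
def ofInt (d : ℕ) (v : ℤ → ℤ → F) : Matrix (Fin (d + 1)) (Fin (d + 1)) F :=
  of fun i j => v i j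

lemma ofInt_mulVec_stdVec (v : ℤ → ℤ → F) {n : ℤ} (h0 : 0 ≤ n) (h1 : n ≤ d) :
    ofInt d v *ᵥ stdVec F d n = fun i : Fin (d + 1) => v i n := by
  obtain ⟨m, rfl⟩ : ∃ m : Fin (d + 1), n = m := ⟨⟨n.toNat, by omega⟩, by simp [h0]⟩
  rw [stdVec_coe, mulVec_single_one]
  rfl

lemma smul_ofInt_mulVec_stdVec (v : ℤ → ℤ → F) {c : F} {n : ℤ} (h : c ≠ 0 → 0 ≤ n ∧ n ≤ d) :
    c • (ofInt d v *ᵥ stdVec F d n) = fun i : Fin (d + 1) => c * v i n := by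
  by_cases hc : c = 0
  · subst hc
    simp only [zero_smul, zero_mul]
    rfl
  · rw [ofInt_mulVec_stdVec v (h hc).1 (h hc).2]
    rfl

lemma ofInt_mul_apply_of_isBand {M : Matrix (Fin (d + 1)) (Fin (d + 1)) F} {u y l : ℤ → F}
    (h : IsBand M u y l) (hl : l 0 = 0) (hu : u (d + 1) = 0) (hu0 : u 0 = 0) (hld : l (d + 1) = 0)
    (v : ℤ → ℤ → F) (i j : Fin (d + 1)) :
    (ofInt d v * M) i j = u j * v i (j - 1) + y j * v i j + l (j + 1) * v i (j + 1) := by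
  have hj := j.2
  have : (ofInt d v * M) i j = ((ofInt d v * M) *ᵥ stdVec F d j) i := by
    rw [stdVec_coe, mulVec_single_one, col_apply]
  rw [this, ← mulVec_mulVec, h.mulVec_stdVec hl hu, mulVec_add, mulVec_add, mulVec_smul, mulVec_smul,
    mulVec_smul, ofInt_mulVec_stdVec v (n := j) (by omega) (by omega), smul_ofInt_mulVec_stdVec,
    smul_ofInt_mulVec_stdVec]
  · rfl
  · intro hc
    have : (j : ℤ) + 1 ≠ d + 1 := fun h' => hc (by rw [h', hld])
    omega
  · intro hc
    have : (j : ℤ) ≠ 0 := fun h' => hc (by rw [h', hu0])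
    omega

lemma mul_ofInt_apply_of_isBand {M : Matrix (Fin (d + 1)) (Fin (d + 1)) F} {u y l : ℤ → F}
    (h : IsBand M u y l) (hl : l 0 = 0) (hu : u (d + 1) = 0) (hu0 : u 0 = 0) (hld : l (d + 1) = 0)
    (v : ℤ → ℤ → F) (i j : Fin (d + 1)) :
    (M * ofInt d v) i j = l i * v (i - 1) j + y i * v i j + u (i + 1) * v (i + 1) j := by
  rw [← transpose_apply (M * ofInt d v), transpose_mul]
  exact ofInt_mul_apply_of_isBand h.transpose hu0 hld hl hu (fun i j => v j i) j i

lemma exists_recursive (r : ℤ → F) (hi : ℤ) (hr : ∀ n, 1 ≤ n → n ≤ hi → r n ≠ 0) :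
    ∃ f : ℤ → F, f 0 = 1 ∧ (∀ n, 0 ≤ n → f (n + 1) = f n * r (n + 1)) ∧
      ∀ n, 0 ≤ n → n ≤ hi → f n ≠ 0 := by
  have hf : ∀ n : ℤ, 0 ≤ n → ∏ k ∈ Finset.range (n + 1).toNat, r (k + 1) =
      (∏ k ∈ Finset.range n.toNat, r (k + 1)) * r (n + 1) := by
    intro n hn
    rw [show (n + 1).toNat = n.toNat + 1 by omega, Finset.prod_range_succ, Int.toNat_of_nonneg hn]
  refine ⟨fun n => ∏ k ∈ Finset.range n.toNat, r (k + 1), by simp, hf, fun n _ hn => ?_⟩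
  refine Finset.prod_ne_zero_iff.2 fun k hk => hr _ (by omega) ?_
  have := Finset.mem_range.1 hk
  omega

section Recursion

variable {q a a' b b' C : F} {H : ℤ → F}

lemma exists_coupling (hq : q ≠ 0) (hqr : ∀ n : ℕ, 1 ≤ n → q ^ n ≠ 1) (C : F) :
    ∃ H : ℤ → F, H 0 = 1 ∧ (∀ n < 0, H n = 0) ∧
      ∀ n, H (n + 1) * (q ^ (n + 1) - (q ^ (n + 1))⁻¹) = -C * q ^ n * H n := by
  obtain ⟨f, h0, h1, -⟩ := exists_recursive
    (fun n => -C * q ^ (n - 1) / (q ^ n - (q ^ n)⁻¹)) 0 (fun n _ _ => by omega)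
  refine ⟨fun n => if n < 0 then 0 else f n, by simp [h0], fun n hn => if_pos hn, fun n => ?_⟩
  rcases lt_trichotomy n (-1) with hn | rfl | hn
  · simp [show n < 0 by omega, show n + 1 < 0 by omega]
  · simp
  · simp only [show ¬ n < 0 by omega, show ¬ n + 1 < 0 by omega, if_false]
    have hne : q ^ (n + 1) - (q ^ (n + 1))⁻¹ ≠ 0 := by
      intro h
      have hK : q ^ (n + 1) ≠ 0 := zpow_ne_zero _ hq
      apply hqr ((n + 1).toNat * 2) (by omega)
      have h2 : q ^ (n + 1).toNat = q ^ (n + 1) := by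
        rw [← zpow_natCast, Int.toNat_of_nonneg (by omega)]
      rw [pow_mul, h2]
      field_simp at h
      linear_combination h
    rw [h1 n (by omega), add_sub_cancel_right, mul_assoc, div_mul_cancel₀ _ hne]
    ring

lemma coupling_mul_qEig_sub (hq : q ≠ 0)
    (hH : ∀ n, H (n + 1) * (q ^ (n + 1) - (q ^ (n + 1))⁻¹) = -C * q ^ n * H n) (i j : ℤ) :
    H (i - j) * (qEig q d a a' i - qEig q d a a' j) =
      H (i - j - 1) * (C * a' * (q ^ (2 * (j + 1) - (d : ℤ) - 1))⁻¹ - C * a * q ^ (2 * i - (d : ℤ) - 1)) := by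
  have h := hH (i - j - 1)
  rw [sub_add_cancel, zpow_sub_one₀ hq, zpow_sub₀ hq] at h
  have e1 := qEig_add (d := d) hq a a' i 0
  have e2 := qEig_add (d := d) hq a a' j 0
  rw [add_zero] at e1 e2
  rw [e1, e2, show 2 * (j + 1) - (d : ℤ) - 1 = j + j - d + 1 by ring,
    show 2 * i - (d : ℤ) - 1 = i + i - d - 1 by ring, zpow_add_one₀ hq, zpow_sub_one₀ hq, mul_zero, zpow_zero,
    show 2 * i - (d : ℤ) = i + i - d by ring, show 2 * j - (d : ℤ) = j + j - d by ring]
  simp only [zpow_sub₀ hq, zpow_add₀ hq] at h ⊢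
  have hX : q ^ i ≠ 0 := zpow_ne_zero _ hq
  have hY : q ^ j ≠ 0 := zpow_ne_zero _ hq
  have hD : q ^ (d : ℤ) ≠ 0 := zpow_ne_zero _ hq
  generalize q ^ i = X at *
  generalize q ^ j = Y at *
  generalize q ^ (d : ℤ) = D at *
  linear_combination (norm := (field_simp; ring)) (a * X * Y / D - a' * D / (X * Y)) * h

lemma coupling_tridiagonal (hq : q ≠ 0) (hC : C ≠ 0)
    (hH : ∀ n, H (n + 1) * (q ^ (n + 1) - (q ^ (n + 1))⁻¹) = -C * q ^ n * H n) (i j : ℤ) {p : F} {R Q : ℤ → F}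
    (hR : ∀ n, R n = q ^ (2 * n - (d : ℤ) - 1)) (hQ : ∀ n, Q n = q ^ (2 * n - (d : ℤ))) :
    ((R (i + 1) + (R (i + 1))⁻¹ - p) * (b' + C * a * R (i + 1)) - (R j + (R j)⁻¹ - p) * (b' + C * a * R j)) / C
        * H (i - j + 1)
      + (Q i * (b + b' - C * a * p) + C * a * (q + q⁻¹) * Q i ^ 2 - qEig q d b b' j) * H (i - j)
      + C * R i * (b + C * a * R i) * H (i - j - 1) = 0 := by
  have h := hH (i - j - 1)
  have h' := hH (i - j)
  rw [zpow_add_one₀ hq, zpow_sub₀ hq] at h'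
  rw [sub_add_cancel, zpow_sub_one₀ hq, zpow_sub₀ hq] at h
  have e2 := qEig_add (d := d) hq b b' j 0
  rw [add_zero] at e2
  rw [e2, hR, hR, hR, hQ, show 2 * (i + 1) - (d : ℤ) - 1 = i + i - d + 1 by ring,
    show 2 * i - (d : ℤ) - 1 = i + i - d - 1 by ring, show 2 * j - (d : ℤ) - 1 = j + j - d - 1 by ring,
    zpow_add_one₀ hq, zpow_sub_one₀ hq, zpow_sub_one₀ hq, mul_zero, zpow_zero,
    show 2 * i - (d : ℤ) = i + i - d by ring, show 2 * j - (d : ℤ) = j + j - d by ring]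
  simp only [zpow_sub₀ hq, zpow_add₀ hq] at h h' ⊢
  have hX : q ^ i ≠ 0 := zpow_ne_zero _ hq
  have hY : q ^ j ≠ 0 := zpow_ne_zero _ hq
  have hD : q ^ (d : ℤ) ≠ 0 := zpow_ne_zero _ hq
  generalize q ^ i = X at *
  generalize q ^ j = Y at *
  generalize q ^ (d : ℤ) = D at *
  obtain ⟨m, hm⟩ : ∃ m, m = X * Y / D := ⟨_, rfl⟩
  linear_combination (norm := (rw [hm]; field_simp; ring))
    (b' * (m - m⁻¹) + C * a * m * (m * (q * X / Y + Y / (q * X)) - p)) / C * h'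
    + X * X / (D * q) * (b + C * a * (X * X / (D * q))) * (q * Y / X) * h

end Recursion

/-- The tridiagonal matrix with superdiagonal `u`, diagonal `y` and subdiagonal `l`. -/
def bandMatrix (d : ℕ) (u y l : ℤ → F) : Matrix (Fin (d + 1)) (Fin (d + 1)) F :=
  of fun i j => if (i : ℤ) = j then y j else if (i : ℤ) = j + 1 then l i
    else if (j : ℤ) = i + 1 then u j else 0

lemma isBand_bandMatrix (d : ℕ) (u y l : ℤ → F) : IsBand (bandMatrix d u y l) u y l :=
  fun _ _ => rfl

lemma isIrredTridiagonal_of_isBand {M : Matrix (Fin (d + 1)) (Fin (d + 1)) F} {u y l : ℤ → F}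
    (h : IsBand M u y l) (hu : ∀ n : ℤ, 1 ≤ n → n ≤ d → u n ≠ 0) (hl : ∀ n : ℤ, 1 ≤ n → n ≤ d → l n ≠ 0) :
    IsIrredTridiagonal M := by
  refine ⟨fun i j hij => ?_, fun i j hij => ?_⟩
  · rw [h i j]
    split_ifs <;> first | rfl | omega
  · rw [h i j]
    split_ifs with h1 h2 h3
    · omega
    · exact hl _ (by omega) (by omega)
    · exact hu _ (by omega) (by omega)
    · omega

variable {q a a' b b' ξ C : F} {X Y : Matrix (Fin (d + 1)) (Fin (d + 1)) F} {ε : ℤ → F}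

lemma qSplit_eq_of_root (hq : q ≠ 0) (hC : C ≠ 0) (hroot : a * a' * C ^ 2 - ξ * C + b * b' = 0) (n : ℤ)
    {P R : F} (hP : P = q ^ ((d : ℤ) + 1)) (hR : R = q ^ (2 * n - (d : ℤ) - 1)) :
    qSplit q d a a' b b' ξ n =
      (R + R⁻¹ - (P + P⁻¹)) * ((b' + C * a * R) * (b + C * a' * R⁻¹) / C) := by
  have h := qSplit_add hq a a' b b' ξ n 0 (d := d) rfl hP
  rw [mul_zero, zero_sub, add_zero, ← zpow_add₀ hq, show -1 + (2 * n - (d : ℤ)) = 2 * n - d - 1 by ring,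
    ← hR] at h
  have hR0 : R ≠ 0 := hR ▸ zpow_ne_zero _ hq
  rw [h, sub_sub]
  congr 1
  field_simp
  linear_combination -R * hroot

lemma exists_bidiagonal_tridiagonal_form (hq : q ≠ 0) (hqr : ∀ n : ℕ, 1 ≤ n → q ^ n ≠ 1) (hC : C ≠ 0)
    (hroot : a * a' * C ^ 2 - ξ * C + b * b' = 0)
    (hφ : ∀ n : ℤ, 1 ≤ n → n ≤ d → qSplit q d a a' b b' ξ n ≠ 0)
    (hφ' : ∀ n : ℤ, 1 ≤ n → n ≤ d → qSplit q d a' a b b' ξ n ≠ 0)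
    (hε0 : ε 0 = 0) (hεd : ε (d + 1) = 0) (hε : ∀ n : ℤ, 1 ≤ n → n ≤ d → ε n = 1)
    (hX : IsBand X 0 (qEig q d a a') ε) (hY : IsBand Y (qSplit q d a a' b b' ξ) (qEig q d b b') 0) :
    ∃ V L B : Matrix (Fin (d + 1)) (Fin (d + 1)) F, IsUnit V ∧ IsBand L 0 (qEig q d a a') ε ∧
      IsIrredTridiagonal B ∧ L * V = V * X ∧ B * V = V * Y := by
  obtain ⟨P, hP⟩ : ∃ P, P = q ^ ((d : ℤ) + 1) := ⟨_, rfl⟩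
  obtain ⟨R, hR⟩ : ∃ R : ℤ → F, ∀ n, R n = q ^ (2 * n - (d : ℤ) - 1) := ⟨_, fun _ => rfl⟩
  obtain ⟨Q, hQ⟩ : ∃ Q : ℤ → F, ∀ n, Q n = q ^ (2 * n - (d : ℤ)) := ⟨_, fun _ => rfl⟩
  have hsplit := fun n => qSplit_eq_of_root (d := d) hq hC hroot n hP (hR n)
  have hsplit' := fun n => qSplit_eq_of_root (d := d) (a := a') (a' := a) (b := b) (b' := b') (ξ := ξ) hq hC
    (by rw [mul_comm a', hroot]) n hP (hR n)
  have hR0 : ∀ n, R n ≠ 0 := fun n => hR n ▸ zpow_ne_zero _ hq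
  have hRinv : ∀ n, (R (d + 1 - n))⁻¹ = R n := by
    intro n
    rw [hR, hR, ← zpow_neg]
    congr 1
    ring
  have hne : ∀ n : ℤ, 1 ≤ n → n ≤ d → R n + (R n)⁻¹ - (P + P⁻¹) ≠ 0 ∧ b' + C * a * R n ≠ 0 ∧
      b + C * a' * (R n)⁻¹ ≠ 0 ∧ b + C * a * R n ≠ 0 := by
    intro n h1 h2
    have e1 := hφ n h1 h2
    have e2 := hφ' (d + 1 - n) (by omega) (by omega)
    rw [hsplit] at e1
    rw [hsplit', hRinv] at e2
    refine ⟨left_ne_zero_of_mul e1, fun h => e1 ?_, fun h => e1 ?_, fun h => e2 ?_⟩ <;> simp [h]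
  have hRd : R (d + 1) + (R (d + 1))⁻¹ - (P + P⁻¹) = 0 := by
    rw [hR, hP, show 2 * ((d : ℤ) + 1) - d - 1 = d + 1 by ring, sub_self]
  have hR00 : R 0 + (R 0)⁻¹ - (P + P⁻¹) = 0 := by
    have h := hRinv 0
    rw [sub_zero] at h
    rw [← hRd, ← h, inv_inv, add_comm]
  obtain ⟨H, hH0, hHneg, hH⟩ := exists_coupling hq hqr C
  obtain ⟨f, -, hf1, hf⟩ := exists_recursive (fun n => b + C * a * R n) d fun n h1 h2 => (hne n h1 h2).2.2.2
  obtain ⟨g, -, hg1, hg⟩ := exists_recursive (fun n => b + C * a' * (R n)⁻¹) d fun n h1 h2 => (hne n h1 h2).2.2.1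
  obtain ⟨z, hz⟩ : ∃ z : ℤ → F, ∀ n, z n =
    (R n + (R n)⁻¹ - (P + P⁻¹)) * ((b + C * a * R n) * (b' + C * a * R n) / C) := ⟨_, fun _ => rfl⟩
  obtain ⟨y, hy⟩ : ∃ y : ℤ → F, ∀ n, y n =
    Q n * (b + b' - C * a * (P + P⁻¹)) + C * a * (q + q⁻¹) * Q n ^ 2 := ⟨_, fun _ => rfl⟩
  have hv0 : ∀ i j : ℤ, i < j → H (i - j) * g j / f i = 0 := by
    intro i j h
    rw [hHneg _ (by omega), zero_mul, zero_div]
  have hL := isBand_bandMatrix d 0 (qEig q d a a') ε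
  have hB := isBand_bandMatrix d z y (fun n => ε n * (C * R n))
  have hstep : ∀ i j : ℤ, 0 ≤ i → i ≤ d → 0 ≤ j →
      ε i * (H (i - 1 - j) * g j / f (i - 1)) = (H (i - j - 1) * (b + C * a * R i)) * (g j / f i) := by
    intro i j h0 h1 hj
    rcases h0.eq_or_lt with rfl | h
    · rw [hε0, hHneg (0 - j - 1) (by omega), zero_mul, zero_mul, zero_mul]
    · have e := hf1 (i - 1) (by omega)
      rw [sub_add_cancel] at e
      have e1 := hf (i - 1) (by omega) (by omega)
      have e2 := hf i (by omega) (by omega)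
      rw [hε i (by omega) h1, show i - 1 - j = i - j - 1 by ring, one_mul]
      field_simp
      rw [e]
      ring
  refine ⟨ofInt d fun i j => H (i - j) * g j / f i, _, _, ?_, hL, isIrredTridiagonal_of_isBand hB ?_ ?_, ?_, ?_⟩
  · rw [isUnit_iff_isUnit_det, isUnit_iff_ne_zero, det_of_isLowerTriangular]
    · refine Finset.prod_ne_zero_iff.2 fun i _ => ?_
      have := i.2
      simp only [ofInt, of_apply, sub_self, hH0, one_mul]
      exact div_ne_zero (hg i (by omega) (by omega)) (hf i (by omega) (by omega))
    · intro i j hij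
      exact hv0 _ _ (by simpa using hij)
  · intro n h1 h2
    rw [hz]
    obtain ⟨e1, e2, -, e4⟩ := hne n h1 h2
    exact mul_ne_zero e1 (div_ne_zero (mul_ne_zero e4 e2) hC)
  · intro n h1 h2
    simp only [hε n h1 h2, one_mul]
    exact mul_ne_zero hC (hR0 n)
  · ext i j
    have hi := i.2
    have hj := j.2
    rw [mul_ofInt_apply_of_isBand hL hε0 rfl rfl hεd, ofInt_mul_apply_of_isBand hX hε0 rfl rfl hεd,
      hstep _ _ (by omega) (by omega) (by omega)]
    have hg' : ε (j + 1) * (H (i - (j + 1)) * g (j + 1) / f i) =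
        H (i - j - 1) * (b + C * a' * (R (j + 1))⁻¹) * (g j / f i) := by
      by_cases hjd : (j : ℤ) = d
      · rw [hjd, hεd, hHneg (i - d - 1) (by omega)]
        ring
      · rw [hε _ (by omega) (by omega), hg1 j (by omega), sub_add_eq_sub_sub]
        ring
    rw [hg']
    have key := coupling_mul_qEig_sub (d := d) (a := a) (a' := a') hq hH i j
    rw [← hR, ← hR] at key
    simp only [Pi.zero_apply, zero_mul]
    linear_combination (g j / f i) * key
  · ext i j
    have hi := i.2
    have hj := j.2
    have hzd : z (d + 1) = 0 := by rw [hz, hRd, zero_mul]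
    have hz0 : z 0 = 0 := by rw [hz, hR00, zero_mul]
    rw [mul_ofInt_apply_of_isBand hB (by simp [hε0]) hzd hz0 (by simp [hεd]),
      ofInt_mul_apply_of_isBand hY rfl (by rw [hsplit, hRd, zero_mul]) (qSplit_zero _ _ _ _ _ _ _) rfl]
    have e1 : z (i + 1) * (H (i + 1 - j) * g j / f (i + 1)) =
        (R (i + 1) + (R (i + 1))⁻¹ - (P + P⁻¹)) * (b' + C * a * R (i + 1)) / C * H (i - j + 1) * (g j / f i) := by
      by_cases hid : (i : ℤ) = d
      · rw [hid, hzd, hRd]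
        ring
      · have h1 := hf i (by omega) (by omega)
        have h2 := (hne (i + 1) (by omega) (by omega)).2.2.2
        rw [hz, hf1 i (by omega), show (i : ℤ) + 1 - j = i - j + 1 by ring]
        generalize b + C * a * R (i + 1) = T at h2 ⊢
        field_simp
    have e2 : qSplit q d a a' b b' ξ j * (H (i - (j - 1)) * g (j - 1) / f i) =
        (R j + (R j)⁻¹ - (P + P⁻¹)) * (b' + C * a * R j) / C * H (i - j + 1) * (g j / f i) := by
      by_cases hj0 : (j : ℤ) = 0
      · rw [hsplit, hj0, hR00]
        ring
      · have h1 := hg1 (j - 1) (by omega)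
        rw [sub_add_cancel] at h1
        rw [hsplit, h1, show (i : ℤ) - (j - 1) = i - j + 1 by ring]
        ring
    have e3 := hstep i j (by omega) (by omega) (by omega)
    rw [e1, e2]
    have key := coupling_tridiagonal (d := d) (a := a) (b := b) (b' := b') hq hC hH i j (p := P + P⁻¹) hR hQ
    rw [← hy] at key
    simp only [Pi.zero_apply, zero_mul]
    linear_combination (g j / f i) * key + C * R i * e3

end Sufficiency

lemma conj_eq_add_smul_one {A U V M : Matrix (Fin (d + 1)) (Fin (d + 1)) F} {c : F}
    (hV : IsUnit V) (h : M * V = V * (U⁻¹ * A * U - c • 1)) :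
    (U * V⁻¹)⁻¹ * A * (U * V⁻¹) = M + c • 1 := by
  have hVV : V * V⁻¹ = 1 := mul_nonsing_inv _ ((isUnit_iff_isUnit_det _).1 hV)
  have h' : V * (U⁻¹ * A * U) = (M + c • 1) * V := by
    rw [mul_sub, mul_smul_comm, mul_one] at h
    rw [add_mul, smul_mul_assoc, one_mul, h, sub_add_cancel]
  rw [Matrix.mul_inv_rev, nonsing_inv_nonsing_inv _ ((isUnit_iff_isUnit_det _).1 hV)]
  calc V * U⁻¹ * A * (U * V⁻¹) = V * (U⁻¹ * A * U) * V⁻¹ := by simp only [mul_assoc]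
    _ = _ := by rw [h', mul_assoc, hVV, mul_one]

lemma exists_ne_zero_root [IsAlgClosed F] {r s t : F}
    (h : (r ≠ 0 ∧ s ≠ 0) ∨ (r ≠ 0 ∧ t ≠ 0) ∨ (s ≠ 0 ∧ t ≠ 0)) :
    ∃ C : F, C ≠ 0 ∧ r * C ^ 2 - t * C + s = 0 := by
  by_cases hr : r = 0
  · subst hr
    have hst : s ≠ 0 ∧ t ≠ 0 := by tauto
    refine ⟨s / t, div_ne_zero hst.1 hst.2, ?_⟩
    have := hst.2
    field_simp
    ring
  by_cases hs : s = 0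
  · subst hs
    have ht : t ≠ 0 := by tauto
    refine ⟨t / r, div_ne_zero ht hr, ?_⟩
    field_simp
    ring
  · obtain ⟨C, hC⟩ := IsAlgClosed.exists_root
      (Polynomial.C r * Polynomial.X ^ 2 + Polynomial.C (-t) * Polynomial.X + Polynomial.C s)
      (by rw [Polynomial.degree_quadratic hr]; decide)
    simp only [Polynomial.IsRoot, Polynomial.eval_add, Polynomial.eval_mul, Polynomial.eval_C,
      Polynomial.eval_pow, Polynomial.eval_X] at hC
    refine ⟨C, fun h0 => hs ?_, by linear_combination hC⟩
    simpa [h0] using hC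

lemma two_ne_zero_of_root {r s t C : F} (hC : C ≠ 0) (h : r * C ^ 2 - t * C + s = 0)
    (hne : ¬ (r = 0 ∧ s = 0 ∧ t = 0)) :
    (r ≠ 0 ∧ s ≠ 0) ∨ (r ≠ 0 ∧ t ≠ 0) ∨ (s ≠ 0 ∧ t ≠ 0) := by
  by_cases hr : r = 0 <;> by_cases hs : s = 0 <;> by_cases ht : t = 0 <;> simp_all

end LeonardHelpers
/-- Theorem 1.12 of the paper: a Leonard pair with quantum parameter `q` not a root
of unity has LB-TD form iff at least two of `a a'`, `b b'`, `ξ` are nonzero. -/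
theorem stmt4 {F : Type*} [Field F] [IsAlgClosed F] {d : ℕ} (hd : 3 ≤ d)
    (q α αs a a' b b' ξ : F) (hq : q ≠ 0)
    (hqru : ∀ n : ℕ, 1 ≤ n → q ^ n ≠ 1)
    (θ θs φ φh : ℕ → F)
    (hθ : ∀ i : ℕ, i ≤ d → θ i = α + a * q ^ (2 * (i : ℤ) - (d : ℤ)) + a' * q ^ ((d : ℤ) - 2 * (i : ℤ)))
    (hθs : ∀ i : ℕ, i ≤ d → θs i = αs + b * q ^ (2 * (i : ℤ) - (d : ℤ)) + b' * q ^ ((d : ℤ) - 2 * (i : ℤ)))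
    (hφ : ∀ i : ℕ, 1 ≤ i → i ≤ d → φ i = (q ^ (i : ℤ) - q ^ (-(i : ℤ))) * (q ^ ((i : ℤ) - (d : ℤ) - 1) - q ^ ((d : ℤ) - (i : ℤ) + 1)) * (ξ + a * b * q ^ (2 * (i : ℤ) - (d : ℤ) - 1) + a' * b' * q ^ ((d : ℤ) - 2 * (i : ℤ) + 1)))
    (hφh : ∀ i : ℕ, 1 ≤ i → i ≤ d → φh i = (q ^ (i : ℤ) - q ^ (-(i : ℤ))) * (q ^ ((i : ℤ) - (d : ℤ) - 1) - q ^ ((d : ℤ) - (i : ℤ) + 1)) * (ξ + a' * b * q ^ (2 * (i : ℤ) - (d : ℤ) - 1) + a * b' * q ^ ((d : ℤ) - 2 * (i : ℤ) + 1)))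
    (A As : Matrix (Fin (d + 1)) (Fin (d + 1)) F)
    (hLP : IsLeonardPair A As)
    (hU : ∃ U : Matrix (Fin (d + 1)) (Fin (d + 1)) F, IsUnit U ∧
      (∀ i j : Fin (d + 1), (U⁻¹ * A * U) i j =
        if (i : ℕ) = (j : ℕ) then θ (i : ℕ)
        else if (i : ℕ) = (j : ℕ) + 1 then 1 else 0) ∧
      (∀ i j : Fin (d + 1), (U⁻¹ * As * U) i j =
        if (i : ℕ) = (j : ℕ) then θs (i : ℕ)
        else if (j : ℕ) = (i : ℕ) + 1 then φ (j : ℕ) else 0))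
    (hW : ∃ W : Matrix (Fin (d + 1)) (Fin (d + 1)) F, IsUnit W ∧
      (∀ i j : Fin (d + 1), (W⁻¹ * A * W) i j =
        if (i : ℕ) = (j : ℕ) then θ (d - (i : ℕ))
        else if (i : ℕ) = (j : ℕ) + 1 then 1 else 0) ∧
      (∀ i j : Fin (d + 1), (W⁻¹ * As * W) i j =
        if (i : ℕ) = (j : ℕ) then θs (i : ℕ)
        else if (j : ℕ) = (i : ℕ) + 1 then φh (j : ℕ) else 0)) :
    (∃ S : Matrix (Fin (d + 1)) (Fin (d + 1)) F, IsUnit S ∧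
      IsLowerBidiagonal (S⁻¹ * A * S) ∧
      (∀ i j : Fin (d + 1), (i : ℕ) = (j : ℕ) + 1 → (S⁻¹ * A * S) i j = 1) ∧
      IsIrredTridiagonal (S⁻¹ * As * S)) ↔
    ((a * a' ≠ 0 ∧ b * b' ≠ 0) ∨ (a * a' ≠ 0 ∧ ξ ≠ 0) ∨ (b * b' ≠ 0 ∧ ξ ≠ 0)) := by
  obtain ⟨U, hU, hUA, hUAs⟩ := hU
  obtain ⟨W, hW, hWA, hWAs⟩ := hW
  have hUband : ∀ ε : ℤ → F, (∀ n : ℤ, 1 ≤ n → n ≤ d → ε n = 1) →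
      IsBand (U⁻¹ * A * U) 0 (fun n => α + qEig q d a a' n) ε := by
    intro ε hε i j
    rw [hUA]
    split_ifs with h1 h2 h3 h4 h5 h6 <;> first | omega | rfl | skip
    · rw [hθ _ (by omega), h1, add_assoc]; rfl
    · exact (hε _ (by omega) (by omega)).symm
  have hUsband : IsBand (U⁻¹ * As * U) (qSplit q d a a' b b' ξ) (fun n => αs + qEig q d b b' n) 0 := by
    intro i j
    rw [hUAs]
    split_ifs with h1 h2 h3 h4 h5 h6 <;> first | omega | rfl | skip
    · rw [hθs _ (by omega), h1, add_assoc]; rfl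
    · exact hφ _ (by omega) (by omega)
  constructor
  · rintro ⟨S, hS, hL, h1, hT⟩
    obtain ⟨C, hC, hroot⟩ := exists_root_of_split hq hqru hd hLP hU
      (hUband _ fun n hn _ => if_neg (by omega)) hUsband hS hL h1 hT
    refine two_ne_zero_of_root hC hroot fun ⟨h1, h2, h3⟩ => ?_
    have e1 := split_ne_zero hLP hU hUA hUAs le_rfl (by omega : 1 ≤ d)
    have e2 := split_ne_zero hLP hW (t := fun i => θ (d - i)) hWA hWAs le_rfl (by omega : 1 ≤ d)
    rw [hφ 1 le_rfl (by omega), h3] at e1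
    rw [hφh 1 le_rfl (by omega), h3] at e2
    refine mul_ne_zero (right_ne_zero_of_mul e1) (right_ne_zero_of_mul e2) ?_
    generalize q ^ (2 * ((1 : ℕ) : ℤ) - (d : ℤ) - 1) = R
    generalize q ^ ((d : ℤ) - 2 * ((1 : ℕ) : ℤ) + 1) = T
    linear_combination (b ^ 2 * R ^ 2 + b' ^ 2 * T ^ 2) * h1 + (a ^ 2 + a' ^ 2) * R * T * h2
  · intro h
    obtain ⟨C, hC, hroot⟩ := exists_ne_zero_root h
    have hne : ∀ n : ℤ, 1 ≤ n → n ≤ d → qSplit q d a a' b b' ξ n ≠ 0 := by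
      intro n h1 h2
      obtain ⟨m, rfl⟩ : ∃ m : ℕ, n = m := ⟨n.toNat, by omega⟩
      have := split_ne_zero hLP hU hUA hUAs (by omega : 1 ≤ m) (by omega)
      rwa [hφ m (by omega) (by omega)] at this
    have hne' : ∀ n : ℤ, 1 ≤ n → n ≤ d → qSplit q d a' a b b' ξ n ≠ 0 := by
      intro n h1 h2
      obtain ⟨m, rfl⟩ : ∃ m : ℕ, n = m := ⟨n.toNat, by omega⟩
      have := split_ne_zero hLP hW (t := fun i => θ (d - i)) hWA hWAs (by omega : 1 ≤ m) (by omega)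
      rwa [hφh m (by omega) (by omega)] at this
    obtain ⟨ε, hε0, hεd, hε⟩ : ∃ ε : ℤ → F, ε 0 = 0 ∧ ε (d + 1) = 0 ∧ ∀ n : ℤ, 1 ≤ n → n ≤ d → ε n = 1 :=
      ⟨fun n => if 1 ≤ n ∧ n ≤ d then 1 else 0, by simp, by simp, fun n h1 h2 => if_pos ⟨h1, h2⟩⟩
    obtain ⟨V, L, B, hV, hL, hB, hLV, hBV⟩ := exists_bidiagonal_tridiagonal_form hq hqru hC hroot hne hne'
      hε0 hεd hε (hUband ε hε).sub_smul_one hUsband.sub_smul_one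
    refine ⟨U * V⁻¹, hU.mul (Matrix.isUnit_nonsing_inv_iff.2 hV), ?_, ?_, ?_, ?_⟩
    · intro i j hij
      rw [conj_eq_add_smul_one hV hLV, add_smul_one_apply_of_ne _ _ (by tauto), hL i j]
      split_ifs <;> first | rfl | omega
    · intro i j hij
      rw [conj_eq_add_smul_one hV hLV, add_smul_one_apply_of_ne _ _ (by omega), hL i j,
        if_neg (by omega), if_pos (by omega)]
      exact hε _ (by omega) (by omega)
    · intro i j hij
      rw [conj_eq_add_smul_one hV hBV, add_smul_one_apply_of_ne _ _ (by tauto), hB.1 i j hij]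
    · intro i j hij
      rw [conj_eq_add_smul_one hV hBV, add_smul_one_apply_of_ne _ _ (by omega)]
      exact hB.2 i j hij
end

section
/- With the hypotheses of the Askey–Wilson setting below, assume moreover that z_i = z_1·q^{2−2i} for 1 ≤ i ≤ d. Then x_{i−1}² − β·x_{i−1}x_i + x_i² − ρ* = (q + q^{−1})(q^{−1}·y_{i−1} − (q + q^{−1})·y_i + q·y_{i+1})·z_i for 1 ≤ i ≤ d. -/
/-- The entry in row `i` and column `j` of the infinite tridiagonal matrix with diagonal `x`,
superdiagonal `y` and subdiagonal `z`. -/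
def tridiagEntry {R : Type*} [Zero R] (x y z : ℕ → R) (i j : ℕ) : R :=
  if i = j then x i else if i = j + 1 then z i else if j = i + 1 then y j else 0

/-- The action of the tridiagonal matrix with diagonal `x`, superdiagonal `y` and subdiagonal `z`
on the column `f`; the value in row `0` is the expected one when `z 0 = 0`. -/
def tridiagApply {R : Type*} [Semiring R] (x y z f : ℕ → R) (i : ℕ) : R :=
  z i * f (i - 1) + x i * f i + y (i + 1) * f (i + 1)

/-- Multiplying a column on the left by a finite tridiagonal matrix is given by
`tridiagApply`. -/
lemma tridiag_mul_apply {R : Type*} [Semiring R] {d : ℕ} {x y z : ℕ → R}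
    (hz : z 0 = 0) (hy : y (d + 1) = 0) {T M : Matrix (Fin (d + 1)) (Fin (d + 1)) R}
    (hT : ∀ i j : Fin (d + 1), T i j = tridiagEntry x y z i j)
    {j : Fin (d + 1)} {f : ℕ → R} (hM : ∀ i : Fin (d + 1), M i j = f i) (i : Fin (d + 1)) :
    (T * M) i j = tridiagApply x y z f i := by
  obtain ⟨i, hi⟩ := i
  simp only [Matrix.mul_apply, hT, hM]
  rw [Fin.sum_univ_eq_sum_range (fun m => tridiagEntry x y z i m * f m) (d + 1)]
  have key : ∀ m, tridiagEntry x y z i m * f m =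
      (if i - 1 = m then z i * f m else 0) + (if i = m then x i * f m else 0) +
        (if i + 1 = m then y m * f m else 0) := by
    intro m
    unfold tridiagEntry
    rcases Nat.eq_zero_or_pos i with rfl | h0
    · rcases m with _ | _ | m <;> simp [hz]
    · split_ifs <;> first | omega | simp
  have hi' : i - 1 < d + 1 := by omega
  simp only [key, Finset.sum_add_distrib, Finset.sum_ite_eq, Finset.mem_range, hi, hi', if_true,
    tridiagApply]
  split_ifs with h
  · rfl
  · rw [show i + 1 = d + 1 by omega, hy, zero_mul]

/-- stmt12 of the paper, in the Askey–Wilson setting. -/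
theorem stmt12 {F : Type*} [Field F] [IsAlgClosed F] {d : ℕ} (hd : 3 ≤ d)
    (q a a' b b' ξ : F) (hq : q ≠ 0)
    (hqru : ∀ n : ℕ, 1 ≤ n → q ^ n ≠ 1)
    (θ : ℤ → F)
    (hθ : ∀ i : ℤ, θ i = a * q ^ (2 * i - (d : ℤ)) + a' * q ^ ((d : ℤ) - 2 * i))
    (hθdist : ∀ i j : ℕ, i ≤ d → j ≤ d → i ≠ j → θ i ≠ θ j)
    (β ρ ρs ω η ηs : F)
    (hβ : β = q ^ (2 : ℤ) + q ^ (-2 : ℤ))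
    (hρ : ρ = -(a * a') * (q ^ (2 : ℤ) - q ^ (-2 : ℤ)) ^ 2)
    (hρs : ρs = -(b * b') * (q ^ (2 : ℤ) - q ^ (-2 : ℤ)) ^ 2)
    (hω : ω = (q - q⁻¹) ^ 2 *
      ((q ^ ((d : ℤ) + 1) + q ^ (-(d : ℤ) - 1)) * ξ - (a + a') * (b + b')))
    (hη : η = -((q - q⁻¹) * (q ^ (2 : ℤ) - q ^ (-2 : ℤ)) *
      ((a + a') * ξ - a * a' * (b + b') * (q ^ ((d : ℤ) + 1) + q ^ (-(d : ℤ) - 1)))))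
    (hηs : ηs = -((q - q⁻¹) * (q ^ (2 : ℤ) - q ^ (-2 : ℤ)) *
      ((b + b') * ξ - b * b' * (a + a') * (q ^ ((d : ℤ) + 1) + q ^ (-(d : ℤ) - 1)))))
    (x y z : ℕ → F)
    (hyz : ∀ i : ℕ, 1 ≤ i → i ≤ d → y i * z i ≠ 0)
    (hy0 : y 0 = 0) (hyd1 : y (d + 1) = 0)
    (A As : Matrix (Fin (d + 1)) (Fin (d + 1)) F)
    (hA : ∀ i j : Fin (d + 1), A i j =
      if (i : ℕ) = (j : ℕ) then θ (i : ℕ)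
      else if (i : ℕ) = (j : ℕ) + 1 then 1 else 0)
    (hAs : ∀ i j : Fin (d + 1), As i j =
      if (i : ℕ) = (j : ℕ) then x (i : ℕ)
      else if (i : ℕ) = (j : ℕ) + 1 then z (i : ℕ)
      else if (j : ℕ) = (i : ℕ) + 1 then y (j : ℕ) else 0)
    (hAW1 : A ^ 2 * As - β • (A * As * A) + As * A ^ 2 - ρ • As =
      ω • A + η • (1 : Matrix (Fin (d + 1)) (Fin (d + 1)) F))
    (hAW2 : As ^ 2 * A - β • (As * A * As) + A * As ^ 2 - ρs • A =
      ω • As + ηs • (1 : Matrix (Fin (d + 1)) (Fin (d + 1)) F))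
    (hz : ∀ i : ℕ, 1 ≤ i → i ≤ d → z i = z 1 * q ^ ((2 : ℤ) - 2 * (i : ℤ))) :
    ∀ i : ℕ, 1 ≤ i → i ≤ d →
      x (i - 1) ^ 2 - β * x (i - 1) * x i + x i ^ 2 - ρs =
        (q + q⁻¹) * (q⁻¹ * y (i - 1) - (q + q⁻¹) * y i + q * y (i + 1)) * z i := by
  intro i hi1 hid
  obtain ⟨k, rfl⟩ : ∃ k, i = k + 1 := ⟨i - 1, by omega⟩
  have hA' : ∀ i j, A i j = tridiagEntry (fun n => θ n) (fun _ => 0)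
      (fun n => if n = 0 then 0 else 1) i j := by
    intro i j
    rw [hA, tridiagEntry]
    split_ifs <;> first | rfl | omega
  have hAs' : ∀ i j, As i j = tridiagEntry x y (fun n => if n = 0 then 0 else z n) i j := by
    intro i j
    rw [hAs, tridiagEntry]
    split_ifs <;> first | rfl | omega
  have mulA := fun {M j f} => tridiag_mul_apply (M := M) (j := j) (f := f) (by simp) (by simp) hA'
  have mulAs := fun {M j f} => tridiag_mul_apply (M := M) (j := j) (f := f) (by simp) hyd1 hAs'
  set r : Fin (d + 1) := ⟨k + 1, by omega⟩ with hr
  set c : Fin (d + 1) := ⟨k, by omega⟩ with hc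
  have hrc : r ≠ c := by simp [hr, hc]
  obtain ⟨f, hf⟩ : ∃ f : ℕ → F, f = fun n => tridiagEntry (fun n => θ n) (fun _ => 0)
      (fun n => if n = 0 then 0 else 1) n c := ⟨_, rfl⟩
  obtain ⟨g, hg⟩ : ∃ g : ℕ → F, g = fun n => tridiagEntry x y
      (fun n => if n = 0 then 0 else z n) n c := ⟨_, rfl⟩
  have colA : ∀ i, A i c = f i := fun i => by rw [hA', hf]
  have colAs : ∀ i, As i c = g i := fun i => by rw [hAs', hg]
  have e1 := congrFun (congrFun hAW1 r) c
  have e2 := congrFun (congrFun hAW2 r) c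
  simp only [pow_two, Matrix.mul_assoc, Matrix.sub_apply, Matrix.add_apply, Matrix.smul_apply,
    smul_eq_mul, Matrix.one_apply_ne hrc, mul_zero, add_zero, mulA (mulA colAs),
    mulA (mulAs colA), mulAs (mulA colA), mulAs (mulAs colA), mulAs (mulA colAs),
    mulA (mulAs colAs), colA, colAs] at e1 e2
  simp only [hf, hg] at e1 e2
  have hz1 : y k * (if k = 0 then 0 else z k) = y k * (q ^ 2 * z (k + 1)) := by
    rcases k with _ | k
    · simp [hy0]
    · rw [if_neg (by omega), hz (k + 1) (by omega) (by omega), hz (k + 1 + 1) (by omega) hid]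
      rw [show (2 : ℤ) - 2 * ((k + 1 : ℕ) : ℤ) = 2 + (2 - 2 * ((k + 1 + 1 : ℕ) : ℤ)) by
        push_cast; ring, zpow_add₀ hq]
      norm_cast
      ring
  have hz2 : y (k + 2) * z (k + 2) = y (k + 2) * (q⁻¹ ^ 2 * z (k + 1)) := by
    rcases Nat.lt_or_ge d (k + 2) with h | h
    · rw [show k + 2 = d + 1 by omega, hyd1, zero_mul, zero_mul]
    · rw [hz (k + 2) (by omega) h, hz (k + 1) (by omega) hid]
      rw [show (2 : ℤ) - 2 * ((k + 2 : ℕ) : ℤ) = -2 + (2 - 2 * ((k + 1 : ℕ) : ℤ)) by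
        push_cast; ring, zpow_add₀ hq, zpow_neg, inv_pow]
      norm_cast
      ring
  have hβ' : β = q ^ 2 + q⁻¹ ^ 2 := by
    rw [hβ, zpow_neg, inv_pow]
    norm_cast
  have hθρ : θ (k + 1 : ℕ) ^ 2 - β * θ (k + 1 : ℕ) * θ k + θ k ^ 2 = ρ := by
    have hk : q ^ (2 * (k : ℤ) - d) * q ^ ((d : ℤ) - 2 * k) = 1 := by
      rw [← zpow_add₀ hq]
      simp
    rw [hθ, hθ, hρ, hβ,
      show 2 * ((k + 1 : ℕ) : ℤ) - d = 2 + (2 * k - d) by push_cast; ring,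
      show (d : ℤ) - 2 * ((k + 1 : ℕ) : ℤ) = -2 + (d - 2 * k) by push_cast; ring,
      zpow_add₀ hq, zpow_add₀ hq]
    have hq2 : q ^ (2 : ℤ) * q ^ (-2 : ℤ) = 1 := by
      rw [← zpow_add₀ hq]
      simp
    generalize q ^ (2 * (k : ℤ) - d) = t at *
    generalize q ^ ((d : ℤ) - 2 * k) = u at *
    generalize q ^ (2 : ℤ) = v at *
    generalize q ^ (-2 : ℤ) = w at *
    linear_combination (-(a ^ 2 * t ^ 2 + a' ^ 2 * u ^ 2) - 2 * a * a') * hq2 +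
      a * a' * (2 * v * w + 2 - (v + w) ^ 2) * hk
  have hk1 : ∀ k : ℕ, k ≠ k + 1 + 1 := by omega
  have hk3 : ∀ k : ℕ, k + 1 + 1 + 1 ≠ k := by omega
  have hk2 : ∀ k : ℕ, k + 1 + 1 ≠ k := by omega
  have f1 : (θ (k + 1 : ℕ) ^ 2 - β * θ (k + 1 : ℕ) * θ k + θ k ^ 2 - ρ) * z (k + 1) +
      (θ (k + 1 : ℕ) + θ k) * (x (k + 1) + x k) -
      β * (θ (k + 1 : ℕ) * x (k + 1) + θ k * x k) + y k - β * y (k + 1) + y (k + 2) = ω := by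
    rcases k with _ | k
    · simp [tridiagApply, tridiagEntry, r, c] at e1
      simp [hy0]
      linear_combination e1
    · simp [tridiagApply, tridiagEntry, r, c, hk1, hk2, hk3] at e1
      push_cast at e1 ⊢
      linear_combination e1
  have f2 : (θ k + θ (k + 1 : ℕ)) * z (k + 1) * (x (k + 1) + x k) + 2 * z (k + 1) * y (k + 1) +
      x (k + 1) ^ 2 + x k ^ 2 + y (k + 2) * z (k + 2) + y k * (if k = 0 then 0 else z k) -
      β * (z (k + 1) * θ k * x k + x (k + 1) * θ (k + 1 : ℕ) * z (k + 1) + z (k + 1) * y k +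
        x (k + 1) * x k + y (k + 2) * z (k + 1)) - ρs = ω * z (k + 1) := by
    rcases k with _ | k
    · simp [tridiagApply, tridiagEntry, r, c] at e2
      simp [hy0]
      linear_combination e2
    · simp [tridiagApply, tridiagEntry, r, c, hk1, hk2, hk3] at e2
      push_cast at e2 ⊢
      linear_combination e2
  rw [hθρ] at f1
  rw [hz1, hz2] at f2
  have hqq : q * q⁻¹ = 1 := mul_inv_cancel₀ hq
  simp only [Nat.add_sub_cancel]
  subst hβ'
  linear_combination f2 - z (k + 1) * f1 + z (k + 1) * (2 * y (k + 1) - y k - y (k + 2)) * hqq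
end

section
/- With the hypotheses of the Askey–Wilson setting below, assume moreover that z_i = z_1·q^{2−2i} for 1 ≤ i ≤ d. Then for 1 ≤ i ≤ d, y_i = q^{−i}(q^i − q^{−i})·[ (a′)²·q^{2d−3i+3}(q^{i−1} − q^{1−i})·z_1 + a·a′·q(q + q^{−1})·z_1 + b·b′·q^{i−2}(q^i + q^{−i})·z_1^{−1} − q^{1−i}(a·q^{i−d−1} + a′·q^{d−i+1})·x_0 − (q^{d+1} + q^{−d−1})·ξ + (a + a′)(b + b′) ]. -/
/-- The entries of a square matrix, extended by zero to all integer indices. -/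
def Matrix.zeroExtend {F : Type*} [Zero F] {d : ℕ}
    (M : Matrix (Fin (d + 1)) (Fin (d + 1)) F) (i j : ℤ) : F :=
  if h : (0 ≤ i ∧ i ≤ d) ∧ (0 ≤ j ∧ j ≤ d) then
    M ⟨i.toNat, by omega⟩ ⟨j.toNat, by omega⟩ else 0

namespace Matrix

variable {F : Type*} [Field F] {d : ℕ}

theorem zeroExtend_mul (M N : Matrix (Fin (d + 1)) (Fin (d + 1)) F) (i j : ℤ) :
    (M * N).zeroExtend i j =
      ∑ k ∈ Finset.range (d + 1), M.zeroExtend i k * N.zeroExtend k j := by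
  rw [← Fin.sum_univ_eq_sum_range (fun k : ℕ => M.zeroExtend i k * N.zeroExtend k j)]
  by_cases hi : 0 ≤ i ∧ i ≤ d
  · by_cases hj : 0 ≤ j ∧ j ≤ d
    · rw [zeroExtend, dif_pos ⟨hi, hj⟩, Matrix.mul_apply]
      refine Finset.sum_congr rfl fun k _ => ?_
      have hk : (0 : ℤ) ≤ (k : ℕ) ∧ ((k : ℕ) : ℤ) ≤ d := by omega
      rw [zeroExtend, zeroExtend, dif_pos ⟨hi, hk⟩, dif_pos ⟨hk, hj⟩]
      rfl
    · simp [zeroExtend, hj]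
  · simp [zeroExtend, hi]

/-- Right multiplication by a tridiagonal matrix, entrywise. -/
theorem zeroExtend_mul_of_tridiagonal (M T : Matrix (Fin (d + 1)) (Fin (d + 1)) F)
    (hT : ∀ i j : ℤ, (i + 1 < j ∨ j + 1 < i) → T.zeroExtend i j = 0) (i j : ℤ) :
    (M * T).zeroExtend i j =
      M.zeroExtend i (j - 1) * T.zeroExtend (j - 1) j + M.zeroExtend i j * T.zeroExtend j j +
        M.zeroExtend i (j + 1) * T.zeroExtend (j + 1) j := by
  have hM : ∀ k : ℤ, ¬ (0 ≤ k ∧ k ≤ d) → M.zeroExtend i k = 0 := fun k hk => by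
    simp [zeroExtend, hk]
  have hsum : ∑ k ∈ Finset.range (d + 1), M.zeroExtend i k * T.zeroExtend k j =
      ∑ k ∈ Finset.Icc (0 : ℤ) d, M.zeroExtend i k * T.zeroExtend k j := by
    refine Finset.sum_bij (fun k _ => (k : ℤ)) ?_ ?_ ?_ ?_
    · intro k hk
      simp only [Finset.mem_range, Finset.mem_Icc] at *
      omega
    · intro k _ l _ h
      exact_mod_cast h
    · intro k hk
      simp only [Finset.mem_Icc] at hk
      exact ⟨k.toNat, by simp only [Finset.mem_range]; omega, by omega⟩
    · intro k _
      rfl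
  rw [zeroExtend_mul, hsum]
  have h3 : M.zeroExtend i (j - 1) * T.zeroExtend (j - 1) j + M.zeroExtend i j * T.zeroExtend j j +
        M.zeroExtend i (j + 1) * T.zeroExtend (j + 1) j =
      ∑ k ∈ ({j - 1, j, j + 1} : Finset ℤ), M.zeroExtend i k * T.zeroExtend k j := by
    rw [Finset.sum_insert, Finset.sum_insert, Finset.sum_singleton, add_assoc]
    · simp
    · simp only [Finset.mem_insert, Finset.mem_singleton]; omega
  rw [h3]
  refine Finset.sum_congr_of_eq_on_inter ?_ ?_ fun _ _ _ => rfl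
  · intro k _ hk
    simp only [Finset.mem_insert, Finset.mem_singleton] at hk
    rw [hT k j (by omega), mul_zero]
  · intro k _ hk
    simp only [Finset.mem_Icc] at hk
    rw [hM k (by omega), zero_mul]

theorem zeroExtend_smul (c : F) (M : Matrix (Fin (d + 1)) (Fin (d + 1)) F) (i j : ℤ) :
    (c • M).zeroExtend i j = c * M.zeroExtend i j := by
  unfold zeroExtend; split_ifs <;> simp

theorem zeroExtend_add (M N : Matrix (Fin (d + 1)) (Fin (d + 1)) F) (i j : ℤ) :
    (M + N).zeroExtend i j = M.zeroExtend i j + N.zeroExtend i j := by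
  unfold zeroExtend; split_ifs <;> simp

theorem zeroExtend_sub (M N : Matrix (Fin (d + 1)) (Fin (d + 1)) F) (i j : ℤ) :
    (M - N).zeroExtend i j = M.zeroExtend i j - N.zeroExtend i j := by
  unfold zeroExtend; split_ifs <;> simp

theorem zeroExtend_one_of_ne {i j : ℤ} (h : i ≠ j) :
    (1 : Matrix (Fin (d + 1)) (Fin (d + 1)) F).zeroExtend i j = 0 := by
  unfold zeroExtend
  split_ifs
  · rw [one_apply_ne]
    simp only [ne_eq, Fin.mk.injEq]
    omega
  · rfl

end Matrix

section Relations

variable {F : Type*} [Field F] {d : ℕ} {θ : ℤ → F} {x y z : ℕ → F}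
  {A As : Matrix (Fin (d + 1)) (Fin (d + 1)) F}

theorem zeroExtend_bidiagonal
    (hA : ∀ i j : Fin (d + 1), A i j =
      if (i : ℕ) = (j : ℕ) then θ (i : ℕ)
      else if (i : ℕ) = (j : ℕ) + 1 then 1 else 0) (i j : ℤ) :
    A.zeroExtend i j =
      if (0 ≤ i ∧ i ≤ d) ∧ i = j then θ i
      else if (0 ≤ j ∧ i ≤ d) ∧ i = j + 1 then 1 else 0 := by
  unfold Matrix.zeroExtend
  split_ifs with h h1 h2 h2 <;> try omega
  · rw [hA, if_pos (by simp only; omega)]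
    congr 1; simp only; omega
  · rw [hA, if_neg (by simp only; omega), if_pos (by simp only; omega)]
  · rw [hA, if_neg (by simp only; omega), if_neg (by simp only; omega)]
  · rfl

theorem zeroExtend_tridiagonal
    (hAs : ∀ i j : Fin (d + 1), As i j =
      if (i : ℕ) = (j : ℕ) then x (i : ℕ)
      else if (i : ℕ) = (j : ℕ) + 1 then z (i : ℕ)
      else if (j : ℕ) = (i : ℕ) + 1 then y (j : ℕ) else 0) (i j : ℤ) :
    As.zeroExtend i j =
      if (0 ≤ i ∧ i ≤ d) ∧ i = j then x i.toNat
      else if (0 ≤ j ∧ i ≤ d) ∧ i = j + 1 then z i.toNat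
      else if (0 ≤ i ∧ j ≤ d) ∧ j = i + 1 then y j.toNat else 0 := by
  unfold Matrix.zeroExtend
  split_ifs with h h1 h2 h3 h2 h3 <;> try omega
  · rw [hAs, if_pos (by simp only; omega)]
  · rw [hAs, if_neg (by simp only; omega), if_pos (by simp only; omega)]
  · rw [hAs, if_neg (by simp only; omega), if_neg (by simp only; omega),
      if_pos (by simp only; omega)]
  · rw [hAs, if_neg (by simp only; omega), if_neg (by simp only; omega),
      if_neg (by simp only; omega)]
  · rfl

theorem subdiagonal_relation {β ρ ω η : F} (hy0 : y 0 = 0)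
    (eA : ∀ i j : ℤ, A.zeroExtend i j =
      if (0 ≤ i ∧ i ≤ d) ∧ i = j then θ i
      else if (0 ≤ j ∧ i ≤ d) ∧ i = j + 1 then 1 else 0)
    (eS : ∀ i j : ℤ, As.zeroExtend i j =
      if (0 ≤ i ∧ i ≤ d) ∧ i = j then x i.toNat
      else if (0 ≤ j ∧ i ≤ d) ∧ i = j + 1 then z i.toNat
      else if (0 ≤ i ∧ j ≤ d) ∧ j = i + 1 then y j.toNat else 0)
    (h : A ^ 2 * As - β • (A * As * A) + As * A ^ 2 - ρ • As =
      ω • A + η • (1 : Matrix (Fin (d + 1)) (Fin (d + 1)) F))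
    {n : ℕ} (hn : n + 2 ≤ d) :
    (θ (n + 1) ^ 2 - β * θ (n + 1) * θ n + θ n ^ 2 - ρ) * z (n + 1) +
      y n - β * y (n + 1) + y (n + 2) + (θ n + θ (n + 1) - β * θ n) * x n +
      (θ n + θ (n + 1) - β * θ (n + 1)) * x (n + 1) = ω := by
  have tA : ∀ i j : ℤ, (i + 1 < j ∨ j + 1 < i) → A.zeroExtend i j = 0 := by
    intro i j h; rw [eA, if_neg (by omega), if_neg (by omega)]
  have tS : ∀ i j : ℤ, (i + 1 < j ∨ j + 1 < i) → As.zeroExtend i j = 0 := by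
    intro i j h; rw [eS, if_neg (by omega), if_neg (by omega), if_neg (by omega)]
  replace h := congrArg (fun M => M.zeroExtend (n + 1) (n)) h
  simp only [pow_two, ← mul_assoc, Matrix.zeroExtend_sub, Matrix.zeroExtend_add,
    Matrix.zeroExtend_smul, Matrix.zeroExtend_mul_of_tridiagonal _ _ tA,
    Matrix.zeroExtend_mul_of_tridiagonal _ _ tS] at h
  rw [Matrix.zeroExtend_one_of_ne (by omega)] at h
  simp only [eA, eS] at h
  have e0 : (n : ℤ).toNat = n := by omega
  have e1 : ((n : ℤ) + 1).toNat = n + 1 := by omega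
  have e2' : ((n : ℤ) + 1 + 1).toNat = n + 2 := by omega
  rcases Nat.eq_zero_or_pos n with hn0 | hn0
  · simp (disch := omega) only [if_pos, if_neg, and_true, e0, e1, e2'] at h
    have hyn : y n = 0 := by rw [hn0, hy0]
    linear_combination h + hyn
  · simp (disch := omega) only [if_pos, if_neg, and_true, e0, e1, e2'] at h
    linear_combination h

theorem second_subdiagonal_relation {β ρ ω η : F}
    (eA : ∀ i j : ℤ, A.zeroExtend i j =
      if (0 ≤ i ∧ i ≤ d) ∧ i = j then θ i
      else if (0 ≤ j ∧ i ≤ d) ∧ i = j + 1 then 1 else 0)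
    (eS : ∀ i j : ℤ, As.zeroExtend i j =
      if (0 ≤ i ∧ i ≤ d) ∧ i = j then x i.toNat
      else if (0 ≤ j ∧ i ≤ d) ∧ i = j + 1 then z i.toNat
      else if (0 ≤ i ∧ j ≤ d) ∧ j = i + 1 then y j.toNat else 0)
    (h : A ^ 2 * As - β • (A * As * A) + As * A ^ 2 - ρ • As =
      ω • A + η • (1 : Matrix (Fin (d + 1)) (Fin (d + 1)) F))
    {n : ℕ} (hn : n + 2 ≤ d) :
    x n - β * x (n + 1) + x (n + 2) + z (n + 1) * (θ (n + 2) + θ (n + 1) - β * θ n) +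
      z (n + 2) * (θ (n + 1) + θ n - β * θ (n + 2)) = 0 := by
  have tA : ∀ i j : ℤ, (i + 1 < j ∨ j + 1 < i) → A.zeroExtend i j = 0 := by
    intro i j h; rw [eA, if_neg (by omega), if_neg (by omega)]
  have tS : ∀ i j : ℤ, (i + 1 < j ∨ j + 1 < i) → As.zeroExtend i j = 0 := by
    intro i j h; rw [eS, if_neg (by omega), if_neg (by omega), if_neg (by omega)]
  replace h := congrArg (fun M => M.zeroExtend (n + 2) (n)) h
  simp only [pow_two, ← mul_assoc, Matrix.zeroExtend_sub, Matrix.zeroExtend_add,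
    Matrix.zeroExtend_smul, Matrix.zeroExtend_mul_of_tridiagonal _ _ tA,
    Matrix.zeroExtend_mul_of_tridiagonal _ _ tS] at h
  rw [Matrix.zeroExtend_one_of_ne (by omega)] at h
  simp only [eA, eS] at h
  have e0 : (n : ℤ).toNat = n := by omega
  have e1 : ((n : ℤ) + 1).toNat = n + 1 := by omega
  have e2 : ((n : ℤ) + 2).toNat = n + 2 := by omega
  have e2' : ((n : ℤ) + 1 + 1).toNat = n + 2 := by omega
  rcases Nat.eq_zero_or_pos n with hn0 | hn0
  all_goals
    simp (disch := omega) only [if_pos, if_neg, and_true, e0, e1, e2, e2'] at h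
    linear_combination h

theorem second_subdiagonal_relation_dual {β ρ ω η : F}
    (eA : ∀ i j : ℤ, A.zeroExtend i j =
      if (0 ≤ i ∧ i ≤ d) ∧ i = j then θ i
      else if (0 ≤ j ∧ i ≤ d) ∧ i = j + 1 then 1 else 0)
    (eS : ∀ i j : ℤ, As.zeroExtend i j =
      if (0 ≤ i ∧ i ≤ d) ∧ i = j then x i.toNat
      else if (0 ≤ j ∧ i ≤ d) ∧ i = j + 1 then z i.toNat
      else if (0 ≤ i ∧ j ≤ d) ∧ j = i + 1 then y j.toNat else 0)
    (h : As ^ 2 * A - β • (As * A * As) + A * As ^ 2 - ρ • A =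
      ω • As + η • (1 : Matrix (Fin (d + 1)) (Fin (d + 1)) F))
    {n : ℕ} (hn : n + 2 ≤ d) :
    z (n + 2) * z (n + 1) * (θ n - β * θ (n + 1) + θ (n + 2)) +
      z (n + 2) * (x (n + 2) + x (n + 1) - β * x n) +
      z (n + 1) * (x (n + 1) + x n - β * x (n + 2)) = 0 := by
  have tA : ∀ i j : ℤ, (i + 1 < j ∨ j + 1 < i) → A.zeroExtend i j = 0 := by
    intro i j h; rw [eA, if_neg (by omega), if_neg (by omega)]
  have tS : ∀ i j : ℤ, (i + 1 < j ∨ j + 1 < i) → As.zeroExtend i j = 0 := by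
    intro i j h; rw [eS, if_neg (by omega), if_neg (by omega), if_neg (by omega)]
  replace h := congrArg (fun M => M.zeroExtend (n + 2) (n)) h
  simp only [pow_two, ← mul_assoc, Matrix.zeroExtend_sub, Matrix.zeroExtend_add,
    Matrix.zeroExtend_smul, Matrix.zeroExtend_mul_of_tridiagonal _ _ tA,
    Matrix.zeroExtend_mul_of_tridiagonal _ _ tS] at h
  rw [Matrix.zeroExtend_one_of_ne (by omega)] at h
  simp only [eA, eS] at h
  have e0 : (n : ℤ).toNat = n := by omega
  have e1 : ((n : ℤ) + 1).toNat = n + 1 := by omega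
  have e2 : ((n : ℤ) + 2).toNat = n + 2 := by omega
  have e2' : ((n : ℤ) + 1 + 1).toNat = n + 2 := by omega
  rcases Nat.eq_zero_or_pos n with hn0 | hn0
  all_goals
    simp (disch := omega) only [if_pos, if_neg, and_true, e0, e1, e2, e2'] at h
    linear_combination h

theorem first_subdiagonal_relation_dual {β ρ ω η : F}
    (eA : ∀ i j : ℤ, A.zeroExtend i j =
      if (0 ≤ i ∧ i ≤ d) ∧ i = j then θ i
      else if (0 ≤ j ∧ i ≤ d) ∧ i = j + 1 then 1 else 0)
    (eS : ∀ i j : ℤ, As.zeroExtend i j =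
      if (0 ≤ i ∧ i ≤ d) ∧ i = j then x i.toNat
      else if (0 ≤ j ∧ i ≤ d) ∧ i = j + 1 then z i.toNat
      else if (0 ≤ i ∧ j ≤ d) ∧ j = i + 1 then y j.toNat else 0)
    (h : As ^ 2 * A - β • (As * A * As) + A * As ^ 2 - ρ • A =
      ω • As + η • (1 : Matrix (Fin (d + 1)) (Fin (d + 1)) F))
    (hd : 2 ≤ d) :
    z 1 * (x 1 + x 0) * (θ 0 + θ 1) + 2 * z 1 * y 1 + x 1 ^ 2 + x 0 ^ 2 + y 2 * z 2 -
      β * (x 1 * θ 1 * z 1 + x 1 * x 0 + z 1 * θ 0 * x 0 + y 2 * z 1) = ρ + ω * z 1 := by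
  have tA : ∀ i j : ℤ, (i + 1 < j ∨ j + 1 < i) → A.zeroExtend i j = 0 := by
    intro i j h; rw [eA, if_neg (by omega), if_neg (by omega)]
  have tS : ∀ i j : ℤ, (i + 1 < j ∨ j + 1 < i) → As.zeroExtend i j = 0 := by
    intro i j h; rw [eS, if_neg (by omega), if_neg (by omega), if_neg (by omega)]
  replace h := congrArg (fun M => M.zeroExtend (1) (0)) h
  simp only [pow_two, ← mul_assoc, Matrix.zeroExtend_sub, Matrix.zeroExtend_add,
    Matrix.zeroExtend_smul, Matrix.zeroExtend_mul_of_tridiagonal _ _ tA,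
    Matrix.zeroExtend_mul_of_tridiagonal _ _ tS] at h
  rw [Matrix.zeroExtend_one_of_ne (by omega)] at h
  simp only [eA, eS] at h
  have e0 : (0 : ℤ).toNat = 0 := rfl
  have e1 : (1 : ℤ).toNat = 1 := rfl
  have e2 : ((1 : ℤ) + 1).toNat = 2 := rfl
  simp (disch := omega) only [if_pos, if_neg, and_true, zero_add, e0, e1, e2] at h
  linear_combination h

end Relations

section ClosedForms

variable {F : Type*} [Field F]

/-- The closed form of the diagonal entries, with `p = q ^ d` and `u = q ^ i`. -/
theorem diagonal_step {q a a' p u z₁ x₀ X₀ X₁ X₂ : F} (hq : q ≠ 0) (hp : p ≠ 0) (hu : u ≠ 0)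
    (h0 : X₀ = x₀ / u ^ 2 + a' * z₁ * p * (q ^ 2 + 1) * (1 / u ^ 4 - 1 / u ^ 2))
    (h1 : X₁ = x₀ / (u * q) ^ 2 +
      a' * z₁ * p * (q ^ 2 + 1) * (1 / (u * q) ^ 4 - 1 / (u * q) ^ 2))
    (hT : X₀ - (q ^ 2 + 1 / q ^ 2) * X₁ + X₂ +
      z₁ / u ^ 2 * (a * (u * q ^ 2) ^ 2 / p + a' * p / (u * q ^ 2) ^ 2 +
        (a * (u * q) ^ 2 / p + a' * p / (u * q) ^ 2) -
        (q ^ 2 + 1 / q ^ 2) * (a * u ^ 2 / p + a' * p / u ^ 2)) +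
      z₁ / (u * q) ^ 2 * (a * (u * q) ^ 2 / p + a' * p / (u * q) ^ 2 +
        (a * u ^ 2 / p + a' * p / u ^ 2) -
        (q ^ 2 + 1 / q ^ 2) * (a * (u * q ^ 2) ^ 2 / p + a' * p / (u * q ^ 2) ^ 2)) = 0) :
    X₂ = x₀ / (u * q ^ 2) ^ 2 +
      a' * z₁ * p * (q ^ 2 + 1) * (1 / (u * q ^ 2) ^ 4 - 1 / (u * q ^ 2) ^ 2) := by
  subst h0 h1
  rw [← sub_eq_zero, ← hT]
  field_simp
  ring

theorem diagonal_one {q a a' p z₁ x₀ X₁ X₂ : F} (hq : q ≠ 0) (hp : p ≠ 0)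
    (hz : z₁ ≠ 0) (hq6 : q ^ 6 ≠ 1)
    (hT : x₀ - (q ^ 2 + 1 / q ^ 2) * X₁ + X₂ +
      z₁ * (a * (q ^ 2) ^ 2 / p + a' * p / (q ^ 2) ^ 2 +
        (a * q ^ 2 / p + a' * p / q ^ 2) - (q ^ 2 + 1 / q ^ 2) * (a / p + a' * p)) +
      z₁ / q ^ 2 * (a * q ^ 2 / p + a' * p / q ^ 2 + (a / p + a' * p) -
        (q ^ 2 + 1 / q ^ 2) * (a * (q ^ 2) ^ 2 / p + a' * p / (q ^ 2) ^ 2)) = 0)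
    (hU : z₁ / q ^ 2 * z₁ * (a / p + a' * p -
        (q ^ 2 + 1 / q ^ 2) * (a * q ^ 2 / p + a' * p / q ^ 2) +
        (a * (q ^ 2) ^ 2 / p + a' * p / (q ^ 2) ^ 2)) +
      z₁ / q ^ 2 * (X₂ + X₁ - (q ^ 2 + 1 / q ^ 2) * x₀) +
      z₁ * (X₁ + x₀ - (q ^ 2 + 1 / q ^ 2) * X₂) = 0) :
    X₁ = x₀ / q ^ 2 + a' * z₁ * p * (q ^ 2 + 1) * (1 / q ^ 4 - 1 / q ^ 2) := by
  have hX : X₂ = -(x₀ - (q ^ 2 + 1 / q ^ 2) * X₁ +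
      z₁ * (a * (q ^ 2) ^ 2 / p + a' * p / (q ^ 2) ^ 2 +
        (a * q ^ 2 / p + a' * p / q ^ 2) - (q ^ 2 + 1 / q ^ 2) * (a / p + a' * p)) +
      z₁ / q ^ 2 * (a * q ^ 2 / p + a' * p / q ^ 2 + (a / p + a' * p) -
        (q ^ 2 + 1 / q ^ 2) * (a * (q ^ 2) ^ 2 / p + a' * p / (q ^ 2) ^ 2))) := by
    linear_combination hT
  subst hX
  have hk : z₁ * (q ^ 6 - 1) * q ^ 2 ≠ 0 :=
    mul_ne_zero (mul_ne_zero hz (sub_ne_zero.2 hq6)) (pow_ne_zero _ hq)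
  refine mul_left_cancel₀ hk ?_
  rw [← sub_eq_zero]
  trans (-q ^ 4) * 0
  swap
  · ring
  rw [← hU]
  field_simp
  ring

/-- The closed form of the superdiagonal entries, with `p = q ^ d` and `u = q ^ i`. -/
def superdiagonalForm (q a a' b b' ξ p z₁ x₀ u : F) : F :=
  u⁻¹ * (u - u⁻¹) *
    (a' ^ 2 * (p ^ 2 * q ^ 3 / u ^ 3) * (u / q - q / u) * z₁ + a * a' * q * (q + q⁻¹) * z₁ +
      b * b' * (u / q ^ 2) * (u + u⁻¹) * z₁⁻¹ -
      q / u * (a * (u / (p * q)) + a' * (p * q / u)) * x₀ -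
      (p * q + 1 / (p * q)) * ξ + (a + a') * (b + b'))

theorem superdiagonal_step {q a a' b b' ξ p u z₁ x₀ X₀ X₁ Y₀ Y₁ Y₂ : F}
    (hq : q ≠ 0) (hp : p ≠ 0) (hu : u ≠ 0) (hz : z₁ ≠ 0)
    (h0 : X₀ = x₀ / u ^ 2 + a' * z₁ * p * (q ^ 2 + 1) * (1 / u ^ 4 - 1 / u ^ 2))
    (h1 : X₁ = x₀ / (u * q) ^ 2 +
      a' * z₁ * p * (q ^ 2 + 1) * (1 / (u * q) ^ 4 - 1 / (u * q) ^ 2))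
    (hY0 : Y₀ = superdiagonalForm q a a' b b' ξ p z₁ x₀ u)
    (hY1 : Y₁ = superdiagonalForm q a a' b b' ξ p z₁ x₀ (u * q))
    (hS : Y₀ - (q ^ 2 + 1 / q ^ 2) * Y₁ + Y₂ +
      (a * u ^ 2 / p + a' * p / u ^ 2 + (a * (u * q) ^ 2 / p + a' * p / (u * q) ^ 2) -
        (q ^ 2 + 1 / q ^ 2) * (a * u ^ 2 / p + a' * p / u ^ 2)) * X₀ +
      (a * u ^ 2 / p + a' * p / u ^ 2 + (a * (u * q) ^ 2 / p + a' * p / (u * q) ^ 2) -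
        (q ^ 2 + 1 / q ^ 2) * (a * (u * q) ^ 2 / p + a' * p / (u * q) ^ 2)) * X₁ =
      (q - q⁻¹) ^ 2 * ((p * q + 1 / (p * q)) * ξ - (a + a') * (b + b'))) :
    Y₂ = superdiagonalForm q a a' b b' ξ p z₁ x₀ (u * q ^ 2) := by
  subst h0 h1 hY0 hY1
  rw [← sub_eq_zero] at hS ⊢
  rw [← hS]
  unfold superdiagonalForm
  field_simp
  ring

theorem superdiagonal_one {q a a' b b' ξ p z₁ x₀ X₁ Y₁ Y₂ : F}
    (hq : q ≠ 0) (hp : p ≠ 0) (hz : z₁ ≠ 0) (hq4 : q ^ 4 ≠ 1)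
    (h1 : X₁ = x₀ / q ^ 2 + a' * z₁ * p * (q ^ 2 + 1) * (1 / q ^ 4 - 1 / q ^ 2))
    (hS : -(q ^ 2 + 1 / q ^ 2) * Y₁ + Y₂ +
      (a / p + a' * p + (a * q ^ 2 / p + a' * p / q ^ 2) -
        (q ^ 2 + 1 / q ^ 2) * (a / p + a' * p)) * x₀ +
      (a / p + a' * p + (a * q ^ 2 / p + a' * p / q ^ 2) -
        (q ^ 2 + 1 / q ^ 2) * (a * q ^ 2 / p + a' * p / q ^ 2)) * X₁ =
      (q - q⁻¹) ^ 2 * ((p * q + 1 / (p * q)) * ξ - (a + a') * (b + b')))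
    (hV : z₁ * (X₁ + x₀) * (a / p + a' * p + (a * q ^ 2 / p + a' * p / q ^ 2)) +
        2 * z₁ * Y₁ + X₁ ^ 2 + x₀ ^ 2 + Y₂ * (z₁ / q ^ 2) -
      (q ^ 2 + 1 / q ^ 2) * (X₁ * (a * q ^ 2 / p + a' * p / q ^ 2) * z₁ + X₁ * x₀ +
        z₁ * (a / p + a' * p) * x₀ + Y₂ * z₁) =
      -(b * b') * (q ^ 2 - 1 / q ^ 2) ^ 2 +
        (q - q⁻¹) ^ 2 * ((p * q + 1 / (p * q)) * ξ - (a + a') * (b + b')) * z₁) :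
    Y₁ = superdiagonalForm q a a' b b' ξ p z₁ x₀ q := by
  have hk : z₁ * (q ^ 4 - 1) ≠ 0 := mul_ne_zero hz (sub_ne_zero.2 hq4)
  refine mul_left_cancel₀ hk ?_
  have hY : Y₂ = (q - q⁻¹) ^ 2 * ((p * q + 1 / (p * q)) * ξ - (a + a') * (b + b')) -
      (-(q ^ 2 + 1 / q ^ 2) * Y₁ +
      (a / p + a' * p + (a * q ^ 2 / p + a' * p / q ^ 2) -
        (q ^ 2 + 1 / q ^ 2) * (a / p + a' * p)) * x₀ +
      (a / p + a' * p + (a * q ^ 2 / p + a' * p / q ^ 2) -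
        (q ^ 2 + 1 / q ^ 2) * (a * q ^ 2 / p + a' * p / q ^ 2)) * X₁) := by
    linear_combination hS
  subst h1 hY
  rw [← sub_eq_zero] at hV ⊢
  trans (-1) * 0
  swap
  · ring
  rw [← hV]
  unfold superdiagonalForm
  field_simp
  ring

end ClosedForms


/-- stmt16 of the paper, in the Askey–Wilson setting. -/
theorem stmt16 {F : Type*} [Field F] [IsAlgClosed F] {d : ℕ} (hd : 3 ≤ d)
    (q a a' b b' ξ : F) (hq : q ≠ 0)
    (hqru : ∀ n : ℕ, 1 ≤ n → q ^ n ≠ 1)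
    (θ : ℤ → F)
    (hθ : ∀ i : ℤ, θ i = a * q ^ (2 * i - (d : ℤ)) + a' * q ^ ((d : ℤ) - 2 * i))
    (hθdist : ∀ i j : ℕ, i ≤ d → j ≤ d → i ≠ j → θ i ≠ θ j)
    (β ρ ρs ω η ηs : F)
    (hβ : β = q ^ (2 : ℤ) + q ^ (-2 : ℤ))
    (hρ : ρ = -(a * a') * (q ^ (2 : ℤ) - q ^ (-2 : ℤ)) ^ 2)
    (hρs : ρs = -(b * b') * (q ^ (2 : ℤ) - q ^ (-2 : ℤ)) ^ 2)
    (hω : ω = (q - q⁻¹) ^ 2 *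
      ((q ^ ((d : ℤ) + 1) + q ^ (-(d : ℤ) - 1)) * ξ - (a + a') * (b + b')))
    (hη : η = -((q - q⁻¹) * (q ^ (2 : ℤ) - q ^ (-2 : ℤ)) *
      ((a + a') * ξ - a * a' * (b + b') * (q ^ ((d : ℤ) + 1) + q ^ (-(d : ℤ) - 1)))))
    (hηs : ηs = -((q - q⁻¹) * (q ^ (2 : ℤ) - q ^ (-2 : ℤ)) *
      ((b + b') * ξ - b * b' * (a + a') * (q ^ ((d : ℤ) + 1) + q ^ (-(d : ℤ) - 1)))))
    (x y z : ℕ → F)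
    (hyz : ∀ i : ℕ, 1 ≤ i → i ≤ d → y i * z i ≠ 0)
    (hy0 : y 0 = 0) (hyd1 : y (d + 1) = 0)
    (A As : Matrix (Fin (d + 1)) (Fin (d + 1)) F)
    (hA : ∀ i j : Fin (d + 1), A i j =
      if (i : ℕ) = (j : ℕ) then θ (i : ℕ)
      else if (i : ℕ) = (j : ℕ) + 1 then 1 else 0)
    (hAs : ∀ i j : Fin (d + 1), As i j =
      if (i : ℕ) = (j : ℕ) then x (i : ℕ)
      else if (i : ℕ) = (j : ℕ) + 1 then z (i : ℕ)
      else if (j : ℕ) = (i : ℕ) + 1 then y (j : ℕ) else 0)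
    (hAW1 : A ^ 2 * As - β • (A * As * A) + As * A ^ 2 - ρ • As =
      ω • A + η • (1 : Matrix (Fin (d + 1)) (Fin (d + 1)) F))
    (hAW2 : As ^ 2 * A - β • (As * A * As) + A * As ^ 2 - ρs • A =
      ω • As + ηs • (1 : Matrix (Fin (d + 1)) (Fin (d + 1)) F))
    (hz : ∀ i : ℕ, 1 ≤ i → i ≤ d → z i = z 1 * q ^ ((2 : ℤ) - 2 * (i : ℤ))) :
    ∀ i : ℕ, 1 ≤ i → i ≤ d →
      y i = q ^ (-(i : ℤ)) * (q ^ (i : ℤ) - q ^ (-(i : ℤ))) *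
        (a' ^ 2 * q ^ (2 * (d : ℤ) - 3 * (i : ℤ) + 3) * (q ^ ((i : ℤ) - 1) - q ^ (1 - (i : ℤ))) * z 1 +
          a * a' * q * (q + q⁻¹) * z 1 +
          b * b' * q ^ ((i : ℤ) - 2) * (q ^ (i : ℤ) + q ^ (-(i : ℤ))) * (z 1)⁻¹ -
          q ^ (1 - (i : ℤ)) * (a * q ^ ((i : ℤ) - (d : ℤ) - 1) + a' * q ^ ((d : ℤ) - (i : ℤ) + 1)) * x 0 -
          (q ^ ((d : ℤ) + 1) + q ^ (-(d : ℤ) - 1)) * ξ + (a + a') * (b + b')) := by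
  set p : F := q ^ d with hp_def
  have hp : p ≠ 0 := pow_ne_zero _ hq
  have eA := zeroExtend_bidiagonal hA
  have eS := zeroExtend_tridiagonal hAs
  have hz1 : z 1 ≠ 0 := (mul_ne_zero_iff.1 (hyz 1 le_rfl (by omega))).2
  have hβ' : β = q ^ 2 + 1 / q ^ 2 := by
    rw [hβ, zpow_neg, one_div]; norm_cast
  have hθ0 : ∀ n : ℕ, θ n = a * (q ^ n) ^ 2 / p + a' * p / (q ^ n) ^ 2 := by
    intro n
    rw [hθ, zpow_sub₀ hq, zpow_sub₀ hq, mul_comm (2 : ℤ), zpow_mul, zpow_natCast, zpow_natCast,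
      zpow_ofNat, mul_div_assoc, mul_div_assoc]
  have hθ1 : ∀ n : ℕ, θ ((n : ℤ) + 1) = a * (q ^ n * q) ^ 2 / p + a' * p / (q ^ n * q) ^ 2 := by
    intro n; rw [← pow_succ, ← hθ0]; push_cast; rfl
  have hθ2 : ∀ n : ℕ, θ ((n : ℤ) + 2) =
      a * (q ^ n * q ^ 2) ^ 2 / p + a' * p / (q ^ n * q ^ 2) ^ 2 := by
    intro n; rw [← pow_add, ← hθ0]; push_cast; rfl
  have hz0 : ∀ n : ℕ, n + 1 ≤ d → z (n + 1) = z 1 / (q ^ n) ^ 2 := by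
    intro n hn
    rw [hz _ (by omega) hn, div_eq_mul_inv, ← pow_mul, ← zpow_natCast, ← zpow_neg]
    congr 2; push_cast; ring
  have hz2 : ∀ n : ℕ, n + 2 ≤ d → z (n + 2) = z 1 / (q ^ n * q) ^ 2 := by
    intro n hn; rw [← pow_succ, ← hz0 _ hn]
  have hω' : ω = (q - q⁻¹) ^ 2 * ((p * q + 1 / (p * q)) * ξ - (a + a') * (b + b')) := by
    rw [hω, show -(d : ℤ) - 1 = -((d : ℤ) + 1) by ring, zpow_neg, zpow_add_one₀ hq, zpow_natCast,
      one_div]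
  have hρs' : ρs = -(b * b') * (q ^ 2 - 1 / q ^ 2) ^ 2 := by
    rw [hρs, zpow_neg, one_div]; norm_cast
  have hρ0 : ∀ n : ℕ,
      θ ((n : ℤ) + 1) ^ 2 - β * θ ((n : ℤ) + 1) * θ n + θ n ^ 2 - ρ = 0 := by
    intro n
    have hu : q ^ n ≠ 0 := pow_ne_zero _ hq
    rw [hθ0, hθ1, hβ', hρ, show (q ^ (2 : ℤ) - q ^ (-2 : ℤ)) = q ^ 2 - 1 / q ^ 2 by
      rw [zpow_neg, one_div]; norm_cast]
    field_simp
    ring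
  have hx1 : x 1 = x 0 / q ^ 2 + a' * z 1 * p * (q ^ 2 + 1) * (1 / q ^ 4 - 1 / q ^ 2) := by
    have hT := second_subdiagonal_relation eA eS hAW1 (n := 0) (by omega)
    have hU := second_subdiagonal_relation_dual eA eS hAW2 (n := 0) (by omega)
    rw [hθ0, hθ1, hθ2, hz2 0 (by omega), hβ'] at hT hU
    simp only [pow_zero, one_mul, zero_add, one_pow, mul_one, div_one] at hT hU
    exact diagonal_one (a := a) hq hp hz1 (hqru 6 (by omega)) hT hU
  have hx : ∀ n : ℕ, n + 1 ≤ d →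
      x n = x 0 / (q ^ n) ^ 2 +
        a' * z 1 * p * (q ^ 2 + 1) * (1 / (q ^ n) ^ 4 - 1 / (q ^ n) ^ 2) ∧
      x (n + 1) = x 0 / (q ^ n * q) ^ 2 +
        a' * z 1 * p * (q ^ 2 + 1) * (1 / (q ^ n * q) ^ 4 - 1 / (q ^ n * q) ^ 2) := by
    intro n
    induction n with
    | zero => intro _; exact ⟨by simp, by simpa using hx1⟩
    | succ n ih =>
      intro hn
      obtain ⟨h0, h1⟩ := ih (by omega)
      refine ⟨by rw [pow_succ q n]; exact h1, ?_⟩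
      have hT := second_subdiagonal_relation eA eS hAW1 (n := n) (by omega)
      rw [hθ0, hθ1, hθ2, hz0 n (by omega), hz2 n (by omega), hβ'] at hT
      have h2 := diagonal_step hq hp (pow_ne_zero n hq) h0 h1 hT
      rw [pow_succ q n, mul_assoc, ← pow_two]
      exact h2
  have hS : ∀ n : ℕ, n + 2 ≤ d → y n - (q ^ 2 + 1 / q ^ 2) * y (n + 1) + y (n + 2) +
      (θ n + θ ((n : ℤ) + 1) - (q ^ 2 + 1 / q ^ 2) * θ n) * x n +
      (θ n + θ ((n : ℤ) + 1) - (q ^ 2 + 1 / q ^ 2) * θ ((n : ℤ) + 1)) * x (n + 1) =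
      (q - q⁻¹) ^ 2 * ((p * q + 1 / (p * q)) * ξ - (a + a') * (b + b')) := by
    intro n hn
    have h := subdiagonal_relation hy0 eA eS hAW1 hn
    rwa [hρ0, zero_mul, zero_add, hβ', hω'] at h
  have hy1 : y 1 = superdiagonalForm q a a' b b' ξ p (z 1) (x 0) q := by
    have hS0 := hS 0 (by omega)
    have hV := first_subdiagonal_relation_dual eA eS hAW2 (by omega)
    have t0 := hθ0 0
    have t1 := hθ1 0
    have z2 := hz2 0 (by omega)
    simp only [Nat.cast_zero, pow_zero, one_mul, zero_add, one_pow, mul_one, div_one] at t0 t1 z2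
    simp only [Nat.cast_zero, zero_add, t0, t1, hy0, zero_sub, ← neg_mul] at hS0
    rw [t0, t1, z2, hβ', hω', hρs'] at hV
    exact superdiagonal_one hq hp hz1 (hqru 4 (by omega)) hx1 hS0 hV
  have hy : ∀ n : ℕ, n + 1 ≤ d →
      y n = superdiagonalForm q a a' b b' ξ p (z 1) (x 0) (q ^ n) ∧
      y (n + 1) = superdiagonalForm q a a' b b' ξ p (z 1) (x 0) (q ^ n * q) := by
    intro n
    induction n with
    | zero => intro _; exact ⟨by simp [hy0, superdiagonalForm], by simpa using hy1⟩
    | succ n ih =>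
      intro hn
      obtain ⟨h0, h1⟩ := ih (by omega)
      refine ⟨by rw [pow_succ q n]; exact h1, ?_⟩
      have hSn := hS n (by omega)
      rw [hθ0, hθ1] at hSn
      obtain ⟨hX0, hX1⟩ := hx n (by omega)
      have h2 := superdiagonal_step hq hp (pow_ne_zero n hq) hz1 hX0 hX1 h0 h1 hSn
      rw [pow_succ q n, mul_assoc, ← pow_two]
      exact h2
  intro i hi hid
  obtain ⟨n, rfl⟩ : ∃ n, i = n + 1 := ⟨i - 1, by omega⟩
  rw [(hy n hid).2, ← pow_succ]
  generalize n + 1 = i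
  have e1 : q ^ (2 * (d : ℤ) - 3 * (i : ℤ) + 3) = p ^ 2 * q ^ 3 / (q ^ i) ^ 3 := by
    rw [zpow_add₀ hq, zpow_sub₀ hq, mul_comm (2 : ℤ), mul_comm (3 : ℤ), zpow_mul, zpow_mul,
      zpow_natCast, zpow_natCast, zpow_ofNat, zpow_ofNat, zpow_ofNat, div_mul_eq_mul_div]
  have e2 : q ^ ((i : ℤ) - (d : ℤ) - 1) = q ^ i / (p * q) := by
    rw [zpow_sub₀ hq, zpow_sub₀ hq, zpow_natCast, zpow_natCast, zpow_one, div_div]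
  have e3 : q ^ ((d : ℤ) - (i : ℤ) + 1) = p * q / q ^ i := by
    rw [zpow_add₀ hq, zpow_sub₀ hq, zpow_natCast, zpow_natCast, zpow_one, div_mul_eq_mul_div]
  have e4 : q ^ (-(d : ℤ) - 1) = 1 / (p * q) := by
    rw [show -(d : ℤ) - 1 = -((d : ℤ) + 1) by ring, zpow_neg, zpow_add_one₀ hq, zpow_natCast,
      one_div]
  rw [e1, e2, e3, e4, zpow_add_one₀ hq, zpow_neg, zpow_sub₀ hq, zpow_sub₀ hq, zpow_sub₀ hq]
  simp only [zpow_natCast, zpow_ofNat, pow_one, ← hp_def]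
  rfl
end

section
/- With the hypotheses of the Askey–Wilson setting below, assume moreover that z_i = z_1·q^{2−2i} for 1 ≤ i ≤ d, and that a ≠ a′·q^{2d+2}. Then ξ = q^d·(a·a′·q·z_1 + b·b′·q^{−1}·z_1^{−1}) − a·q·x_0 + a(b + b′)·q^{d+1}. -/
/-- A column of `N` supported on the first four rows gives a four-term product. -/
theorem Matrix.mul_apply_eq_of_col_support {F : Type*} [Field F] {n : ℕ}
    (M N : Matrix (Fin (n + 3 + 1)) (Fin (n + 3 + 1)) F) (i j : Fin (n + 3 + 1))
    (hN : ∀ k : Fin (n + 3 + 1), 3 < (k : ℕ) → N k j = 0) :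
    (M * N) i j = M i 0 * N 0 j + M i 1 * N 1 j + M i 2 * N 2 j + M i 3 * N 3 j := by
  rw [Matrix.mul_apply, Fin.sum_univ_succ, Fin.sum_univ_succ, Fin.sum_univ_succ,
    Fin.sum_univ_succ, Finset.sum_eq_zero]
  · have h1 : (Fin.succ 0 : Fin (n + 3 + 1)) = 1 := rfl
    have h2 : (Fin.succ (Fin.succ 0) : Fin (n + 3 + 1)) = 2 := rfl
    have h3 : (Fin.succ (Fin.succ (Fin.succ 0)) : Fin (n + 3 + 1)) = 3 := rfl
    rw [h1, h2, h3]
    ring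
  · intro k _
    rw [hN _ (by simp only [Fin.val_succ]; omega), mul_zero]

/-- The entries of the Askey–Wilson relations in the top left corner of a lower bidiagonal matrix
`A` and a tridiagonal matrix `As`. -/
theorem askeyWilson_corner_entries {F : Type*} [Field F] {n : ℕ}
    {β ρ ρs ω η ηs : F} {θ : ℤ → F} {x y z : ℕ → F}
    {A As : Matrix (Fin (n + 3 + 1)) (Fin (n + 3 + 1)) F}
    (hA : ∀ i j : Fin (n + 3 + 1), A i j =
      if (i : ℕ) = (j : ℕ) then θ (i : ℕ)
      else if (i : ℕ) = (j : ℕ) + 1 then 1 else 0)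
    (hAs : ∀ i j : Fin (n + 3 + 1), As i j =
      if (i : ℕ) = (j : ℕ) then x (i : ℕ)
      else if (i : ℕ) = (j : ℕ) + 1 then z (i : ℕ)
      else if (j : ℕ) = (i : ℕ) + 1 then y (j : ℕ) else 0)
    (hAW1 : A ^ 2 * As - β • (A * As * A) + As * A ^ 2 - ρ • As =
      ω • A + η • (1 : Matrix (Fin (n + 3 + 1)) (Fin (n + 3 + 1)) F))
    (hAW2 : As ^ 2 * A - β • (As * A * As) + A * As ^ 2 - ρs • A =
      ω • As + ηs • (1 : Matrix (Fin (n + 3 + 1)) (Fin (n + 3 + 1)) F)) :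
    (y 1 * (θ 0 + θ 1 - β * θ 0) + (2 - β) * θ 0 ^ 2 * x 0 - ρ * x 0 = ω * θ 0 + η) ∧
    (y 2 - β * y 1 + (θ 0 ^ 2 - β * (θ 0 * θ 1) + θ 1 ^ 2 - ρ) * z 1 +
      x 0 * (θ 1 + θ 0 - β * θ 0) + x 1 * (θ 1 + θ 0 - β * θ 1) = ω) ∧
    (x 2 - β * x 1 + x 0 + z 1 * (θ 2 + θ 1 - β * θ 0) + z 2 * (θ 1 + θ 0 - β * θ 2) = 0) ∧
    (z 1 * (x 1 + x 0) * (θ 0 + θ 1) + 2 * (y 1 * z 1) + x 1 ^ 2 + x 0 ^ 2 + y 2 * z 2 -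
      β * (z 1 * θ 0 * x 0 + x 1 * θ 1 * z 1 + y 2 * z 1 + x 1 * x 0) - ρs = ω * z 1) ∧
    (z 1 * z 2 * (θ 0 - β * θ 1 + θ 2) + z 2 * (x 2 + x 1 - β * x 0) +
      z 1 * (x 1 + x 0 - β * x 2) = 0) := by
  have cA : ∀ j : Fin (n + 3 + 1), (j : ℕ) ≤ 2 → ∀ k : Fin (n + 3 + 1), 3 < (k : ℕ) →
      A k j = 0 := by
    intro j hj k hk
    rw [hA, if_neg (by omega), if_neg (by omega)]
  have cAs : ∀ j : Fin (n + 3 + 1), (j : ℕ) ≤ 2 → ∀ k : Fin (n + 3 + 1), 3 < (k : ℕ) →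
      As k j = 0 := by
    intro j hj k hk
    rw [hAs, if_neg (by omega), if_neg (by omega), if_neg (by omega)]
  have v0 : ((0 : Fin (n + 3 + 1)) : ℕ) = 0 := rfl
  have v1 : ((1 : Fin (n + 3 + 1)) : ℕ) = 1 := rfl
  have v2 : ((2 : Fin (n + 3 + 1)) : ℕ) = 2 := rfl
  have v3 : ((3 : Fin (n + 3 + 1)) : ℕ) = 3 := rfl
  have mA : ∀ (M : Matrix (Fin (n + 3 + 1)) (Fin (n + 3 + 1)) F) (i : Fin (n + 3 + 1)),
      (M * A) i 0 = M i 0 * θ 0 + M i 1 ∧ (M * A) i 1 = M i 1 * θ 1 + M i 2 ∧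
      (M * A) i 2 = M i 2 * θ 2 + M i 3 := by
    intro M i
    refine ⟨?_, ?_, ?_⟩ <;>
      rw [Matrix.mul_apply_eq_of_col_support _ _ _ _ (cA _ (by simp only [v0, v1, v2]; norm_num))] <;>
      simp only [hA, v0, v1, v2, v3] <;> norm_num
  have mAs : ∀ (M : Matrix (Fin (n + 3 + 1)) (Fin (n + 3 + 1)) F) (i : Fin (n + 3 + 1)),
      (M * As) i 0 = M i 0 * x 0 + M i 1 * z 1 ∧
      (M * As) i 1 = M i 0 * y 1 + M i 1 * x 1 + M i 2 * z 2 ∧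
      (M * As) i 2 = M i 1 * y 2 + M i 2 * x 2 + M i 3 * z 3 := by
    intro M i
    refine ⟨?_, ?_, ?_⟩ <;>
      rw [Matrix.mul_apply_eq_of_col_support _ _ _ _ (cAs _ (by simp only [v0, v1, v2]; norm_num))] <;>
      simp only [hAs, v0, v1, v2, v3] <;> norm_num
  rw [pow_two, ← mul_assoc] at hAW1 hAW2
  have e1 := fun i j => congrFun (congrFun hAW1 i) j
  have e2 := fun i j => congrFun (congrFun hAW2 i) j
  simp only [Matrix.add_apply, Matrix.sub_apply, Matrix.smul_apply, smul_eq_mul] at e1 e2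
  have a00 := e1 0 0
  have a10 := e1 1 0
  have a20 := e1 2 0
  have b10 := e2 1 0
  have b20 := e2 2 0
  have n1 : (1 : Matrix (Fin (n + 3 + 1)) (Fin (n + 3 + 1)) F) 1 0 = 0 :=
    Matrix.one_apply_ne (by simp only [ne_eq, Fin.ext_iff, v0, v1]; norm_num)
  have n2 : (1 : Matrix (Fin (n + 3 + 1)) (Fin (n + 3 + 1)) F) 2 0 = 0 :=
    Matrix.one_apply_ne (by simp only [ne_eq, Fin.ext_iff, v0, v2]; norm_num)
  simp only [mA, mAs, n1, n2, Matrix.one_apply_eq] at a00 a10 a20 b10 b20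
  simp only [hA, hAs, v0, v1, v2] at a00 a10 a20 b10 b20
  norm_num at a00 a10 a20 b10 b20
  refine ⟨?_, ?_, ?_, ?_, ?_⟩
  · linear_combination a00
  · linear_combination a10
  · linear_combination a20
  · linear_combination b10
  · linear_combination b20

/-- stmt17 of the paper, in the Askey–Wilson setting. -/
theorem stmt17 {F : Type*} [Field F] [IsAlgClosed F] {d : ℕ} (hd : 3 ≤ d)
    (q a a' b b' ξ : F) (hq : q ≠ 0)
    (hqru : ∀ n : ℕ, 1 ≤ n → q ^ n ≠ 1)
    (θ : ℤ → F)
    (hθ : ∀ i : ℤ, θ i = a * q ^ (2 * i - (d : ℤ)) + a' * q ^ ((d : ℤ) - 2 * i))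
    (hθdist : ∀ i j : ℕ, i ≤ d → j ≤ d → i ≠ j → θ i ≠ θ j)
    (β ρ ρs ω η ηs : F)
    (hβ : β = q ^ (2 : ℤ) + q ^ (-2 : ℤ))
    (hρ : ρ = -(a * a') * (q ^ (2 : ℤ) - q ^ (-2 : ℤ)) ^ 2)
    (hρs : ρs = -(b * b') * (q ^ (2 : ℤ) - q ^ (-2 : ℤ)) ^ 2)
    (hω : ω = (q - q⁻¹) ^ 2 *
      ((q ^ ((d : ℤ) + 1) + q ^ (-(d : ℤ) - 1)) * ξ - (a + a') * (b + b')))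
    (hη : η = -((q - q⁻¹) * (q ^ (2 : ℤ) - q ^ (-2 : ℤ)) *
      ((a + a') * ξ - a * a' * (b + b') * (q ^ ((d : ℤ) + 1) + q ^ (-(d : ℤ) - 1)))))
    (hηs : ηs = -((q - q⁻¹) * (q ^ (2 : ℤ) - q ^ (-2 : ℤ)) *
      ((b + b') * ξ - b * b' * (a + a') * (q ^ ((d : ℤ) + 1) + q ^ (-(d : ℤ) - 1)))))
    (x y z : ℕ → F)
    (hyz : ∀ i : ℕ, 1 ≤ i → i ≤ d → y i * z i ≠ 0)
    (hy0 : y 0 = 0) (hyd1 : y (d + 1) = 0)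
    (A As : Matrix (Fin (d + 1)) (Fin (d + 1)) F)
    (hA : ∀ i j : Fin (d + 1), A i j =
      if (i : ℕ) = (j : ℕ) then θ (i : ℕ)
      else if (i : ℕ) = (j : ℕ) + 1 then 1 else 0)
    (hAs : ∀ i j : Fin (d + 1), As i j =
      if (i : ℕ) = (j : ℕ) then x (i : ℕ)
      else if (i : ℕ) = (j : ℕ) + 1 then z (i : ℕ)
      else if (j : ℕ) = (i : ℕ) + 1 then y (j : ℕ) else 0)
    (hAW1 : A ^ 2 * As - β • (A * As * A) + As * A ^ 2 - ρ • As =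
      ω • A + η • (1 : Matrix (Fin (d + 1)) (Fin (d + 1)) F))
    (hAW2 : As ^ 2 * A - β • (As * A * As) + A * As ^ 2 - ρs • A =
      ω • As + ηs • (1 : Matrix (Fin (d + 1)) (Fin (d + 1)) F))
    (hz : ∀ i : ℕ, 1 ≤ i → i ≤ d → z i = z 1 * q ^ ((2 : ℤ) - 2 * (i : ℤ)))
    (hne : a ≠ a' * q ^ (2 * (d : ℤ) + 2)) :
    ξ = q ^ (d : ℤ) * (a * a' * q * z 1 + b * b' * q⁻¹ * (z 1)⁻¹) -
      a * q * x 0 + a * (b + b') * q ^ ((d : ℤ) + 1) := by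

  obtain ⟨n, rfl⟩ : ∃ n, d = n + 3 := ⟨d - 3, by omega⟩
  obtain ⟨a00, a10, a20, b10, b20⟩ := askeyWilson_corner_entries hA hAs hAW1 hAW2
  have hz1 : z 1 ≠ 0 := right_ne_zero_of_mul (hyz 1 le_rfl (by omega))
  have hz2 : z 2 = z 1 * (q ^ 2)⁻¹ := by
    rw [hz 2 (by omega) (by omega)]
    norm_num [zpow_neg]
  generalize ((n + 3 : ℕ) : ℤ) = D at *
  obtain ⟨Q, hQ⟩ : ∃ Q, Q = q ^ D := ⟨_, rfl⟩
  have hQ0 : Q ≠ 0 := hQ ▸ zpow_ne_zero _ hq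
  have t0 : θ 0 = a * Q⁻¹ + a' * Q := by
    rw [hθ, hQ]
    simp [zpow_neg]
  have t1 : θ 1 = a * q ^ 2 * Q⁻¹ + a' * Q * (q ^ 2)⁻¹ := by
    rw [hθ, hQ, zpow_sub₀ hq, zpow_sub₀ hq]
    norm_num [div_eq_mul_inv, ← mul_assoc]
  have t2 : θ 2 = a * q ^ 4 * Q⁻¹ + a' * Q * (q ^ 4)⁻¹ := by
    rw [hθ, hQ, zpow_sub₀ hq, zpow_sub₀ hq]
    norm_num [div_eq_mul_inv, ← mul_assoc]
  have p1 : q ^ (D + 1) = Q * q := by rw [zpow_add₀ hq, hQ, zpow_one]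
  have p2 : q ^ (-D - 1) = Q⁻¹ * q⁻¹ := by
    rw [zpow_sub₀ hq, zpow_neg, hQ, zpow_one, div_eq_mul_inv]
  have p3 : q ^ (2 * D + 2) = Q ^ 2 * q ^ 2 := by
    rw [zpow_add₀ hq, mul_comm 2 D, zpow_mul, hQ]
    norm_cast
  have p4 : q ^ (-2 : ℤ) = (q ^ 2)⁻¹ := by
    rw [zpow_neg]
    norm_cast
  have p5 : q ^ (2 : ℤ) = q ^ 2 := by norm_cast
  rw [p1, p2, p4, p5] at hη
  rw [p1, p2] at hω
  rw [p4, p5] at hβ hρ hρs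
  rw [p3] at hne
  rw [p1, ← hQ]
  have q6 : 1 - q ^ 6 ≠ 0 := sub_ne_zero.2 (hqru 6 (by norm_num)).symm
  have q4 : 1 - q ^ 4 ≠ 0 := sub_ne_zero.2 (hqru 4 (by norm_num)).symm
  have hx1 : x 1 = (x 0 * q ^ 2 + a' * Q * z 1 * (1 - q ^ 4)) / q ^ 4 := by
    rw [t0, t1, t2, hβ, hz2] at b20 a20
    rw [eq_div_iff (pow_ne_zero 4 hq)]
    apply mul_left_cancel₀ (mul_ne_zero hz1 q6)
    linear_combination (norm := skip) q ^ 6 * b20 + q ^ 8 * z 1 * a20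
    field_simp
    ring
  have q2 : q ^ 2 - 1 ≠ 0 := sub_ne_zero.2 (hqru 2 (by norm_num))
  have q2' : q ^ 2 + 1 ≠ 0 := fun h => q4 (by linear_combination (1 - q ^ 2) * h)
  have hne' : a - a' * (Q ^ 2 * q ^ 2) ≠ 0 := sub_ne_zero.2 hne
  rw [hβ, hω, hρ, t0, t1, hx1] at a10
  rw [hβ, hω, hρ, hη, t0, t1] at a00
  rw [hβ, hω, hρs, t0, t1, hx1, hz2] at b10
  have hc : -((1 - q ^ 4) * (q ^ 2 - 1) ^ 2 * (q ^ 2 + 1) / (q ^ 5 * Q ^ 2)) *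
      (a - a' * (Q ^ 2 * q ^ 2)) * z 1 ≠ 0 :=
    mul_ne_zero (mul_ne_zero (neg_ne_zero.2 (div_ne_zero
      (mul_ne_zero (mul_ne_zero q4 (pow_ne_zero 2 q2)) q2')
      (mul_ne_zero (pow_ne_zero 5 hq) (pow_ne_zero 2 hQ0)))) hne') hz1
  apply mul_left_cancel₀ hc
  linear_combination (norm := skip) z 1 * (1 - q ^ 4) * a00 -
    (a * Q⁻¹ + a' * Q + (a * q ^ 2 * Q⁻¹ + a' * Q * (q ^ 2)⁻¹) -
      (q ^ 2 + (q ^ 2)⁻¹) * (a * Q⁻¹ + a' * Q)) * (b10 + q ^ 2 * z 1 * a10)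
  field_simp
  ring
end

section
/- With the hypotheses of the Askey–Wilson setting below, assume moreover that z_i = z_1·q^{2−2i} for 1 ≤ i ≤ d, that a ≠ a′·q^{2d+2}, and that a′ ≠ a·q^{2d+2}. Then x_0 = a′(q^d − q^{−d})·z_1 + (b + b′)·q^d and ξ = a·a′·q^{1−d}·z_1 + b·b′·q^{d−1}·z_1^{−1}. -/
namespace Matrix

/-- Extension of a square matrix to integer indices by zero. -/
def intPad {F : Type*} [Zero F] {d : ℕ} (M : Matrix (Fin (d + 1)) (Fin (d + 1)) F)
    (i j : ℤ) : F :=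
  if h : (0 ≤ i ∧ i ≤ d) ∧ (0 ≤ j ∧ j ≤ d) then
    M ⟨i.toNat, by omega⟩ ⟨j.toNat, by omega⟩
  else 0

section intPad

variable {F : Type*} [Field F] {d : ℕ}

lemma intPad_eq_zero (M : Matrix (Fin (d + 1)) (Fin (d + 1)) F) {i j : ℤ}
    (h : (i < 0 ∨ d < i) ∨ (j < 0 ∨ d < j)) : M.intPad i j = 0 := by
  rw [intPad, dif_neg (by omega)]

lemma intPad_natCast (M : Matrix (Fin (d + 1)) (Fin (d + 1)) F) (i j : Fin (d + 1)) :
    M.intPad (i : ℕ) (j : ℕ) = M i j := by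
  rw [intPad, dif_pos (by omega)]
  simp

lemma intPad_add (M N : Matrix (Fin (d + 1)) (Fin (d + 1)) F) (i j : ℤ) :
    (M + N).intPad i j = M.intPad i j + N.intPad i j := by
  unfold intPad; split_ifs <;> simp

lemma intPad_sub (M N : Matrix (Fin (d + 1)) (Fin (d + 1)) F) (i j : ℤ) :
    (M - N).intPad i j = M.intPad i j - N.intPad i j := by
  unfold intPad; split_ifs <;> simp

lemma intPad_smul (c : F) (M : Matrix (Fin (d + 1)) (Fin (d + 1)) F) (i j : ℤ) :
    (c • M).intPad i j = c * M.intPad i j := by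
  unfold intPad; split_ifs <;> simp

lemma intPad_one {i j : ℤ} (hi : 0 ≤ i) (hid : i ≤ d) (hj : 0 ≤ j) (hjd : j ≤ d) :
    (1 : Matrix (Fin (d + 1)) (Fin (d + 1)) F).intPad i j = if i = j then 1 else 0 := by
  rw [intPad, dif_pos (by omega), one_apply]
  congr 1
  simp only [Fin.mk.injEq, eq_iff_iff]
  omega

lemma intPad_mul_eq_sum (M N : Matrix (Fin (d + 1)) (Fin (d + 1)) F) (i j : ℤ) :
    (M * N).intPad i j = ∑ k ∈ Finset.Icc (0 : ℤ) d, M.intPad i k * N.intPad k j := by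
  by_cases h : (0 ≤ i ∧ i ≤ d) ∧ (0 ≤ j ∧ j ≤ d)
  · lift i to ℕ using h.1.1
    lift j to ℕ using h.2.1
    obtain ⟨i, rfl⟩ : ∃ i' : Fin (d + 1), (i' : ℕ) = i := ⟨⟨i, by omega⟩, rfl⟩
    obtain ⟨j, rfl⟩ : ∃ j' : Fin (d + 1), (j' : ℕ) = j := ⟨⟨j, by omega⟩, rfl⟩
    rw [intPad_natCast, mul_apply]
    refine Finset.sum_bij (fun k _ => ((k : ℕ) : ℤ)) ?_ ?_ ?_ ?_
    · intro k _
      simp only [Finset.mem_Icc]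
      omega
    · intro k _ l _ hkl
      exact Fin.ext (by omega)
    · intro k hk
      rw [Finset.mem_Icc] at hk
      exact ⟨⟨k.toNat, by omega⟩, Finset.mem_univ _, by simp [hk.1]⟩
    · intro k _
      rw [intPad_natCast, intPad_natCast]
  · rw [intPad_eq_zero _ (by omega)]
    symm
    refine Finset.sum_eq_zero fun k _ => ?_
    by_cases hi : 0 ≤ i ∧ i ≤ d
    · rw [intPad_eq_zero N (by omega), mul_zero]
    · rw [intPad_eq_zero M (by omega), zero_mul]

/-- Product formula when the left factor is tridiagonal. -/
lemma intPad_mul (M N : Matrix (Fin (d + 1)) (Fin (d + 1)) F)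
    (hM : ∀ i j : ℤ, (j < i - 1 ∨ i + 1 < j) → M.intPad i j = 0) (i j : ℤ) :
    (M * N).intPad i j = M.intPad i (i - 1) * N.intPad (i - 1) j +
      M.intPad i i * N.intPad i j + M.intPad i (i + 1) * N.intPad (i + 1) j := by
  have h1 : ∑ k ∈ ({i - 1, i, i + 1} : Finset ℤ), M.intPad i k * N.intPad k j =
      M.intPad i (i - 1) * N.intPad (i - 1) j +
      M.intPad i i * N.intPad i j + M.intPad i (i + 1) * N.intPad (i + 1) j := by
    rw [Finset.sum_insert (by simp; omega), Finset.sum_insert (by simp), Finset.sum_singleton,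
      add_assoc]
  rw [← h1, intPad_mul_eq_sum]
  refine (Finset.sum_subset_zero_on_sdiff (Finset.inter_subset_left (s₂ := {i - 1, i, i + 1}))
    ?_ fun _ _ => rfl).symm.trans
    (Finset.sum_subset_zero_on_sdiff Finset.inter_subset_right ?_ fun _ _ => rfl)
  · intro k hk
    simp only [Finset.mem_sdiff, Finset.mem_inter, Finset.mem_insert,
      Finset.mem_singleton, Finset.mem_Icc] at hk
    rw [hM i k (by omega), zero_mul]
  · intro k hk
    simp only [Finset.mem_sdiff, Finset.mem_inter, Finset.mem_insert,
      Finset.mem_singleton, Finset.mem_Icc] at hk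
    rw [intPad_eq_zero M (by omega), zero_mul]

end intPad

section tridiagonal

variable {F : Type*} [Field F] {d : ℕ} {x y z : ℕ → F}
  {M : Matrix (Fin (d + 1)) (Fin (d + 1)) F}

/-- The extended entries of a tridiagonal matrix. -/
lemma intPad_tridiagonal (hM : ∀ i j : Fin (d + 1), M i j =
      if (i : ℕ) = (j : ℕ) then x (i : ℕ)
      else if (i : ℕ) = (j : ℕ) + 1 then z (i : ℕ)
      else if (j : ℕ) = (i : ℕ) + 1 then y (j : ℕ) else 0) :
    (∀ i j : ℤ, (j < i - 1 ∨ i + 1 < j) → M.intPad i j = 0) ∧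
    (∀ i j : ℤ, i = j → 0 ≤ i → i ≤ d → M.intPad i j = x i.toNat) ∧
    (∀ i j : ℤ, i = j + 1 → 0 ≤ j → i ≤ d → M.intPad i j = z i.toNat) ∧
    (∀ i j : ℤ, j = i + 1 → 0 ≤ i → j ≤ d → M.intPad i j = y j.toNat) := by
  refine ⟨fun i j h => ?_, fun i j h h0 h1 => ?_, fun i j h h0 h1 => ?_, fun i j h h0 h1 => ?_⟩
  · unfold intPad
    split_ifs with h'
    · rw [hM, if_neg, if_neg, if_neg] <;> dsimp only <;> omega
    · rfl
  · rw [intPad, dif_pos (by omega), hM, if_pos]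
    dsimp only; omega
  · rw [intPad, dif_pos (by omega), hM, if_neg, if_pos] <;> dsimp only <;> omega
  · rw [intPad, dif_pos (by omega), hM, if_neg, if_neg, if_pos] <;> dsimp only <;> omega

end tridiagonal

end Matrix

namespace AskeyWilson

section entries

open Matrix

variable {F : Type*} [Field F] {d : ℕ} {x y z : ℕ → F} {θ : ℤ → F} {β ρ ω η : F}
  {A As : Matrix (Fin (d + 1)) (Fin (d + 1)) F}

/-- The extended entries of a lower bidiagonal matrix with unit subdiagonal. -/
lemma intPad_lowerBidiagonal (hA : ∀ i j : Fin (d + 1), A i j =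
      if (i : ℕ) = (j : ℕ) then θ (i : ℕ)
      else if (i : ℕ) = (j : ℕ) + 1 then 1 else 0) :
    (∀ i j : ℤ, (j < i - 1 ∨ i + 1 < j) → A.intPad i j = 0) ∧
    (∀ i j : ℤ, i = j → 0 ≤ i → i ≤ d → A.intPad i j = θ i) ∧
    (∀ i j : ℤ, i = j + 1 → 0 ≤ j → i ≤ d → A.intPad i j = 1) ∧
    (∀ i j : ℤ, j = i + 1 → A.intPad i j = 0) := by
  have h := intPad_tridiagonal (M := A) (x := fun n => θ n) (y := 0) (z := 1) (by simpa using hA)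
  refine ⟨h.1, fun i j hij h0 h1 => ?_, fun i j hij h0 h1 => ?_, fun i j hij => ?_⟩
  · rw [h.2.1 i j hij h0 h1, Int.toNat_of_nonneg h0]
  · rw [h.2.2.1 i j hij h0 h1]; rfl
  · by_cases h' : 0 ≤ i ∧ j ≤ d
    · rw [h.2.2.2 i j hij h'.1 h'.2]; rfl
    · exact intPad_eq_zero _ (by omega)

/-- The diagonal entries of the first Askey–Wilson relation. -/
lemma aw1_diag (hy0 : y 0 = 0) (hyd1 : y (d + 1) = 0)
    (hA : ∀ i j : Fin (d + 1), A i j =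
      if (i : ℕ) = (j : ℕ) then θ (i : ℕ)
      else if (i : ℕ) = (j : ℕ) + 1 then 1 else 0)
    (hAs : ∀ i j : Fin (d + 1), As i j =
      if (i : ℕ) = (j : ℕ) then x (i : ℕ)
      else if (i : ℕ) = (j : ℕ) + 1 then z (i : ℕ)
      else if (j : ℕ) = (i : ℕ) + 1 then y (j : ℕ) else 0)
    (hAW1 : A ^ 2 * As - β • (A * As * A) + As * A ^ 2 - ρ • As =
      ω • A + η • (1 : Matrix (Fin (d + 1)) (Fin (d + 1)) F)) (hd : 1 ≤ d) (i : ℕ) (hi : i ≤ d) :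
    y i * (θ (i - 1) + θ i - β * θ i) + y (i + 1) * (θ (i + 1) + θ i - β * θ i) +
      ((2 - β) * θ i ^ 2 - ρ) * x i = ω * θ i + η := by
  obtain ⟨a0, a1, a2, a3⟩ := intPad_lowerBidiagonal hA
  obtain ⟨s0, s1, s2, s3⟩ := intPad_tridiagonal hAs
  have h := congrArg (fun M => M.intPad i i) hAW1
  simp only [pow_two, Matrix.mul_assoc, intPad_add, intPad_sub, intPad_smul, intPad_mul A _ a0,
    intPad_mul As _ s0] at h
  rcases Nat.eq_zero_or_pos i with rfl | hi0
  · simp (disch := omega) only [intPad_eq_zero, intPad_one, a0, a1, a2, a3, s0, s1, s2, s3] at h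
    simp at h ⊢
    linear_combination h + hy0 * (θ (-1) + θ 0 - β * θ 0)
  rcases hi.lt_or_eq with hid | rfl
  · simp (disch := omega) only [intPad_one, a0, a1, a2, a3, s0, s1, s2, s3] at h
    simp at h ⊢
    linear_combination h
  · simp (disch := omega) only [intPad_eq_zero, intPad_one, a0, a1, a2, a3, s0, s1, s2, s3] at h
    simp at h ⊢
    linear_combination h + hyd1 * (θ (i + 1) + θ i - β * θ i)

/-- The entries of the first Askey–Wilson relation two steps below the diagonal. -/
lemma aw1_subsub
    (hA : ∀ i j : Fin (d + 1), A i j =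
      if (i : ℕ) = (j : ℕ) then θ (i : ℕ)
      else if (i : ℕ) = (j : ℕ) + 1 then 1 else 0)
    (hAs : ∀ i j : Fin (d + 1), As i j =
      if (i : ℕ) = (j : ℕ) then x (i : ℕ)
      else if (i : ℕ) = (j : ℕ) + 1 then z (i : ℕ)
      else if (j : ℕ) = (i : ℕ) + 1 then y (j : ℕ) else 0)
    (hAW1 : A ^ 2 * As - β • (A * As * A) + As * A ^ 2 - ρ • As =
      ω • A + η • (1 : Matrix (Fin (d + 1)) (Fin (d + 1)) F)) (i : ℕ) (hi : i + 2 ≤ d) :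
    x i - β * x (i + 1) + x (i + 2) + z (i + 1) * (θ (i + 2) + θ (i + 1) - β * θ i) +
      z (i + 2) * (θ (i + 1) + θ i - β * θ (i + 2)) = 0 := by
  obtain ⟨a0, a1, a2, a3⟩ := intPad_lowerBidiagonal hA
  obtain ⟨s0, s1, s2, s3⟩ := intPad_tridiagonal hAs
  have h := congrArg (fun M => M.intPad (i + 2) i) hAW1
  simp only [pow_two, Matrix.mul_assoc, intPad_add, intPad_sub, intPad_smul, intPad_mul A _ a0,
    intPad_mul As _ s0] at h
  simp (disch := omega) only [intPad_one, a0, a1, a2, a3, s0, s1, s2, s3] at h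
  have e1 : ((i : ℤ) + 2 - 1) = i + 1 := by ring
  have e2 : ((i : ℤ) + 2).toNat = i + 2 := by omega
  have e3 : ((i : ℤ) + 1).toNat = i + 1 := by omega
  simp [e1, e2, e3] at h ⊢
  linear_combination h

/-- The `(2, 0)` entry of the second Askey–Wilson relation. -/
lemma aw2_two_zero (hd : 2 ≤ d)
    (hA : ∀ i j : Fin (d + 1), A i j =
      if (i : ℕ) = (j : ℕ) then θ (i : ℕ)
      else if (i : ℕ) = (j : ℕ) + 1 then 1 else 0)
    (hAs : ∀ i j : Fin (d + 1), As i j =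
      if (i : ℕ) = (j : ℕ) then x (i : ℕ)
      else if (i : ℕ) = (j : ℕ) + 1 then z (i : ℕ)
      else if (j : ℕ) = (i : ℕ) + 1 then y (j : ℕ) else 0)
    (hAW2 : As ^ 2 * A - β • (As * A * As) + A * As ^ 2 - ρ • A =
      ω • As + η • (1 : Matrix (Fin (d + 1)) (Fin (d + 1)) F)) :
    z 2 * (x 2 + x 1 - β * x 0) + z 1 * (x 1 + x 0 - β * x 2) +
      z 1 * z 2 * (θ 0 - β * θ 1 + θ 2) = 0 := by
  obtain ⟨a0, a1, a2, a3⟩ := intPad_lowerBidiagonal hA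
  obtain ⟨s0, s1, s2, s3⟩ := intPad_tridiagonal hAs
  have h := congrArg (fun M => M.intPad 2 0) hAW2
  simp only [pow_two, Matrix.mul_assoc, intPad_add, intPad_sub, intPad_smul, intPad_mul A _ a0,
    intPad_mul As _ s0] at h
  simp (disch := omega) only [intPad_one, a0, a1, a2, a3, s0, s1, s2, s3] at h
  simp at h ⊢
  linear_combination h

/-- The `(1, 0)` entry of the second Askey–Wilson relation. -/
lemma aw2_one_zero (hd : 2 ≤ d)
    (hA : ∀ i j : Fin (d + 1), A i j =
      if (i : ℕ) = (j : ℕ) then θ (i : ℕ)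
      else if (i : ℕ) = (j : ℕ) + 1 then 1 else 0)
    (hAs : ∀ i j : Fin (d + 1), As i j =
      if (i : ℕ) = (j : ℕ) then x (i : ℕ)
      else if (i : ℕ) = (j : ℕ) + 1 then z (i : ℕ)
      else if (j : ℕ) = (i : ℕ) + 1 then y (j : ℕ) else 0)
    (hAW2 : As ^ 2 * A - β • (As * A * As) + A * As ^ 2 - ρ • A =
      ω • As + η • (1 : Matrix (Fin (d + 1)) (Fin (d + 1)) F)) :
    z 1 * (x 1 + x 0) * (θ 0 + θ 1) - β * z 1 * (x 1 * θ 1 + x 0 * θ 0) +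
      x 1 ^ 2 - β * x 1 * x 0 + x 0 ^ 2 + 2 * z 1 * y 1 + z 2 * y 2 - β * z 1 * y 2
      = ρ + ω * z 1 := by
  obtain ⟨a0, a1, a2, a3⟩ := intPad_lowerBidiagonal hA
  obtain ⟨s0, s1, s2, s3⟩ := intPad_tridiagonal hAs
  have h := congrArg (fun M => M.intPad 1 0) hAW2
  simp only [pow_two, Matrix.mul_assoc, intPad_add, intPad_sub, intPad_smul, intPad_mul A _ a0,
    intPad_mul As _ s0] at h
  simp (disch := omega) only [intPad_eq_zero, intPad_one, a0, a1, a2, a3, s0, s1, s2, s3] at h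
  simp at h ⊢
  linear_combination h

end entries

section scalars

variable {F : Type*} [Field F]

/-- Closed form of the diagonal entries. -/
lemma x_closed_form {d : ℕ} (hd : 2 ≤ d) {q Q a a' ζ : F} (hq : q ≠ 0) (hQ : Q ≠ 0)
    (hζ : ζ ≠ 0) (h6 : q ^ 6 ≠ 1) {θ : ℤ → F} {x z : ℕ → F}
    (hθ : ∀ i : ℤ, θ i = a * (q ^ 2) ^ i / Q + a' * Q / (q ^ 2) ^ i)
    (hz : ∀ i : ℕ, 1 ≤ i → i ≤ d → z i = ζ / (q ^ 2) ^ i)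
    (hx : ∀ i : ℕ, i + 2 ≤ d → x i - (q ^ 2 + 1 / q ^ 2) * x (i + 1) + x (i + 2) +
      z (i + 1) * (θ (i + 2) + θ (i + 1) - (q ^ 2 + 1 / q ^ 2) * θ i) +
      z (i + 2) * (θ (i + 1) + θ i - (q ^ 2 + 1 / q ^ 2) * θ (i + 2)) = 0)
    (hx' : z 2 * (x 2 + x 1 - (q ^ 2 + 1 / q ^ 2) * x 0) +
      z 1 * (x 1 + x 0 - (q ^ 2 + 1 / q ^ 2) * x 2) +
      z 1 * z 2 * (θ 0 - (q ^ 2 + 1 / q ^ 2) * θ 1 + θ 2) = 0)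
    (i : ℕ) (hi : i ≤ d) :
    x i = (x 0 - a' * Q * ζ * (1 + 1 / q ^ 2)) / (q ^ 2) ^ i +
      a' * Q * ζ * (1 + 1 / q ^ 2) / ((q ^ 2) ^ i) ^ 2 := by
  induction i using Nat.twoStepInduction with
  | zero => simp
  | one =>
    have e := hx 0 (by omega)
    rw [zero_add, zero_add, hz 1 le_rfl (by omega), hz 2 (by omega) hd] at e
    rw [hz 1 le_rfl (by omega), hz 2 (by omega) hd] at hx'
    simp only [hθ, Nat.cast_zero, zero_add, pow_one,
      zpow_ofNat] at e hx' ⊢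
    have h6' : q ^ 6 - 1 ≠ 0 := sub_ne_zero.mpr h6
    rw [← sub_eq_zero]
    refine (mul_eq_zero.mp ?_).resolve_left h6'
    rw [← mul_zero (-q ^ 4), ← add_zero (0 : F)]
    nth_rw 1 [← e]
    rw [← zero_div ζ, ← hx']
    field_simp
    ring
  | more i ih0 ih1 =>
    have e := hx i hi
    have ht : (q ^ 2) ^ i ≠ 0 := pow_ne_zero _ (pow_ne_zero _ hq)
    have hq2 : q ^ 2 ≠ 0 := pow_ne_zero _ hq
    rw [ih0 (by omega), ih1 (by omega), hz (i + 1) (by omega) (by omega),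
      hz (i + 2) (by omega) hi, hθ, hθ, hθ, zpow_add₀ hq2, zpow_add₀ hq2] at e
    simp only [zpow_natCast, pow_add, zpow_ofNat, pow_one] at e ⊢
    generalize (q ^ 2) ^ i = t at *
    generalize x 0 = x0 at *
    rw [← sub_eq_zero]
    rw [← e]
    field_simp
    ring

/-- Closed form of the superdiagonal entries. -/
lemma y_closed_form {d : ℕ} {q Q a a' ζ c s ξ : F} (hq : q ≠ 0) (hQ : Q ≠ 0)
    (h2 : q ^ 2 ≠ 1) {θ : ℤ → F} {x y : ℕ → F} {ω η : F}
    (hθ : ∀ i : ℤ, θ i = a * (q ^ 2) ^ i / Q + a' * Q / (q ^ 2) ^ i)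
    (hx : ∀ i : ℕ, i ≤ d → x i = c / (q ^ 2) ^ i +
      a' * Q * ζ * (1 + 1 / q ^ 2) / ((q ^ 2) ^ i) ^ 2)
    (hω : ω = (q - 1 / q) ^ 2 * ((Q * q + 1 / (Q * q)) * ξ - (a + a') * s))
    (hη : η = -((q - 1 / q) * (q ^ 2 - 1 / q ^ 2) *
      ((a + a') * ξ - a * a' * s * (Q * q + 1 / (Q * q)))))
    (hD : ∀ i : ℕ, i ≤ d → θ i ≠ θ (i - 1))
    (hy0 : y 0 = 0)
    (hy : ∀ i : ℕ, i ≤ d → y i * (θ (i - 1) + θ i - (q ^ 2 + 1 / q ^ 2) * θ i) +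
      y (i + 1) * (θ (i + 1) + θ i - (q ^ 2 + 1 / q ^ 2) * θ i) +
      ((2 - (q ^ 2 + 1 / q ^ 2)) * θ i ^ 2 + a * a' * (q ^ 2 - 1 / q ^ 2) ^ 2) * x i = ω * θ i + η)
    (i : ℕ) (hi : i ≤ d + 1) :
    y i = (ξ / (Q * q) - a * s) * (q ^ 2) ^ i - ((Q * q + 1 / (Q * q)) * ξ - (a + a') * s) +
      (ξ * (Q * q) - a' * s) / (q ^ 2) ^ i +
      (a * (q ^ 2) ^ i / (Q * q) - a' * (Q * q) / (q ^ 2) ^ i) *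
        (q * c * (1 - 1 / (q ^ 2) ^ i) + a' * Q * ζ * q * (1 - 1 / ((q ^ 2) ^ i) ^ 2)) := by
  induction i with
  | zero => simp [hy0]; ring
  | succ i ih =>
    have e := hy i (by omega)
    have ht : (q ^ 2) ^ i ≠ 0 := pow_ne_zero _ (pow_ne_zero _ hq)
    have hq2 : q ^ 2 ≠ 0 := pow_ne_zero _ hq
    have h2' : q ^ 2 - 1 ≠ 0 := sub_ne_zero.mpr h2
    have hD' := sub_ne_zero.mpr (hD i (by omega))
    rw [hθ, hθ, zpow_sub₀ hq2] at hD'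
    rw [ih (by omega), hx i (by omega), hθ, hθ, hθ, zpow_add₀ hq2, zpow_sub₀ hq2, hω, hη] at e
    simp only [zpow_natCast, pow_add, zpow_ofNat, pow_one] at e hD' ⊢
    generalize (q ^ 2) ^ i = t at *
    generalize y (i + 1) = y1 at *
    rw [← sub_eq_zero]
    refine (mul_eq_zero.mp ?_).resolve_left hD'
    rw [← sub_eq_zero] at e
    rw [← e]
    field_simp
    ring

/-- The boundary conditions on the superdiagonal closed form, with the `(1, 0)` entry of the second
Askey–Wilson relation, determine the first diagonal entry and `ξ`. -/
lemma x0_and_xi_eq {q Q a a' b b' ζ c ξ ω x0 x1 y1 y2 θ0 θ1 ρ : F} (hq : q ≠ 0) (hQ : Q ≠ 0)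
    (hζ : ζ ≠ 0) (h4 : q ^ 4 ≠ 1) (hP : (Q * q) ^ 2 ≠ 1) (hne : a * (Q * q) ^ 2 ≠ a')
    (hθ0 : θ0 = a / Q + a' * Q) (hθ1 : θ1 = a * q ^ 2 / Q + a' * Q / q ^ 2)
    (hω : ω = (q - 1 / q) ^ 2 * ((Q * q + 1 / (Q * q)) * ξ - (a + a') * (b + b')))
    (hx0 : x0 = c + a' * Q * ζ * (1 + 1 / q ^ 2))
    (hx1 : x1 = c / q ^ 2 + a' * Q * ζ * (1 + 1 / q ^ 2) / (q ^ 2) ^ 2)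
    (hρ : ρ = -(b * b') * (q ^ 2 - 1 / q ^ 2) ^ 2)
    {y : F → F} (hy : ∀ t, y t = (ξ / (Q * q) - a * (b + b')) * t -
      ((Q * q + 1 / (Q * q)) * ξ - (a + a') * (b + b')) +
      (ξ * (Q * q) - a' * (b + b')) / t +
      (a * t / (Q * q) - a' * (Q * q) / t) *
        (q * c * (1 - 1 / t) + a' * Q * ζ * q * (1 - 1 / t ^ 2)))
    (hy1 : y1 = y (q ^ 2)) (hy2 : y2 = y ((q ^ 2) ^ 2)) (hyd : y ((Q * q) ^ 2) = 0)
    (h : ζ / q ^ 2 * (x1 + x0) * (θ0 + θ1) -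
        (q ^ 2 + 1 / q ^ 2) * (ζ / q ^ 2) * (x1 * θ1 + x0 * θ0) +
      x1 ^ 2 - (q ^ 2 + 1 / q ^ 2) * x1 * x0 + x0 ^ 2 + 2 * (ζ / q ^ 2) * y1 +
      ζ / (q ^ 2) ^ 2 * y2 - (q ^ 2 + 1 / q ^ 2) * (ζ / q ^ 2) * y2 = ρ + ω * (ζ / q ^ 2)) :
    x0 = a' * (Q - 1 / Q) * (ζ / q ^ 2) + (b + b') * Q ∧
      ξ = a * a' * ζ / (Q * q) + b * b' * (Q * q) / ζ := by
  have hξ : ζ * (ξ / (Q * q) - a * (b + b') + a * (c / Q + a' * ζ)) = b * b' := by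
    have h4' : (q ^ 4 - 1) ^ 2 ≠ 0 := pow_ne_zero _ (sub_ne_zero.mpr h4)
    rw [← sub_eq_zero]
    refine (mul_eq_zero.mp ?_).resolve_left h4'
    rw [← sub_eq_zero] at h
    rw [← mul_zero (-q ^ 4), ← h, hy1, hy2, hy, hy, hω, hθ0, hθ1, hρ, hx0, hx1]
    field_simp
    ring
  have hc : q * c = (b + b') * (Q * q) - a' * ζ * (Q * q + 1 / (Q * q)) := by
    have hP' : (Q * q) ^ 2 - 1 ≠ 0 := sub_ne_zero.mpr hP
    have hne' : a * (Q * q) ^ 2 - a' ≠ 0 := sub_ne_zero.mpr hne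
    rw [← sub_eq_zero]
    refine (mul_eq_zero.mp ?_).resolve_left (mul_ne_zero hP' hne')
    rw [← mul_zero ((Q * q) ^ 3), ← hyd, hy]
    field_simp
    ring
  have hc' : c = ((b + b') * (Q * q) - a' * ζ * (Q * q + 1 / (Q * q))) / q := by
    rw [← hc]; field_simp
  subst hc'
  constructor
  · rw [hx0]
    field_simp
    ring
  · rw [← hξ]
    field_simp
    ring

end scalars

end AskeyWilson

/-- stmt18 of the paper, in the Askey–Wilson setting. -/
theorem stmt18 {F : Type*} [Field F] [IsAlgClosed F] {d : ℕ} (hd : 3 ≤ d)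
    (q a a' b b' ξ : F) (hq : q ≠ 0)
    (hqru : ∀ n : ℕ, 1 ≤ n → q ^ n ≠ 1)
    (θ : ℤ → F)
    (hθ : ∀ i : ℤ, θ i = a * q ^ (2 * i - (d : ℤ)) + a' * q ^ ((d : ℤ) - 2 * i))
    (hθdist : ∀ i j : ℕ, i ≤ d → j ≤ d → i ≠ j → θ i ≠ θ j)
    (β ρ ρs ω η ηs : F)
    (hβ : β = q ^ (2 : ℤ) + q ^ (-2 : ℤ))
    (hρ : ρ = -(a * a') * (q ^ (2 : ℤ) - q ^ (-2 : ℤ)) ^ 2)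
    (hρs : ρs = -(b * b') * (q ^ (2 : ℤ) - q ^ (-2 : ℤ)) ^ 2)
    (hω : ω = (q - q⁻¹) ^ 2 *
      ((q ^ ((d : ℤ) + 1) + q ^ (-(d : ℤ) - 1)) * ξ - (a + a') * (b + b')))
    (hη : η = -((q - q⁻¹) * (q ^ (2 : ℤ) - q ^ (-2 : ℤ)) *
      ((a + a') * ξ - a * a' * (b + b') * (q ^ ((d : ℤ) + 1) + q ^ (-(d : ℤ) - 1)))))
    (hηs : ηs = -((q - q⁻¹) * (q ^ (2 : ℤ) - q ^ (-2 : ℤ)) *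
      ((b + b') * ξ - b * b' * (a + a') * (q ^ ((d : ℤ) + 1) + q ^ (-(d : ℤ) - 1)))))
    (x y z : ℕ → F)
    (hyz : ∀ i : ℕ, 1 ≤ i → i ≤ d → y i * z i ≠ 0)
    (hy0 : y 0 = 0) (hyd1 : y (d + 1) = 0)
    (A As : Matrix (Fin (d + 1)) (Fin (d + 1)) F)
    (hA : ∀ i j : Fin (d + 1), A i j =
      if (i : ℕ) = (j : ℕ) then θ (i : ℕ)
      else if (i : ℕ) = (j : ℕ) + 1 then 1 else 0)
    (hAs : ∀ i j : Fin (d + 1), As i j =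
      if (i : ℕ) = (j : ℕ) then x (i : ℕ)
      else if (i : ℕ) = (j : ℕ) + 1 then z (i : ℕ)
      else if (j : ℕ) = (i : ℕ) + 1 then y (j : ℕ) else 0)
    (hAW1 : A ^ 2 * As - β • (A * As * A) + As * A ^ 2 - ρ • As =
      ω • A + η • (1 : Matrix (Fin (d + 1)) (Fin (d + 1)) F))
    (hAW2 : As ^ 2 * A - β • (As * A * As) + A * As ^ 2 - ρs • A =
      ω • As + ηs • (1 : Matrix (Fin (d + 1)) (Fin (d + 1)) F))
    (hz : ∀ i : ℕ, 1 ≤ i → i ≤ d → z i = z 1 * q ^ ((2 : ℤ) - 2 * (i : ℤ)))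
    (hne : a ≠ a' * q ^ (2 * (d : ℤ) + 2)) (hne' : a' ≠ a * q ^ (2 * (d : ℤ) + 2)) :
    x 0 = a' * (q ^ (d : ℤ) - q ^ (-(d : ℤ))) * z 1 + (b + b') * q ^ (d : ℤ) ∧
    ξ = a * a' * q ^ (1 - (d : ℤ)) * z 1 + b * b' * q ^ ((d : ℤ) - 1) * (z 1)⁻¹ := by
  have hq2 : q ^ 2 ≠ 0 := pow_ne_zero _ hq
  have hQ : q ^ d ≠ 0 := pow_ne_zero _ hq
  have hz1 : z 1 ≠ 0 := right_ne_zero_of_mul (hyz 1 le_rfl (by omega))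
  have hζ : z 1 * q ^ 2 ≠ 0 := mul_ne_zero hz1 hq2
  have hq_sq : ∀ i : ℤ, q ^ (2 * i) = (q ^ 2) ^ i := fun i => by
    rw [zpow_mul, zpow_ofNat]
  have hq_two : q ^ (-2 : ℤ) = 1 / q ^ 2 := by
    rw [zpow_neg, one_div, zpow_ofNat]
  have hP : q ^ ((d : ℤ) + 1) = q ^ d * q := by rw [zpow_add₀ hq, zpow_natCast, zpow_one]
  have hPinv : q ^ (-(d : ℤ) - 1) = 1 / (q ^ d * q) := by
    rw [← neg_add', zpow_neg, hP, one_div]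
  have hP2 : q ^ (2 * (d : ℤ) + 2) = (q ^ d * q) ^ 2 := by
    rw [← hP, ← zpow_natCast, ← zpow_mul]
    congr 1
    push_cast
    ring
  have hθ' : ∀ i : ℤ, θ i = a * (q ^ 2) ^ i / q ^ d + a' * q ^ d / (q ^ 2) ^ i := fun i => by
    rw [hθ, zpow_sub₀ hq, zpow_sub₀ hq, hq_sq, zpow_natCast]
    ring
  have hz' : ∀ i : ℕ, 1 ≤ i → i ≤ d → z i = z 1 * q ^ 2 / (q ^ 2) ^ i := fun i h1 hi => by
    rw [hz i h1 hi, zpow_sub₀ hq, hq_sq, zpow_natCast, zpow_ofNat]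
    ring
  rw [zpow_ofNat, hq_two] at hβ hρ hρs hη hηs
  rw [hP, hPinv] at hω hη hηs
  rw [← one_div] at hω hη hηs
  rw [hP2] at hne hne'
  have hD : ∀ i : ℕ, i ≤ d → θ i ≠ θ (i - 1) := by
    intro i hi h
    rcases Nat.eq_zero_or_pos i with rfl | hi0
    · have h2 : q ^ 2 - 1 ≠ 0 := sub_ne_zero.mpr (hqru 2 (by omega))
      refine hne (sub_eq_zero.mp ((mul_eq_zero.mp ?_).resolve_left h2))
      rw [← sub_eq_zero, hθ', hθ', zpow_sub₀ hq2] at h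
      rw [← mul_zero (q ^ d * q ^ 2), ← h]
      simp only [Nat.cast_zero, zpow_zero, zpow_one]
      field_simp
      ring
    · obtain ⟨j, rfl⟩ := Nat.exists_eq_add_of_le' hi0
      exact hθdist (j + 1) j hi (by omega) (by omega) (by simpa using h)
  have hdiag := AskeyWilson.aw1_diag hy0 hyd1 hA hAs hAW1 (by omega)
  have hsub := AskeyWilson.aw1_subsub hA hAs hAW1
  have h20 := AskeyWilson.aw2_two_zero (by omega) hA hAs hAW2
  have h10 := AskeyWilson.aw2_one_zero (by omega) hA hAs hAW2
  subst hβ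
  have hx := AskeyWilson.x_closed_form (by omega) hq hQ hζ (hqru 6 (by omega)) hθ' hz' hsub h20
  set c := x 0 - a' * q ^ d * (z 1 * q ^ 2) * (1 + 1 / q ^ 2) with hc
  have hy := AskeyWilson.y_closed_form hq hQ (hqru 2 (by omega)) hθ' hx hω hη hD hy0 (fun i hi => by
    rw [← hdiag i hi, hρ]; ring)
  have hz1' : z 1 = z 1 * q ^ 2 / q ^ 2 := by field_simp
  have hz2 := hz' 2 (by omega) (by omega)
  have hV : (q ^ 2) ^ (d + 1) = (q ^ d * q) ^ 2 := by ring
  have key := AskeyWilson.x0_and_xi_eq (x0 := x 0) hq hQ hζ (hqru 4 (by omega)) ?_ (fun h => hne' h.symm)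
    (by simpa using hθ' 0) (by simpa using hθ' 1) hω (by rw [hc]; ring)
    (by simpa using hx 1 (by omega)) hρs (fun t => rfl)
    (by simpa using hy 1 (by omega)) (hy 2 (by omega))
    (by rw [← hV, ← hy (d + 1) le_rfl, hyd1]) (by rw [← hz1', ← hz2]; exact h10)
  · rw [← hz1'] at key
    refine ⟨?_, ?_⟩
    · rw [key.1, zpow_neg, zpow_natCast, one_div]
    · rw [key.2, zpow_sub₀ hq, zpow_sub₀ hq, zpow_natCast, zpow_one]
      field_simp
  · rw [← pow_succ, ← pow_mul]
    exact hqru _ (by omega)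
end
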